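/- Ill-posedness of 3D elastic waves in H³ (Theorem 1.1, lifespan part): There exists a family (U₀^(η), U₁^(η)), indexed by η ∈ (0,1), of smooth compactly supported maps ℝ³ → ℝ³ such that (i) ‖U₀^(η)‖_{Ḣ³(ℝ³)} + ‖U₁^(η)‖_{Ḣ²(ℝ³)} → 0 as η → 0⁺, and (ii) the maximal time of existence of smooth solutions shrinks to zero: for every ε > 0 there exists η₀ ∈ (0,1) such that for every η ∈ (0, η₀) and every T ≥ ε, there is no U ∈ C^∞(ℝ³ × [0,T); ℝ³) solving the 3D elastic wave system with U(·,0) = U₀^(η) and ∂_tU(·,0) = U₁^(η). -/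

import Mathlib

noncomputable section

open MeasureTheory

/-- Spatial partial derivative `∂_i f` on `ℝ³`. -/
def pd (f : (Fin 3 → ℝ) → ℝ) (i : Fin 3) (x : Fin 3 → ℝ) : ℝ :=
  fderiv ℝ f x (Pi.single i 1)

/-- The null form `Q_{ij}(f,g) = ∂_i f ∂_j g − ∂_j f ∂_i g`. -/
def Qnull (i j : Fin 3) (f g : (Fin 3 → ℝ) → ℝ) (x : Fin 3 → ℝ) : ℝ :=
  pd f i x * pd g j x - pd f j x * pd g i x

/-- Divergence of a spatial vector field on `ℝ³`. -/
def divg (W : Fin 3 → (Fin 3 → ℝ) → ℝ) (x : Fin 3 → ℝ) : ℝ :=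
  ∑ j : Fin 3, pd (W j) j x

/-- Curl of a spatial vector field on `ℝ³`:
`(curl W)_i = ∂_{i+1} W_{i+2} − ∂_{i+2} W_{i+1}` (cyclic indices). -/
def curl3 (W : Fin 3 → (Fin 3 → ℝ) → ℝ) (i : Fin 3) (x : Fin 3 → ℝ) : ℝ :=
  pd (W (i + 2)) (i + 1) x - pd (W (i + 1)) (i + 2) x

/-- The `i`-th component of the quadratic nonlinearity
`N = σ₀∇((div U)²) + σ₁(∇(|curl U|²) − 2 curl((div U)·(curl U))) + Q(U,∇U)`,
evaluated on a time slice `V` of the displacement. -/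
def Ncomp (σ₀ σ₁ σ₂ σ₃ σ₄ : ℝ) (V : Fin 3 → (Fin 3 → ℝ) → ℝ) (i : Fin 3)
    (x : Fin 3 → ℝ) : ℝ :=
  σ₀ * pd (fun y => (divg V y) ^ 2) i x
    + σ₁ * (pd (fun y => ∑ k : Fin 3, (curl3 V k y) ^ 2) i x
        - 2 * curl3 (fun k y => divg V y * curl3 V k y) i x)
    + (σ₂ * ∑ j : Fin 3, ∑ k : Fin 3,
          (2 * Qnull j k (fun y => pd (V i) j y) (V k) x
            + Qnull j k (fun y => pd (V j) k y) (V i) x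
            + Qnull i j (fun y => pd (V k) j y) (V k) x)
      + σ₃ * ∑ j : Fin 3, ∑ k : Fin 3,
          (2 * Qnull i j (fun y => pd (V k) k y) (V j) x
            + Qnull j i (fun y => pd (V j) k y) (V k) x)
      + σ₄ * ∑ j : Fin 3, ∑ k : Fin 3,
          (Qnull i k (V k) (fun y => pd (V j) j y) x
            - Qnull j k (V j) (fun y => pd (V k) i y) x))

/-- The 3D elastic wave system
`∂_t²U − c₂²ΔU − (c₁²−c₂²)∇(div U) = N(∇U,∇²U)` holds at the spacetime point `(x,t)`. -/
def ElasticEq (c₁ c₂ σ₀ σ₁ σ₂ σ₃ σ₄ : ℝ) (U : Fin 3 → (Fin 3 → ℝ) → ℝ → ℝ)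
    (x : Fin 3 → ℝ) (t : ℝ) : Prop :=
  ∀ i : Fin 3,
    deriv (fun s => deriv (fun s' => U i x s') s) t
      - c₂ ^ 2 * ∑ j : Fin 3, pd (fun y => pd (fun y' => U i y' t) j y) j x
      - (c₁ ^ 2 - c₂ ^ 2) * pd (fun y => divg (fun j y' => U j y' t) y) i x
    = Ncomp σ₀ σ₁ σ₂ σ₃ σ₄ (fun j y => U j y t) i x

/-- Homogeneous Sobolev seminorm `‖f‖_{Ḣᵏ(ℝ³)} = (∫ |∇ᵏf|²)^{1/2}` for `f : ℝ³ → ℝ³`. -/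
def sobolevSemi (k : ℕ) (f : (Fin 3 → ℝ) → Fin 3 → ℝ) : ℝ :=
  (∫ x : Fin 3 → ℝ, ‖iteratedFDeriv ℝ k f x‖ ^ 2) ^ ((1 : ℝ) / 2)

/-- Kronecker delta on `Fin 3`. -/
def kron (i j : Fin 3) : ℝ := if i = j then 1 else 0

/-- Coefficients of the linear part of the elastic operator. -/
def linCoeff (c₁ c₂ : ℝ) (i j l k : Fin 3) : ℝ :=
  c₂ ^ 2 * (kron i l * kron j k) + (c₁ ^ 2 - c₂ ^ 2) * (kron i j * kron l k)

/-- Coefficients, linear in the displacement gradient `X`, of the principal part of the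
quadratic nonlinearity; symmetric under `(i, j) ↔ (l, k)`. -/
def quadCoeff (σ₀ σ₁ σ₂ σ₃ σ₄ : ℝ) (X : Fin 3 → Fin 3 → ℝ) (i j l k : Fin 3) : ℝ :=
  2 * σ₀ * ((∑ m, X m m) * (kron i j * kron l k))
  + σ₁ * (2 * (kron i j * (X l k - X k l) + kron l k * (X i j - X j i))
      - 2 * (∑ m, X m m) * (kron i j * kron l k - kron i l * kron j k))
  + σ₂ * (2 * (∑ m, X m m) * (kron i l * kron j k) - kron i l * (X k j + X j k)
      + kron i j * X l k + kron l k * X i j - kron j k * (X i l + X l i))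
  + (σ₃ - σ₄) * (2 * (∑ m, X m m) * (kron i j * kron l k)
      - kron i j * X k l - kron l k * X j i)

theorem kron_comm (i j : Fin 3) : kron i j = kron j i := by
  simp [kron, eq_comm]

theorem linCoeff_symm (c₁ c₂ : ℝ) (i j l k : Fin 3) :
    linCoeff c₁ c₂ i j l k = linCoeff c₁ c₂ l k i j := by
  unfold linCoeff
  rw [kron_comm i l, kron_comm j k]; ring

theorem quadCoeff_symm (σ₀ σ₁ σ₂ σ₃ σ₄ : ℝ) (X : Fin 3 → Fin 3 → ℝ) (i j l k : Fin 3) :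
    quadCoeff σ₀ σ₁ σ₂ σ₃ σ₄ X i j l k = quadCoeff σ₀ σ₁ σ₂ σ₃ σ₄ X l k i j := by
  unfold quadCoeff
  rw [kron_comm i l, kron_comm j k]; ring

theorem pd_mul {f g : (Fin 3 → ℝ) → ℝ} {x : Fin 3 → ℝ} (i : Fin 3)
    (hf : DifferentiableAt ℝ f x) (hg : DifferentiableAt ℝ g x) :
    pd (fun y => f y * g y) i x = f x * pd g i x + pd f i x * g x := by
  unfold pd
  rw [fderiv_fun_mul hf hg]
  simp [mul_comm]

theorem pd_pow_two {f : (Fin 3 → ℝ) → ℝ} {x : Fin 3 → ℝ} (i : Fin 3)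
    (hf : DifferentiableAt ℝ f x) :
    pd (fun y => f y ^ 2) i x = 2 * f x * pd f i x := by
  simp only [pow_two]
  rw [pd_mul i hf hf]; ring

theorem pd_sub {f g : (Fin 3 → ℝ) → ℝ} {x : Fin 3 → ℝ} (i : Fin 3)
    (hf : DifferentiableAt ℝ f x) (hg : DifferentiableAt ℝ g x) :
    pd (fun y => f y - g y) i x = pd f i x - pd g i x := by
  unfold pd
  rw [fderiv_fun_sub hf hg]; rfl

theorem pd_sum {ι : Type*} [Fintype ι] {f : ι → (Fin 3 → ℝ) → ℝ} {x : Fin 3 → ℝ} (i : Fin 3)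
    (hf : ∀ a, DifferentiableAt ℝ (f a) x) :
    pd (fun y => ∑ a, f a y) i x = ∑ a, pd (f a) i x := by
  unfold pd
  rw [fderiv_fun_sum fun a _ => hf a]
  simp

theorem differentiable_pd {f : (Fin 3 → ℝ) → ℝ} (hf : ContDiff ℝ 2 f) (i : Fin 3) :
    Differentiable ℝ (fun y => pd f i y) := by
  unfold pd
  exact ((hf.fderiv_right (m := 1) (by norm_num)).clm_apply contDiff_const).differentiable
    (by norm_num)

theorem pd_pd_comm {f : (Fin 3 → ℝ) → ℝ} (hf : ContDiff ℝ 2 f) (i j : Fin 3) (x : Fin 3 → ℝ) :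
    pd (fun y => pd f i y) j x = pd (fun y => pd f j y) i x := by
  have hd : DifferentiableAt ℝ (fderiv ℝ f) x :=
    (hf.fderiv_right (m := 1) (by norm_num)).differentiable (by norm_num) x
  have h := (hf.contDiffAt (x := x)).isSymmSndFDerivAt (by simp)
  unfold pd
  rw [fderiv_clm_apply hd (differentiableAt_const _), fderiv_clm_apply hd (differentiableAt_const _)]
  simpa using h.eq _ _

theorem Ncomp_eq (σ₀ σ₁ σ₂ σ₃ σ₄ : ℝ) (V : Fin 3 → (Fin 3 → ℝ) → ℝ)
    (hV : ∀ i, ContDiff ℝ 2 (V i)) (i : Fin 3) (x : Fin 3 → ℝ) :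
    Ncomp σ₀ σ₁ σ₂ σ₃ σ₄ V i x
      = ∑ j, ∑ l, ∑ k, quadCoeff σ₀ σ₁ σ₂ σ₃ σ₄ (fun a b => pd (V a) b x) i j l k
          * pd (fun y => pd (V l) j y) k x := by
  have hd : ∀ i j, Differentiable ℝ (fun y => pd (V i) j y) :=
    fun i j => differentiable_pd (hV i) j
  have hdiv : Differentiable ℝ (fun y => divg V y) := by
    unfold divg; fun_prop
  have hcurl : ∀ k, Differentiable ℝ (fun y => curl3 V k y) := by
    intro k; unfold curl3
    exact (hd _ _).sub (hd _ _)
  have pdiv : ∀ k, pd (fun y => divg V y) k x = ∑ j, pd (fun y => pd (V j) j y) k x := by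
    intro k
    simp only [divg]
    exact pd_sum k fun j => hd j j x
  have pcurl : ∀ m k, pd (fun y => curl3 V m y) k x
      = pd (fun y => pd (V (m+2)) (m+1) y) k x - pd (fun y => pd (V (m+1)) (m+2) y) k x := by
    intro m k
    simp only [curl3]
    rw [pd_sub k (hd _ _ x) (hd _ _ x)]
  have pcsq : pd (fun y => ∑ k : Fin 3, (curl3 V k y) ^ 2) i x
      = ∑ k, 2 * curl3 V k x * pd (fun y => curl3 V k y) i x := by
    rw [pd_sum (f := fun k y => curl3 V k y ^ 2) i fun k => ((hcurl k).pow 2) x]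
    exact Finset.sum_congr rfl fun k _ => pd_pow_two i (hcurl k x)
  unfold Ncomp
  rw [pd_pow_two i (hdiv x), pcsq]
  have e1 : curl3 (fun k y => divg V y * curl3 V k y) i x
      = (divg V x * pd (fun y => curl3 V (i+2) y) (i+1) x
          + pd (fun y => divg V y) (i+1) x * curl3 V (i+2) x)
        - (divg V x * pd (fun y => curl3 V (i+1) y) (i+2) x
          + pd (fun y => divg V y) (i+2) x * curl3 V (i+1) x) := by
    change pd (fun y => divg V y * curl3 V (i + 2) y) (i + 1) x
      - pd (fun y => divg V y * curl3 V (i + 1) y) (i + 2) x = _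
    rw [pd_mul _ (hdiv x) (hcurl _ x), pd_mul _ (hdiv x) (hcurl _ x)]
  rw [e1]
  simp only [pcurl, pdiv, Qnull]
  have s10 : ∀ l, pd (fun y => pd (V l) 1 y) 0 x = pd (fun y => pd (V l) 0 y) 1 x :=
    fun l => pd_pd_comm (hV l) 1 0 x
  have s20 : ∀ l, pd (fun y => pd (V l) 2 y) 0 x = pd (fun y => pd (V l) 0 y) 2 x :=
    fun l => pd_pd_comm (hV l) 2 0 x
  have s21 : ∀ l, pd (fun y => pd (V l) 2 y) 1 x = pd (fun y => pd (V l) 1 y) 2 x :=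
    fun l => pd_pd_comm (hV l) 2 1 x
  have a1 : (1 : Fin 3) + 1 = 2 := rfl
  have a2 : (1 : Fin 3) + 2 = 0 := rfl
  have a3 : (2 : Fin 3) + 1 = 0 := rfl
  have a4 : (2 : Fin 3) + 2 = 1 := rfl
  unfold divg curl3
  generalize hX : (fun a b => pd (V a) b x) = X
  have hX' : ∀ a b, pd (V a) b x = X a b := fun a b => by rw [← hX]
  generalize hH : (fun l j k => pd (fun y => pd (V l) j y) k x) = H at *
  have hH' : ∀ l j k, pd (fun y => pd (V l) j y) k x = H l j k := fun l j k => by rw [← hH]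
  simp only [hX', hH'] at *
  unfold quadCoeff kron
  fin_cases i <;>
  · simp [Fin.sum_univ_three, a1, a2, a3, a4, s10, s20, s21]
    ring

/-- Space-time `ℝ³ × ℝ`. -/
abbrev SpT := (Fin 3 → ℝ) × ℝ

/-- The `j`-th spatial unit vector of space-time. -/
def ex (j : Fin 3) : SpT := (Pi.single j 1, 0)

/-- The unit time vector of space-time. -/
def et : SpT := (0, 1)

/-- Directional derivative within `s`. -/
def Dw (s : Set SpT) (v : SpT) (F : SpT → ℝ) (p : SpT) : ℝ := fderivWithin ℝ F s p v

section Dw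

variable {s : Set SpT} {v w : SpT} {F G : SpT → ℝ} {p : SpT}

theorem Dw_mul (hs : UniqueDiffWithinAt ℝ s p) (hF : DifferentiableWithinAt ℝ F s p)
    (hG : DifferentiableWithinAt ℝ G s p) :
    Dw s v (fun q => F q * G q) p = F p * Dw s v G p + Dw s v F p * G p := by
  unfold Dw
  rw [fderivWithin_fun_mul hs hF hG]
  simp [mul_comm]

theorem Dw_add (hs : UniqueDiffWithinAt ℝ s p) (hF : DifferentiableWithinAt ℝ F s p)
    (hG : DifferentiableWithinAt ℝ G s p) :
    Dw s v (fun q => F q + G q) p = Dw s v F p + Dw s v G p := by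
  unfold Dw
  rw [fderivWithin_fun_add hs hF hG]
  simp

theorem Dw_sub (hs : UniqueDiffWithinAt ℝ s p) (hF : DifferentiableWithinAt ℝ F s p)
    (hG : DifferentiableWithinAt ℝ G s p) :
    Dw s v (fun q => F q - G q) p = Dw s v F p - Dw s v G p := by
  unfold Dw
  rw [fderivWithin_fun_sub hs hF hG]
  simp

theorem Dw_const_add (c : ℝ) : Dw s v (fun q => c + F q) p = Dw s v F p := by
  unfold Dw
  rw [fderivWithin_const_add]

theorem Dw_const_mul (hs : UniqueDiffWithinAt ℝ s p) (hF : DifferentiableWithinAt ℝ F s p)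
    (c : ℝ) : Dw s v (fun q => c * F q) p = c * Dw s v F p := by
  unfold Dw
  rw [fderivWithin_const_mul hs hF]
  simp

theorem Dw_sum {ι : Type*} [Fintype ι] {f : ι → SpT → ℝ} (hs : UniqueDiffWithinAt ℝ s p)
    (hF : ∀ i, DifferentiableWithinAt ℝ (f i) s p) :
    Dw s v (fun q => ∑ i, f i q) p = ∑ i, Dw s v (f i) p := by
  unfold Dw
  rw [fderivWithin_fun_sum hs fun i _ => hF i]
  simp

theorem contDiffOn_Dw (hs : UniqueDiffOn ℝ s) (hF : ContDiffOn ℝ (⊤ : ℕ∞) F s) (v : SpT) :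
    ContDiffOn ℝ (⊤ : ℕ∞) (Dw s v F) s :=
  (hF.fderivWithin hs (m := (⊤ : ℕ∞)) (by norm_cast)).clm_apply contDiffOn_const

theorem Dw_comm (hs : UniqueDiffOn ℝ s) (hcl : s ⊆ closure (interior s))
    (hF : ContDiffOn ℝ (⊤ : ℕ∞) F s) (hp : p ∈ s) :
    Dw s v (Dw s w F) p = Dw s w (Dw s v F) p := by
  have h := (hF p hp).isSymmSndFDerivWithinAt (by simp; norm_cast) hs (hcl hp) hp
  have hd : DifferentiableWithinAt ℝ (fderivWithin ℝ F s) s p :=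
    (hF.fderivWithin hs (m := 1) (by norm_cast)).differentiableOn (by norm_num) p hp
  have key : ∀ a b : SpT, Dw s a (Dw s b F) p
      = fderivWithin ℝ (fderivWithin ℝ F s) s p a b := by
    intro a b
    unfold Dw
    rw [fderivWithin_clm_apply (hs p hp) hd (differentiableWithinAt_const _)]
    simp
  rw [key, key]
  exact h.eq _ _

end Dw

/-- The coefficients of the linearised operator around `S`. -/
def Acoef (s : Set SpT) (L : Fin 3 → Fin 3 → Fin 3 → Fin 3 → ℝ)
    (γ : Fin 3 → Fin 3 → Fin 3 → Fin 3 → Fin 3 → Fin 3 → ℝ) (S : Fin 3 → SpT → ℝ)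
    (i j l k : Fin 3) (p : SpT) : ℝ :=
  L i j l k + ∑ m, ∑ n, γ m n i j l k * Dw s (ex n) (S m) p

/-- Energy density of `W` for the operator linearised around `S`. -/
def energyDens (s : Set SpT) (L : Fin 3 → Fin 3 → Fin 3 → Fin 3 → ℝ)
    (γ : Fin 3 → Fin 3 → Fin 3 → Fin 3 → Fin 3 → Fin 3 → ℝ) (S W : Fin 3 → SpT → ℝ)
    (p : SpT) : ℝ :=
  1 / 2 * (∑ i, Dw s et (W i) p * Dw s et (W i) p
    + ∑ i, ∑ j, ∑ l, ∑ k, Acoef s L γ S i j l k p * (Dw s (ex j) (W i) p * Dw s (ex k) (W l) p)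
    + ∑ i, W i p * W i p)

/-- Energy flux of `W` for the operator linearised around `S`. -/
def energyFlux (s : Set SpT) (L : Fin 3 → Fin 3 → Fin 3 → Fin 3 → ℝ)
    (γ : Fin 3 → Fin 3 → Fin 3 → Fin 3 → Fin 3 → Fin 3 → ℝ) (S W : Fin 3 → SpT → ℝ)
    (j : Fin 3) (p : SpT) : ℝ :=
  ∑ i, ∑ l, ∑ k, Acoef s L γ S i j l k p * (Dw s et (W i) p * Dw s (ex k) (W l) p)

/-- The terms of the energy identity that are quadratic in the first derivatives of `W`. -/
def energyRem (s : Set SpT)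
    (γ : Fin 3 → Fin 3 → Fin 3 → Fin 3 → Fin 3 → Fin 3 → ℝ) (S W : Fin 3 → SpT → ℝ)
    (p : SpT) : ℝ :=
  ∑ i, ∑ j, ∑ l, ∑ k,
    (1 / 2 * ((∑ m, ∑ n, γ m n i j l k * Dw s et (Dw s (ex n) (S m)) p)
        * (Dw s (ex j) (W i) p * Dw s (ex k) (W l) p))
      - (∑ m, ∑ n, γ m n i j l k * Dw s (ex j) (Dw s (ex n) (S m)) p)
        * (Dw s et (W i) p * Dw s (ex k) (W l) p)
      + Dw s et (W i) p * ((∑ m, ∑ n, γ m n i j l k * Dw s (ex n) (W m) p)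
        * Dw s (ex k) (Dw s (ex j) (S l)) p))
    + ∑ i, W i p * Dw s et (W i) p

theorem sum_swap_pairs (f : Fin 3 → Fin 3 → Fin 3 → Fin 3 → ℝ) :
    ∑ i, ∑ j, ∑ l, ∑ k, f i j l k = ∑ i, ∑ j, ∑ l, ∑ k, f l k i j := by
  have h : ∀ g : Fin 3 → Fin 3 → Fin 3 → Fin 3 → ℝ, ∑ i, ∑ j, ∑ l, ∑ k, g i j l k
      = ∑ a : Fin 3 × Fin 3, ∑ b : Fin 3 × Fin 3, g a.1 a.2 b.1 b.2 := fun g => by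
    simp only [Fintype.sum_prod_type]
  rw [h, h, Finset.sum_comm]

section Energy

variable {s : Set SpT} {L : Fin 3 → Fin 3 → Fin 3 → Fin 3 → ℝ}
  {γ : Fin 3 → Fin 3 → Fin 3 → Fin 3 → Fin 3 → Fin 3 → ℝ} {S W : Fin 3 → SpT → ℝ}

theorem contDiffOn_Acoef (hs : UniqueDiffOn ℝ s) (hS : ∀ i, ContDiffOn ℝ (⊤ : ℕ∞) (S i) s)
    (i j l k : Fin 3) : ContDiffOn ℝ (⊤ : ℕ∞) (Acoef s L γ S i j l k) s := by
  unfold Acoef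
  exact contDiffOn_const.add (ContDiffOn.sum fun m _ => ContDiffOn.sum fun n _ =>
    contDiffOn_const.mul (contDiffOn_Dw hs (hS m) _))

theorem contDiffOn_energyDens (hs : UniqueDiffOn ℝ s)
    (hS : ∀ i, ContDiffOn ℝ (⊤ : ℕ∞) (S i) s) (hW : ∀ i, ContDiffOn ℝ (⊤ : ℕ∞) (W i) s) :
    ContDiffOn ℝ (⊤ : ℕ∞) (energyDens s L γ S W) s := by
  unfold energyDens
  refine contDiffOn_const.mul (((ContDiffOn.sum fun i _ => ?_).add (ContDiffOn.sum fun i _ =>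
    ContDiffOn.sum fun j _ => ContDiffOn.sum fun l _ => ContDiffOn.sum fun k _ => ?_)).add
    (ContDiffOn.sum fun i _ => (hW i).mul (hW i)))
  · exact (contDiffOn_Dw hs (hW i) _).mul (contDiffOn_Dw hs (hW i) _)
  · exact (contDiffOn_Acoef hs hS i j l k).mul
      ((contDiffOn_Dw hs (hW i) _).mul (contDiffOn_Dw hs (hW l) _))

theorem contDiffOn_energyFlux (hs : UniqueDiffOn ℝ s)
    (hS : ∀ i, ContDiffOn ℝ (⊤ : ℕ∞) (S i) s) (hW : ∀ i, ContDiffOn ℝ (⊤ : ℕ∞) (W i) s)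
    (j : Fin 3) : ContDiffOn ℝ (⊤ : ℕ∞) (energyFlux s L γ S W j) s := by
  unfold energyFlux
  exact ContDiffOn.sum fun i _ => ContDiffOn.sum fun l _ => ContDiffOn.sum fun k _ =>
    (contDiffOn_Acoef hs hS i j l k).mul
      ((contDiffOn_Dw hs (hW i) _).mul (contDiffOn_Dw hs (hW l) _))

theorem Dw_Acoef (hs : UniqueDiffOn ℝ s) (hS : ∀ i, ContDiffOn ℝ (⊤ : ℕ∞) (S i) s)
    (i j l k : Fin 3) (v : SpT) {p : SpT} (hp : p ∈ s) :
    Dw s v (Acoef s L γ S i j l k) p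
      = ∑ m, ∑ n, γ m n i j l k * Dw s v (Dw s (ex n) (S m)) p := by
  have hd : ∀ m n, DifferentiableWithinAt ℝ (Dw s (ex n) (S m)) s p := fun m n =>
    (contDiffOn_Dw hs (hS m) _).differentiableOn (by simp) p hp
  unfold Acoef
  rw [Dw_const_add, Dw_sum (hs p hp) fun m =>
    DifferentiableWithinAt.fun_sum fun n _ => (hd m n).const_mul _]
  refine Finset.sum_congr rfl fun m _ => ?_
  rw [Dw_sum (hs p hp) fun n => (hd m n).const_mul _]
  exact Finset.sum_congr rfl fun n _ => Dw_const_mul (hs p hp) (hd m n) _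

theorem Dw_energyDens (hs : UniqueDiffOn ℝ s) (hcl : s ⊆ closure (interior s))
    (hS : ∀ i, ContDiffOn ℝ (⊤ : ℕ∞) (S i) s) (hW : ∀ i, ContDiffOn ℝ (⊤ : ℕ∞) (W i) s)
    (hL : ∀ i j l k, L i j l k = L l k i j)
    (hγ : ∀ m n i j l k, γ m n i j l k = γ m n l k i j) {p : SpT} (hp : p ∈ s)
    (hpde : ∀ i, Dw s et (Dw s et (W i)) p
      = ∑ j, ∑ l, ∑ k, (Acoef s L γ S i j l k p * Dw s (ex k) (Dw s (ex j) (W l)) p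
        + (∑ m, ∑ n, γ m n i j l k * Dw s (ex n) (W m) p)
          * Dw s (ex k) (Dw s (ex j) (S l)) p)) :
    Dw s et (energyDens s L γ S W) p
      = ∑ j, Dw s (ex j) (energyFlux s L γ S W j) p + energyRem s γ S W p := by
  have hu := hs p hp
  have hA : ∀ i j l k, DifferentiableWithinAt ℝ (Acoef s L γ S i j l k) s p := fun i j l k =>
    (contDiffOn_Acoef hs hS i j l k).differentiableOn (by simp) p hp
  have hD : ∀ i v, DifferentiableWithinAt ℝ (Dw s v (W i)) s p := fun i v =>
    (contDiffOn_Dw hs (hW i) v).differentiableOn (by simp) p hp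
  have hW' : ∀ i, DifferentiableWithinAt ℝ (W i) s p := fun i =>
    (hW i).differentiableOn (by simp) p hp
  have hAs : ∀ i j l k, Acoef s L γ S i j l k p = Acoef s L γ S l k i j p := by
    intro i j l k
    unfold Acoef
    rw [hL i j l k]
    congr 1
    exact Finset.sum_congr rfl fun m _ => Finset.sum_congr rfl fun n _ => by rw [hγ]
  have e1 : Dw s et (energyDens s L γ S W) p
      = ∑ i, Dw s et (W i) p * Dw s et (Dw s et (W i)) p
        + ∑ i, ∑ j, ∑ l, ∑ k,
          (1 / 2 * (Dw s et (Acoef s L γ S i j l k) p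
            * (Dw s (ex j) (W i) p * Dw s (ex k) (W l) p))
          + 1 / 2 * (Acoef s L γ S i j l k p
              * (Dw s (ex j) (W i) p * Dw s et (Dw s (ex k) (W l)) p))
          + 1 / 2 * (Acoef s L γ S i j l k p
              * (Dw s et (Dw s (ex j) (W i)) p * Dw s (ex k) (W l) p)))
        + ∑ i, W i p * Dw s et (W i) p := by
    have h4 : ∀ i j l k, DifferentiableWithinAt ℝ (fun q => Acoef s L γ S i j l k q
        * (Dw s (ex j) (W i) q * Dw s (ex k) (W l) q)) s p := fun i j l k =>
      (hA i j l k).fun_mul ((hD i _).fun_mul (hD l _))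
    have h1 : ∀ i, DifferentiableWithinAt ℝ (fun q => Dw s et (W i) q * Dw s et (W i) q) s p :=
      fun i => (hD i _).fun_mul (hD i _)
    have h0 : ∀ i, DifferentiableWithinAt ℝ (fun q => W i q * W i q) s p :=
      fun i => (hW' i).fun_mul (hW' i)
    have h4s : ∀ i, DifferentiableWithinAt ℝ (fun q => ∑ j, ∑ l, ∑ k, Acoef s L γ S i j l k q
        * (Dw s (ex j) (W i) q * Dw s (ex k) (W l) q)) s p := fun i =>
      .fun_sum fun j _ => .fun_sum fun l _ => .fun_sum fun k _ => h4 i j l k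
    unfold energyDens
    rw [Dw_const_mul hu (((DifferentiableWithinAt.fun_sum fun i _ => h1 i).fun_add
        (DifferentiableWithinAt.fun_sum fun i _ => h4s i)).fun_add
        (DifferentiableWithinAt.fun_sum fun i _ => h0 i)),
      Dw_add hu ((DifferentiableWithinAt.fun_sum fun i _ => h1 i).fun_add
        (DifferentiableWithinAt.fun_sum fun i _ => h4s i))
        (DifferentiableWithinAt.fun_sum fun i _ => h0 i),
      Dw_add hu (DifferentiableWithinAt.fun_sum fun i _ => h1 i)
        (DifferentiableWithinAt.fun_sum fun i _ => h4s i),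
      Dw_sum hu h1, Dw_sum hu h0, Dw_sum hu h4s, mul_add, mul_add, Finset.mul_sum,
      Finset.mul_sum, Finset.mul_sum]
    congr 1
    · congr 1
      · refine Finset.sum_congr rfl fun i _ => ?_
        rw [Dw_mul hu (hD i _) (hD i _)]; ring
      · refine Finset.sum_congr rfl fun i _ => ?_
        rw [Dw_sum hu fun j => .fun_sum fun l _ => .fun_sum fun k _ => h4 i j l k, Finset.mul_sum]
        refine Finset.sum_congr rfl fun j _ => ?_
        rw [Dw_sum hu fun l => .fun_sum fun k _ => h4 i j l k, Finset.mul_sum]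
        refine Finset.sum_congr rfl fun l _ => ?_
        rw [Dw_sum hu fun k => h4 i j l k, Finset.mul_sum]
        refine Finset.sum_congr rfl fun k _ => ?_
        rw [Dw_mul hu (hA i j l k) ((hD i _).fun_mul (hD l _)), Dw_mul hu (hD i _) (hD l _)]
        ring
    · refine Finset.sum_congr rfl fun i _ => ?_
      rw [Dw_mul hu (hW' i) (hW' i)]; ring
  have e2 : ∑ j, Dw s (ex j) (energyFlux s L γ S W j) p
      = ∑ i, ∑ j, ∑ l, ∑ k,
        (Dw s (ex j) (Acoef s L γ S i j l k) p * (Dw s et (W i) p * Dw s (ex k) (W l) p)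
        + Acoef s L γ S i j l k p
          * (Dw s et (W i) p * Dw s (ex k) (Dw s (ex j) (W l)) p
            + Dw s et (Dw s (ex j) (W i)) p * Dw s (ex k) (W l) p)) := by
    have h4 : ∀ i j l k, DifferentiableWithinAt ℝ (fun q => Acoef s L γ S i j l k q
        * (Dw s et (W i) q * Dw s (ex k) (W l) q)) s p := fun i j l k =>
      (hA i j l k).fun_mul ((hD i _).fun_mul (hD l _))
    rw [Finset.sum_comm]
    refine Finset.sum_congr rfl fun j _ => ?_
    unfold energyFlux
    rw [Dw_sum hu fun i => .fun_sum fun l _ => .fun_sum fun k _ => h4 i j l k]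
    refine Finset.sum_congr rfl fun i _ => ?_
    rw [Dw_sum hu fun l => .fun_sum fun k _ => h4 i j l k]
    refine Finset.sum_congr rfl fun l _ => ?_
    rw [Dw_sum hu fun k => h4 i j l k]
    refine Finset.sum_congr rfl fun k _ => ?_
    rw [Dw_mul hu (hA i j l k) ((hD i _).fun_mul (hD l _)), Dw_mul hu (hD i _) (hD l _),
      Dw_comm (v := ex j) (w := et) hs hcl (hW i) hp,
      Dw_comm (v := ex j) (w := ex k) hs hcl (hW l) hp]
    ring
  have e3 : ∑ i, ∑ j, ∑ l, ∑ k, Acoef s L γ S i j l k p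
        * (Dw s (ex j) (W i) p * Dw s et (Dw s (ex k) (W l)) p)
      = ∑ i, ∑ j, ∑ l, ∑ k, Acoef s L γ S i j l k p
        * (Dw s et (Dw s (ex j) (W i)) p * Dw s (ex k) (W l) p) := by
    rw [sum_swap_pairs]
    refine Finset.sum_congr rfl fun i _ => Finset.sum_congr rfl fun j _ =>
      Finset.sum_congr rfl fun l _ => Finset.sum_congr rfl fun k _ => ?_
    rw [hAs l k i j]; ring
  have e4 : ∑ i, ∑ j, ∑ l, ∑ k,
          (1 / 2 * (Dw s et (Acoef s L γ S i j l k) p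
            * (Dw s (ex j) (W i) p * Dw s (ex k) (W l) p))
          + 1 / 2 * (Acoef s L γ S i j l k p
              * (Dw s (ex j) (W i) p * Dw s et (Dw s (ex k) (W l)) p))
          + 1 / 2 * (Acoef s L γ S i j l k p
              * (Dw s et (Dw s (ex j) (W i)) p * Dw s (ex k) (W l) p)))
      = ∑ i, ∑ j, ∑ l, ∑ k,
          (1 / 2 * (Dw s et (Acoef s L γ S i j l k) p
            * (Dw s (ex j) (W i) p * Dw s (ex k) (W l) p))
          + Acoef s L γ S i j l k p
              * (Dw s et (Dw s (ex j) (W i)) p * Dw s (ex k) (W l) p)) := by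
    simp only [Finset.sum_add_distrib, ← Finset.mul_sum, e3]
    ring
  rw [e1, e2, e4]
  unfold energyRem
  rw [← add_assoc]
  congr 1
  have hP : ∀ i, Dw s et (W i) p * Dw s et (Dw s et (W i)) p
      = ∑ j, ∑ l, ∑ k, Dw s et (W i) p
        * (Acoef s L γ S i j l k p * Dw s (ex k) (Dw s (ex j) (W l)) p
        + (∑ m, ∑ n, γ m n i j l k * Dw s (ex n) (W m) p)
          * Dw s (ex k) (Dw s (ex j) (S l)) p) := by
    intro i
    rw [hpde, Finset.mul_sum]
    refine Finset.sum_congr rfl fun j _ => ?_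
    rw [Finset.mul_sum]
    refine Finset.sum_congr rfl fun l _ => ?_
    rw [Finset.mul_sum]
  simp only [hP, Dw_Acoef hs hS _ _ _ _ _ hp]
  simp only [← Finset.sum_add_distrib]
  refine Finset.sum_congr rfl fun i _ => Finset.sum_congr rfl fun j _ =>
    Finset.sum_congr rfl fun l _ => Finset.sum_congr rfl fun k _ => ?_
  ring

end Energy

theorem integral_pd_eq_zero {f : (Fin 3 → ℝ) → ℝ} (hf : ContDiff ℝ 1 f)
    (hs : HasCompactSupport f) (j : Fin 3) : ∫ x, pd f j x = 0 := by
  have hc : Continuous fun x => fderiv ℝ f x (Pi.single j 1) :=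
    (hf.continuous_fderiv (by norm_num)).clm_apply continuous_const
  have hs' : HasCompactSupport fun x => fderiv ℝ f x (Pi.single j 1) :=
    hs.fderiv_apply (𝕜 := ℝ) (Pi.single j 1)
  have h := integral_mul_fderiv_eq_neg_fderiv_mul_of_integrable (μ := (volume : Measure (Fin 3 → ℝ)))
    (f := f) (g := fun _ => (1 : ℝ)) (v := Pi.single j 1)
    (by simpa using hc.integrable_of_hasCompactSupport hs')
    (by simp)
    (by simpa using hf.continuous.integrable_of_hasCompactSupport hs)
    (fun x _ => hf.differentiable (by norm_num) x) (fun x _ => differentiableAt_const _)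
  unfold pd
  simpa using h

/-- A nonnegative density vanishes identically if it vanishes initially and its time derivative
is bounded by a multiple of itself up to a spatial divergence. -/
theorem eq_zero_of_deriv_le_add_div {G G' : (Fin 3 → ℝ) → ℝ → ℝ}
    {Fl : Fin 3 → ℝ → (Fin 3 → ℝ) → ℝ} {K : Set (Fin 3 → ℝ)} (hK : IsCompact K)
    {t₁ t₂ M C : ℝ}
    (hcont : ContinuousOn (fun p : SpT => G p.1 p.2) (Set.univ ×ˢ Set.Icc t₁ t₂))
    (hsupp : ∀ t ∈ Set.Icc t₁ t₂, ∀ x ∉ K, G x t = 0)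
    (hnn : ∀ t ∈ Set.Icc t₁ t₂, ∀ x, 0 ≤ G x t) (h0 : ∀ x, G x t₁ = 0)
    (hder : ∀ t ∈ Set.Ioo t₁ t₂, ∀ x, HasDerivAt (G x) (G' x t) t)
    (hGc : ∀ t ∈ Set.Ioo t₁ t₂, Continuous fun x => G' x t)
    (hGs : ∀ t ∈ Set.Ioo t₁ t₂, ∀ x ∉ K, G' x t = 0)
    (hGb : ∀ t ∈ Set.Ioo t₁ t₂, ∀ x, |G' x t| ≤ C)
    (hF : ∀ t ∈ Set.Ioo t₁ t₂, ∀ j, ContDiff ℝ 1 (Fl j t))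
    (hFs : ∀ t ∈ Set.Ioo t₁ t₂, ∀ j, ∀ x ∉ K, Fl j t x = 0)
    (hineq : ∀ t ∈ Set.Ioo t₁ t₂, ∀ x, G' x t ≤ M * G x t + ∑ j, pd (Fl j t) j x) :
    ∀ t ∈ Set.Icc t₁ t₂, ∀ x, G x t = 0 := by
  intro t ht
  have ht12 : t₁ ≤ t₂ := ht.1.trans ht.2
  have hcs : ∀ f : (Fin 3 → ℝ) → ℝ, (∀ x ∉ K, f x = 0) → HasCompactSupport f := fun f hf =>
    HasCompactSupport.intro hK hf
  have hGx : ∀ t ∈ Set.Icc t₁ t₂, Continuous fun x => G x t := fun t ht =>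
    hcont.comp_continuous (f := fun x => ((x, t) : SpT)) (by fun_prop) fun x => ⟨trivial, ht⟩
  have hGi : ∀ t ∈ Set.Icc t₁ t₂, Integrable fun x => G x t := fun t ht =>
    (hGx t ht).integrable_of_hasCompactSupport (hcs _ (hsupp t ht))
  set En : ℝ → ℝ := fun t => ∫ x, G x t with hEn
  have hEc : ContinuousOn En (Set.Icc t₁ t₂) := by
    refine continuousOn_integral_of_compact_support (f := fun t x => G x t) hK ?_ ?_
    · exact hcont.comp (f := fun q : ℝ × (Fin 3 → ℝ) => ((q.2, q.1) : SpT)) (by fun_prop)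
        fun q hq => ⟨trivial, hq.1⟩
    · exact fun p x hp hx => hsupp p hp x hx
  have hEd : ∀ t ∈ Set.Ioo t₁ t₂, HasDerivAt En (∫ x, G' x t) t ∧ ∫ x, G' x t ≤ M * En t := by
    intro t ht
    have ht' := Set.Ioo_subset_Icc_self ht
    have hd := hasDerivAt_integral_of_dominated_loc_of_deriv_le
      (μ := (volume : Measure (Fin 3 → ℝ))) (F := fun t x => G x t) (F' := fun t x => G' x t)
      (bound := K.indicator fun _ => C) (Ioo_mem_nhds ht.1 ht.2)
      (by
        filter_upwards [Ioo_mem_nhds ht.1 ht.2] with r hr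
        exact (hGi r (Set.Ioo_subset_Icc_self hr)).aestronglyMeasurable)
      (hGi t ht') (hGc t ht).aestronglyMeasurable
      (by
        filter_upwards with x r hr
        by_cases hx : x ∈ K
        · simpa [hx] using hGb r hr x
        · simp [hx, hGs r hr x hx])
      (by
        rw [integrable_indicator_iff hK.measurableSet]
        exact integrableOn_const hK.measure_lt_top.ne)
      (by
        filter_upwards with x r hr
        exact hder r hr x)
    refine ⟨hd.2, ?_⟩
    have hFi : ∀ j, Integrable fun x => pd (Fl j t) j x := fun j => by
      refine Continuous.integrable_of_hasCompactSupport
        (((hF t ht j).continuous_fderiv (by norm_num)).clm_apply continuous_const) ?_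
      exact (hcs _ (hFs t ht j)).fderiv_apply (𝕜 := ℝ) (Pi.single j 1)
    calc ∫ x, G' x t ≤ ∫ x, (M * G x t + ∑ j, pd (Fl j t) j x) :=
          integral_mono hd.1 (((hGi t ht').const_mul M).add
            (integrable_finsetSum _ fun j _ => hFi j)) (hineq t ht)
      _ = M * En t := by
          rw [integral_add ((hGi t ht').const_mul M) (integrable_finsetSum _ fun j _ => hFi j),
            integral_const_mul, integral_finsetSum _ fun j _ => hFi j]
          simp [integral_pd_eq_zero (hF t ht _) (hcs _ (hFs t ht _)), hEn]
  have hanti : AntitoneOn (fun t => Real.exp (-M * t) * En t) (Set.Icc t₁ t₂) := by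
    have hd : ∀ t ∈ Set.Ioo t₁ t₂, HasDerivAt (fun t => Real.exp (-M * t) * En t)
        (Real.exp (-M * t) * (-M * 1) * En t + Real.exp (-M * t) * ∫ x, G' x t) t := fun t ht =>
      (((hasDerivAt_id t).const_mul (-M)).exp).mul (hEd t ht).1
    refine antitoneOn_of_deriv_nonpos (convex_Icc _ _)
      ((Real.continuous_exp.comp (continuous_const.mul continuous_id)).continuousOn.mul hEc) ?_ ?_
    · rw [interior_Icc]
      exact fun r hr => (hd r hr).differentiableAt.differentiableWithinAt
    · rw [interior_Icc]
      intro r hr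
      rw [(hd r hr).deriv]
      have := mul_le_mul_of_nonneg_left (hEd r hr).2 (Real.exp_pos (-M * r)).le
      linarith
  have hle := hanti (Set.left_mem_Icc.2 ht12) ht ht.1
  have h1 : En t₁ = 0 := by simp [hEn, h0]
  simp only [h1, mul_zero] at hle
  have hEt : En t ≤ 0 := nonpos_of_mul_nonpos_right hle (Real.exp_pos _)
  intro x
  by_contra hx
  have := (hGx t ht).integral_pos_of_hasCompactSupport_nonneg_nonzero
    (μ := (volume : Measure (Fin 3 → ℝ))) (hcs _ (hsupp t ht)) (fun y => hnn t ht y) hx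
  exact absurd this (not_lt.2 hEt)

/-- The bilinear form with coefficients `A` on `3 × 3` matrices. -/
def qf (A : Fin 3 → Fin 3 → Fin 3 → Fin 3 → ℝ) (Y Z : Fin 3 → Fin 3 → ℝ) : ℝ :=
  ∑ i, ∑ j, ∑ l, ∑ k, A i j l k * (Y i j * Z l k)

theorem qf_symm {A : Fin 3 → Fin 3 → Fin 3 → Fin 3 → ℝ} (hA : ∀ i j l k, A i j l k = A l k i j)
    (Y Z : Fin 3 → Fin 3 → ℝ) : qf A Y Z = qf A Z Y := by
  unfold qf
  rw [sum_swap_pairs]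
  refine Finset.sum_congr rfl fun i _ => Finset.sum_congr rfl fun j _ =>
    Finset.sum_congr rfl fun l _ => Finset.sum_congr rfl fun k _ => ?_
  rw [hA i j l k]; ring

theorem qf_smul_sub {A : Fin 3 → Fin 3 → Fin 3 → Fin 3 → ℝ}
    (hA : ∀ i j l k, A i j l k = A l k i j) (b : ℝ) (Y Z : Fin 3 → Fin 3 → ℝ) :
    qf A (fun i j => b * Y i j - Z i j) (fun i j => b * Y i j - Z i j)
      = b ^ 2 * qf A Y Y - 2 * b * qf A Z Y + qf A Z Z := by
  have h : qf A (fun i j => b * Y i j - Z i j) (fun i j => b * Y i j - Z i j)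
      = b ^ 2 * qf A Y Y - b * qf A Z Y - b * qf A Y Z + qf A Z Z := by
    unfold qf
    simp only [Finset.mul_sum, ← Finset.sum_add_distrib, ← Finset.sum_sub_distrib]
    refine Finset.sum_congr rfl fun i _ => Finset.sum_congr rfl fun j _ =>
      Finset.sum_congr rfl fun l _ => Finset.sum_congr rfl fun k _ => ?_
    ring
  rw [h, qf_symm hA Y Z]; ring

theorem qf_tensor_le {A : Fin 3 → Fin 3 → Fin 3 → Fin 3 → ℝ}
    (hA : ∀ i j l k, A i j l k = A l k i j) (hpos : ∀ Y, 0 ≤ qf A Y Y) {b : ℝ} (hb : 0 < b)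
    {P d : Fin 3 → ℝ} (Q : Fin 3 → Fin 3 → ℝ)
    (hs : qf A (fun i j => P i * d j) (fun i j => P i * d j) ≤ b ^ 2 * ∑ i, P i * P i) :
    qf A (fun i j => P i * d j) Q ≤ b * (1 / 2 * (∑ i, P i * P i + qf A Q Q)) := by
  have h := hpos fun i j => b * Q i j - P i * d j
  rw [qf_smul_sub hA] at h
  have h2 : b * (2 * qf A (fun i j => P i * d j) Q) ≤ b * (b * (∑ i, P i * P i + qf A Q Q)) := by
    nlinarith
  have := le_of_mul_le_mul_left h2 hb
  linarith

theorem abs_sum_three_le {f : Fin 3 → ℝ} {b : ℝ} (h : ∀ i, |f i| ≤ b) : |∑ i, f i| ≤ 3 * b := by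
  rw [Fin.sum_univ_three]
  have := abs_add_three (f 0) (f 1) (f 2)
  linarith [h 0, h 1, h 2]

theorem abs_mul_le_of_sq_le {a b N : ℝ} (ha : a * a ≤ N) (hb : b * b ≤ N) : |a * b| ≤ N := by
  rw [abs_le]
  constructor <;> nlinarith [sq_nonneg (a - b), sq_nonneg (a + b)]

section Rem

variable {s : Set SpT} {γ : Fin 3 → Fin 3 → Fin 3 → Fin 3 → Fin 3 → Fin 3 → ℝ}
  {S W : Fin 3 → SpT → ℝ}

theorem energyRem_le {p : SpT} {Γ B : ℝ} (hB : 0 ≤ B)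
    (hγ : ∀ m n i j l k, |γ m n i j l k| ≤ Γ)
    (hSt : ∀ m n, |Dw s et (Dw s (ex n) (S m)) p| ≤ B)
    (hSx : ∀ j m n, |Dw s (ex j) (Dw s (ex n) (S m)) p| ≤ B) :
    energyRem s γ S W p ≤ (81 * (27 * Γ * B) + 3) *
      (∑ i, Dw s et (W i) p * Dw s et (W i) p
        + ∑ i, ∑ j, Dw s (ex j) (W i) p * Dw s (ex j) (W i) p + ∑ i, W i p * W i p) := by
  set N := ∑ i, Dw s et (W i) p * Dw s et (W i) p
        + ∑ i, ∑ j, Dw s (ex j) (W i) p * Dw s (ex j) (W i) p + ∑ i, W i p * W i p with hN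
  have hΓ : 0 ≤ Γ := (abs_nonneg _).trans (hγ 0 0 0 0 0 0)
  have n1 : ∀ i, 0 ≤ Dw s et (W i) p * Dw s et (W i) p := fun i => mul_self_nonneg _
  have n2 : ∀ i j, 0 ≤ Dw s (ex j) (W i) p * Dw s (ex j) (W i) p := fun i j => mul_self_nonneg _
  have n3 : ∀ i, 0 ≤ W i p * W i p := fun i => mul_self_nonneg _
  have s1 := Finset.sum_nonneg fun i (_ : i ∈ Finset.univ) => n1 i
  have s2 := Finset.sum_nonneg fun i (_ : i ∈ Finset.univ) =>
    Finset.sum_nonneg fun j (_ : j ∈ Finset.univ) => n2 i j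
  have s3 := Finset.sum_nonneg fun i (_ : i ∈ Finset.univ) => n3 i
  have hP : ∀ i, Dw s et (W i) p * Dw s et (W i) p ≤ N := fun i => by
    have := Finset.single_le_sum (fun i _ => n1 i) (Finset.mem_univ i)
    linarith
  have hQ : ∀ i j, Dw s (ex j) (W i) p * Dw s (ex j) (W i) p ≤ N := fun i j => by
    have h1 := Finset.single_le_sum (fun j _ => n2 i j) (Finset.mem_univ j)
    have h2 := Finset.single_le_sum (f := fun i => ∑ j, Dw s (ex j) (W i) p * Dw s (ex j) (W i) p)
      (fun i _ => Finset.sum_nonneg fun j _ => n2 i j) (Finset.mem_univ i)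
    linarith
  have hW : ∀ i, W i p * W i p ≤ N := fun i => by
    have := Finset.single_le_sum (fun i _ => n3 i) (Finset.mem_univ i)
    linarith
  have hN0 : 0 ≤ N := by linarith
  have hg : ∀ (H : Fin 3 → Fin 3 → ℝ) (_ : ∀ m n, |H m n| ≤ B) (i j l k : Fin 3),
      |∑ m, ∑ n, γ m n i j l k * H m n| ≤ 3 * (3 * (Γ * B)) := fun H hH i j l k =>
    abs_sum_three_le fun m => abs_sum_three_le fun n => by
      rw [abs_mul]
      exact mul_le_mul (hγ _ _ _ _ _ _) (hH m n) (abs_nonneg _) hΓ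
  have h4 : ∀ i j l k : Fin 3, |1 / 2 * ((∑ m, ∑ n, γ m n i j l k * Dw s et (Dw s (ex n) (S m)) p)
        * (Dw s (ex j) (W i) p * Dw s (ex k) (W l) p))
      - (∑ m, ∑ n, γ m n i j l k * Dw s (ex j) (Dw s (ex n) (S m)) p)
        * (Dw s et (W i) p * Dw s (ex k) (W l) p)
      + Dw s et (W i) p * ((∑ m, ∑ n, γ m n i j l k * Dw s (ex n) (W m) p)
        * Dw s (ex k) (Dw s (ex j) (S l)) p)| ≤ 27 * Γ * B * N := by
    intro i j l k
    have t1 : |(∑ m, ∑ n, γ m n i j l k * Dw s et (Dw s (ex n) (S m)) p)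
        * (Dw s (ex j) (W i) p * Dw s (ex k) (W l) p)| ≤ 3 * (3 * (Γ * B)) * N := by
      rw [abs_mul]
      exact mul_le_mul (hg _ (fun m n => hSt m n) i j l k) (abs_mul_le_of_sq_le (hQ _ _) (hQ _ _))
        (abs_nonneg _) (by positivity)
    have t2 : |(∑ m, ∑ n, γ m n i j l k * Dw s (ex j) (Dw s (ex n) (S m)) p)
        * (Dw s et (W i) p * Dw s (ex k) (W l) p)| ≤ 3 * (3 * (Γ * B)) * N := by
      rw [abs_mul]
      exact mul_le_mul (hg _ (fun m n => hSx j m n) i j l k)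
        (abs_mul_le_of_sq_le (hP _) (hQ _ _)) (abs_nonneg _) (by positivity)
    have t3 : |Dw s et (W i) p * ((∑ m, ∑ n, γ m n i j l k * Dw s (ex n) (W m) p)
        * Dw s (ex k) (Dw s (ex j) (S l)) p)| ≤ 3 * (3 * (Γ * B * N)) := by
      have : Dw s et (W i) p * ((∑ m, ∑ n, γ m n i j l k * Dw s (ex n) (W m) p)
          * Dw s (ex k) (Dw s (ex j) (S l)) p)
          = ∑ m, ∑ n, γ m n i j l k * Dw s (ex k) (Dw s (ex j) (S l)) p
            * (Dw s et (W i) p * Dw s (ex n) (W m) p) := by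
        simp only [Finset.mul_sum, Finset.sum_mul]
        refine Finset.sum_congr rfl fun m _ => Finset.sum_congr rfl fun n _ => ?_
        ring
      rw [this]
      refine abs_sum_three_le fun m => abs_sum_three_le fun n => ?_
      rw [abs_mul, abs_mul]
      exact mul_le_mul (mul_le_mul (hγ _ _ _ _ _ _) (hSx _ _ _) (abs_nonneg _) hΓ)
        (abs_mul_le_of_sq_le (hP _) (hQ _ _)) (abs_nonneg _) (by positivity)
    rw [abs_le] at t1 t2 t3 ⊢
    have : 0 ≤ Γ * B * N := by positivity
    constructor <;> linarith [t1.1, t1.2, t2.1, t2.2, t3.1, t3.2]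
  have h5 := abs_sum_three_le fun i => abs_sum_three_le fun j => abs_sum_three_le fun l =>
    abs_sum_three_le fun k => h4 i j l k
  have h6 : |∑ i, W i p * Dw s et (W i) p| ≤ 3 * N :=
    abs_sum_three_le fun i => abs_mul_le_of_sq_le (hW i) (hP i)
  unfold energyRem
  linarith [le_abs_self (∑ i, W i p * Dw s et (W i) p), (abs_le.1 h5).2]

end Rem

/-- The space-time slab `ℝ³ × [0, T)`. -/
abbrev slab (T : ℝ) : Set SpT := Set.univ ×ˢ Set.Ico 0 T

theorem uniqueDiffOn_slab (T : ℝ) : UniqueDiffOn ℝ (slab T) :=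
  uniqueDiffOn_univ.prod (uniqueDiffOn_Ico 0 T)

theorem slab_subset_closure_interior (T : ℝ) : slab T ⊆ closure (interior (slab T)) := by
  rintro ⟨x, t⟩ ⟨-, ht⟩
  rw [interior_prod_eq, interior_Ico, closure_prod_eq, closure_Ioo (ht.1.trans_lt ht.2).ne]
  exact ⟨by simp, ht.1, ht.2.le⟩

section Slice

variable {T : ℝ} {F : SpT → ℝ} {x : Fin 3 → ℝ} {t : ℝ}

theorem hasFDerivAt_slice (hF : DifferentiableWithinAt ℝ F (slab T) (x, t)) (ht : t ∈ Set.Ico 0 T) :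
    HasFDerivAt (fun y => F (y, t))
      ((fderivWithin ℝ F (slab T) (x, t)).comp (ContinuousLinearMap.inl ℝ (Fin 3 → ℝ) ℝ)) x := by
  have h := hF.hasFDerivWithinAt.comp (f := fun y : Fin 3 → ℝ => ((y, t) : SpT)) (s := Set.univ) x
    (hasFDerivAt_prodMk_left x t).hasFDerivWithinAt fun y _ => ⟨trivial, ht⟩
  exact hasFDerivWithinAt_univ.1 h

theorem pd_slice (hF : DifferentiableWithinAt ℝ F (slab T) (x, t)) (ht : t ∈ Set.Ico 0 T)
    (j : Fin 3) : pd (fun y => F (y, t)) j x = Dw (slab T) (ex j) F (x, t) := by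
  unfold pd Dw
  rw [(hasFDerivAt_slice hF ht).fderiv]
  simp [ex]

theorem hasDerivWithinAt_slice (hF : DifferentiableWithinAt ℝ F (slab T) (x, t)) :
    HasDerivWithinAt (fun r => F (x, r)) (Dw (slab T) et F (x, t)) (Set.Ico 0 T) t := by
  have h := hF.hasFDerivWithinAt.comp_hasDerivWithinAt (f := fun r : ℝ => ((x, r) : SpT))
    (s := Set.Ico 0 T) t
    (hasFDerivAt_prodMk_right x t).hasDerivAt.hasDerivWithinAt fun r hr => ⟨trivial, hr⟩
  simpa [Dw, et, Function.comp_def] using h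

theorem hasDerivAt_slice (hF : DifferentiableWithinAt ℝ F (slab T) (x, t))
    (ht : t ∈ Set.Ioo 0 T) :
    HasDerivAt (fun r => F (x, r)) (Dw (slab T) et F (x, t)) t :=
  (hasDerivWithinAt_slice hF).hasDerivAt (Ico_mem_nhds ht.1 ht.2)

theorem contDiff_slice {n : WithTop ℕ∞} (hF : ContDiffOn ℝ n F (slab T)) (ht : t ∈ Set.Ico 0 T) :
    ContDiff ℝ n fun y => F (y, t) :=
  contDiffOn_univ.1 <| hF.comp (f := fun y : Fin 3 → ℝ => ((y, t) : SpT)) (s := Set.univ)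
    (contDiff_id.prodMk contDiff_const).contDiffOn fun _ _ => ⟨trivial, ht⟩

end Slice

/-- Squared Euclidean distance. -/
def sqd (z x : Fin 3 → ℝ) : ℝ := ∑ j, (x j - z j) ^ 2

/-- Truncation function of a backward cone with speed `C` and initial radius `ρ`. -/
def coneFun (z : Fin 3 → ℝ) (ρ C : ℝ) (p : SpT) : ℝ := (ρ - C * p.2) ^ 2 - sqd z p.1

/-- Smooth weight supported in a backward cone. -/
def coneWeight (z : Fin 3 → ℝ) (ρ C : ℝ) (p : SpT) : ℝ := expNegInvGlue (coneFun z ρ C p)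

theorem contDiff_coneFun (z : Fin 3 → ℝ) (ρ C : ℝ) {n : WithTop ℕ∞} :
    ContDiff ℝ n (coneFun z ρ C) := by
  unfold coneFun sqd; fun_prop

theorem contDiff_coneWeight (z : Fin 3 → ℝ) (ρ C : ℝ) :
    ContDiff ℝ (⊤ : ℕ∞) (coneWeight z ρ C) :=
  expNegInvGlue.contDiff.comp (contDiff_coneFun z ρ C)

theorem deriv_expNegInvGlue_nonneg (x : ℝ) : 0 ≤ deriv expNegInvGlue x :=
  expNegInvGlue.monotone.deriv_nonneg

theorem deriv_expNegInvGlue_of_nonpos {x : ℝ} (hx : x ≤ 0) : deriv expNegInvGlue x = 0 := by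
  refine IsLocalMin.deriv_eq_zero (Filter.Eventually.of_forall fun y => ?_)
  rw [expNegInvGlue.zero_of_nonpos hx]
  exact expNegInvGlue.nonneg y

theorem hasFDerivAt_coneFun (z : Fin 3 → ℝ) (ρ C : ℝ) (p : SpT) :
    HasFDerivAt (coneFun z ρ C)
      ((-(2 * C * (ρ - C * p.2))) • ContinuousLinearMap.snd ℝ (Fin 3 → ℝ) ℝ
        - ∑ j, (2 * (p.1 j - z j)) •
          ((ContinuousLinearMap.proj j).comp (ContinuousLinearMap.fst ℝ (Fin 3 → ℝ) ℝ))) p := by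
  unfold coneFun sqd
  refine HasFDerivAt.fun_sub ?_ (HasFDerivAt.fun_sum fun j _ => ?_)
  · have h := (((ContinuousLinearMap.snd ℝ (Fin 3 → ℝ) ℝ).hasFDerivAt (x := p)).const_mul C
      |>.const_sub ρ).pow 2
    refine h.congr_fderiv ?_
    ext
    · simp
    · simp; ring
  · have h := ((((ContinuousLinearMap.proj (R := ℝ) (φ := fun _ : Fin 3 => ℝ) j).comp
      (ContinuousLinearMap.fst ℝ (Fin 3 → ℝ) ℝ)).hasFDerivAt (x := p)).sub_const (z j)).pow 2
    refine h.congr_fderiv ?_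
    ext <;> simp

theorem Dw_coneWeight {T : ℝ} (z : Fin 3 → ℝ) (ρ C : ℝ) {p : SpT} (hp : p ∈ slab T) :
    Dw (slab T) et (coneWeight z ρ C) p
        = -(deriv expNegInvGlue (coneFun z ρ C p) * (2 * C * (ρ - C * p.2))) ∧
    ∀ j, Dw (slab T) (ex j) (coneWeight z ρ C) p
        = -(deriv expNegInvGlue (coneFun z ρ C p) * (2 * (p.1 j - z j))) := by
  have h1 : HasDerivAt expNegInvGlue (deriv expNegInvGlue (coneFun z ρ C p)) (coneFun z ρ C p) :=
    ((expNegInvGlue.contDiff (n := 1)).differentiable (by norm_num) _).hasDerivAt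
  have h2 := h1.comp_hasFDerivAt p (hasFDerivAt_coneFun z ρ C p)
  have h3 : fderivWithin ℝ (coneWeight z ρ C) (slab T) p = _ :=
    h2.hasFDerivWithinAt.fderivWithin (uniqueDiffOn_slab T p hp)
  unfold Dw
  rw [h3]
  constructor
  · simp [et]
  · intro j
    simp [ex, Pi.single_apply, mul_comm]

theorem isCompact_sqd_le (z : Fin 3 → ℝ) (r : ℝ) : IsCompact {x | sqd z x ≤ r} := by
  refine Metric.isCompact_of_isClosed_isBounded ?_ ?_
  · exact isClosed_le (by unfold sqd; fun_prop) continuous_const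
  · refine (Metric.isBounded_closedBall (x := z) (r := Real.sqrt r)).subset fun x hx => ?_
    rw [Metric.mem_closedBall, dist_pi_le_iff (Real.sqrt_nonneg _)]
    intro j
    rw [Real.dist_eq]
    refine Real.abs_le_sqrt ?_
    refine le_trans ?_ hx
    exact Finset.single_le_sum (f := fun j => (x j - z j) ^ 2) (fun j _ => sq_nonneg _)
      (Finset.mem_univ j)

section Local

variable {T : ℝ} {L : Fin 3 → Fin 3 → Fin 3 → Fin 3 → ℝ}
  {γ : Fin 3 → Fin 3 → Fin 3 → Fin 3 → Fin 3 → Fin 3 → ℝ} {S W : Fin 3 → SpT → ℝ}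

/-- All first derivatives of `W`, and `W` itself, vanish at `p`. -/
def VanishAt (T : ℝ) (W : Fin 3 → SpT → ℝ) (p : SpT) : Prop :=
  ∀ i, W i p = 0 ∧ Dw (slab T) et (W i) p = 0 ∧ ∀ j, Dw (slab T) (ex j) (W i) p = 0

theorem vanish_of_cone_energy (hS : ∀ i, ContDiffOn ℝ (⊤ : ℕ∞) (S i) (slab T))
    (hW : ∀ i, ContDiffOn ℝ (⊤ : ℕ∞) (W i) (slab T))
    (hL : ∀ i j l k, L i j l k = L l k i j)
    (hγ : ∀ m n i j l k, γ m n i j l k = γ m n l k i j)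
    (hpde : ∀ x, ∀ t ∈ Set.Ioo 0 T, ∀ i, Dw (slab T) et (Dw (slab T) et (W i)) (x, t)
      = ∑ j, ∑ l, ∑ k,
        (Acoef (slab T) L γ S i j l k (x, t) * Dw (slab T) (ex k) (Dw (slab T) (ex j) (W l)) (x, t)
        + (∑ m, ∑ n, γ m n i j l k * Dw (slab T) (ex n) (W m) (x, t))
          * Dw (slab T) (ex k) (Dw (slab T) (ex j) (S l)) (x, t)))
    {z : Fin 3 → ℝ} {ρ C c₀ t₁ t₂ : ℝ} (hC : 0 < C) (hCT : C * T ≤ ρ) (hc₀ : 0 < c₀)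
    (ht₁ : 0 ≤ t₁) (ht₂ : t₂ < T)
    (hcoer : ∀ t ∈ Set.Icc t₁ t₂, ∀ x, sqd z x < (ρ - C * t) ^ 2 → ∀ Z : Fin 3 → Fin 3 → ℝ,
      c₀ * ∑ i, ∑ j, Z i j * Z i j ≤ qf (fun i j l k => Acoef (slab T) L γ S i j l k (x, t)) Z Z)
    (hspeed : ∀ t ∈ Set.Icc t₁ t₂, ∀ x, sqd z x < (ρ - C * t) ^ 2 → ∀ V : Fin 3 → ℝ,
      qf (fun i j l k => Acoef (slab T) L γ S i j l k (x, t))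
        (fun i j => V i * (x j - z j)) (fun i j => V i * (x j - z j))
        ≤ (C * (ρ - C * t)) ^ 2 * ∑ i, V i * V i)
    (hinit : ∀ x, sqd z x < (ρ - C * t₁) ^ 2 → VanishAt T W (x, t₁)) :
    ∀ t ∈ Set.Icc t₁ t₂, ∀ x, sqd z x < (ρ - C * t) ^ 2 → VanishAt T W (x, t) := by
  have hu := uniqueDiffOn_slab T
  set K : Set (Fin 3 → ℝ) := {x | sqd z x ≤ ρ ^ 2} with hKdef
  have hK : IsCompact K := isCompact_sqd_le z _
  set φ := coneWeight z ρ C with hφ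
  set e := energyDens (slab T) L γ S W with he
  have hφc : ContDiffOn ℝ (⊤ : ℕ∞) φ (slab T) := (contDiff_coneWeight z ρ C).contDiffOn
  have hec : ContDiffOn ℝ (⊤ : ℕ∞) e (slab T) := contDiffOn_energyDens hu hS hW
  have hFc : ∀ j, ContDiffOn ℝ (⊤ : ℕ∞) (energyFlux (slab T) L γ S W j) (slab T) := fun j =>
    contDiffOn_energyFlux hu hS hW j
  have hGc : ContDiffOn ℝ (⊤ : ℕ∞) (fun q => φ q * e q) (slab T) := hφc.mul hec
  have hIcc : ∀ t ∈ Set.Icc t₁ t₂, t ∈ Set.Ico 0 T := fun t ht =>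
    ⟨ht₁.trans ht.1, ht.2.trans_lt ht₂⟩
  have hapos : ∀ t ∈ Set.Ico 0 T, 0 < ρ - C * t := fun t ht => by nlinarith [ht.2]
  have hout : ∀ t ∈ Set.Ico 0 T, ∀ x ∉ K, coneFun z ρ C (x, t) ≤ 0 := fun t ht x hx => by
    have h1 : ρ ^ 2 < sqd z x := not_le.1 hx
    have h2 := hapos t ht
    have : (ρ - C * t) ^ 2 ≤ ρ ^ 2 := by
      have : 0 ≤ C * t := mul_nonneg hC.le ht.1
      exact pow_le_pow_left₀ h2.le (by linarith) 2
    simp only [coneFun]; linarith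
  have hφ0 : ∀ p, coneFun z ρ C p ≤ 0 → φ p = 0 := fun p hp => expNegInvGlue.zero_of_nonpos hp
  have hφn : ∀ p, 0 ≤ φ p := fun p => expNegInvGlue.nonneg _
  have hin : ∀ x t, 0 < coneFun z ρ C (x, t) → sqd z x < (ρ - C * t) ^ 2 := fun x t h => by
    simp only [coneFun] at h; linarith
  -- lower bound for the energy density
  have hlow : ∀ t ∈ Set.Icc t₁ t₂, ∀ x, sqd z x < (ρ - C * t) ^ 2 →
      min c₀ 1 / 2 * (∑ i, Dw (slab T) et (W i) (x, t) * Dw (slab T) et (W i) (x, t)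
        + ∑ i, ∑ j, Dw (slab T) (ex j) (W i) (x, t) * Dw (slab T) (ex j) (W i) (x, t)
        + ∑ i, W i (x, t) * W i (x, t)) ≤ e (x, t) := by
    intro t ht x hx
    have h := hcoer t ht x hx fun i j => Dw (slab T) (ex j) (W i) (x, t)
    have n1 : 0 ≤ ∑ i, Dw (slab T) et (W i) (x, t) * Dw (slab T) et (W i) (x, t) :=
      Finset.sum_nonneg fun i _ => mul_self_nonneg _
    have n2 : 0 ≤ ∑ i, ∑ j, Dw (slab T) (ex j) (W i) (x, t) * Dw (slab T) (ex j) (W i) (x, t) :=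
      Finset.sum_nonneg fun i _ => Finset.sum_nonneg fun j _ => mul_self_nonneg _
    have n3 : 0 ≤ ∑ i, W i (x, t) * W i (x, t) := Finset.sum_nonneg fun i _ => mul_self_nonneg _
    have m1 : min c₀ 1 ≤ c₀ := min_le_left _ _
    have m2 : min c₀ 1 ≤ 1 := min_le_right _ _
    have k1 := mul_le_mul_of_nonneg_right m2 n1
    have k2 := mul_le_mul_of_nonneg_right m1 n2
    have k3 := mul_le_mul_of_nonneg_right m2 n3
    simp only [he, energyDens]
    unfold qf at h
    linarith
  have hmin : 0 < min c₀ 1 / 2 := by positivity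
  -- bounds for the coefficients
  obtain ⟨Γ, hΓ⟩ : ∃ Γ, ∀ m n i j l k, |γ m n i j l k| ≤ Γ := by
    obtain ⟨Γ, hΓ⟩ := (Set.finite_range fun q : Fin 3 × Fin 3 × Fin 3 × Fin 3 × Fin 3 × Fin 3 =>
      |γ q.1 q.2.1 q.2.2.1 q.2.2.2.1 q.2.2.2.2.1 q.2.2.2.2.2|).bddAbove
    exact ⟨Γ, fun m n i j l k => hΓ ⟨(m, n, i, j, l, k), rfl⟩⟩
  have hKI : IsCompact (K ×ˢ Set.Icc t₁ t₂) := hK.prod isCompact_Icc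
  have hKIs : K ×ˢ Set.Icc t₁ t₂ ⊆ slab T := fun q hq => ⟨trivial, hIcc _ hq.2⟩
  have hbd : ∀ F : SpT → ℝ, ContDiffOn ℝ (⊤ : ℕ∞) F (slab T) →
      ∃ B, ∀ x ∈ K, ∀ t ∈ Set.Icc t₁ t₂, |F (x, t)| ≤ B := fun F hF => by
    obtain ⟨B, hB⟩ := hKI.exists_bound_of_continuousOn (hF.continuousOn.mono hKIs)
    exact ⟨B, fun x hx t ht => hB (x, t) ⟨hx, ht⟩⟩
  choose B₁ hB₁ using fun (q : Fin 3 × Fin 3) =>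
    hbd _ (contDiffOn_Dw hu (contDiffOn_Dw hu (hS q.1) (ex q.2)) et)
  choose B₂ hB₂ using fun (q : Fin 3 × Fin 3 × Fin 3) =>
    hbd _ (contDiffOn_Dw hu (contDiffOn_Dw hu (hS q.1) (ex q.2.1)) (ex q.2.2))
  obtain ⟨B, hB0, hBt, hBx⟩ : ∃ B, 0 ≤ B ∧ (∀ q, B₁ q ≤ B) ∧ ∀ q, B₂ q ≤ B := by
    obtain ⟨b₁, h₁⟩ := (Set.finite_range B₁).bddAbove
    obtain ⟨b₂, h₂⟩ := (Set.finite_range B₂).bddAbove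
    exact ⟨max 0 (max b₁ b₂), le_max_left _ _,
      fun q => (h₁ ⟨q, rfl⟩).trans ((le_max_left _ _).trans (le_max_right _ _)),
      fun q => (h₂ ⟨q, rfl⟩).trans ((le_max_right _ _).trans (le_max_right _ _))⟩
  have hΓ0 : 0 ≤ Γ := (abs_nonneg _).trans (hΓ 0 0 0 0 0 0)
  set M := (81 * (27 * Γ * B) + 3) / (min c₀ 1 / 2) with hM
  have hrem : ∀ t ∈ Set.Icc t₁ t₂, ∀ x, sqd z x < (ρ - C * t) ^ 2 →
      energyRem (slab T) γ S W (x, t) ≤ M * e (x, t) := by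
    intro t ht x hx
    have hxK : x ∈ K := by
      by_contra hxK
      have := hout t (hIcc t ht) x hxK
      simp only [coneFun] at this; linarith
    have h1 := energyRem_le (s := slab T) (γ := γ) (S := S) (W := W) (p := (x, t)) hB0 hΓ
      (fun m n => (hB₁ (m, n) x hxK t ht).trans (hBt _))
      (fun j m n => (hB₂ (m, n, j) x hxK t ht).trans (hBx _))
    refine h1.trans ?_
    rw [hM, div_mul_eq_mul_div, le_div_iff₀ hmin, mul_assoc]
    refine mul_le_mul_of_nonneg_left ?_ (by positivity)
    rw [mul_comm]
    exact hlow t ht x hx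
  obtain ⟨B₃, hB₃⟩ := hbd _ (contDiffOn_Dw hu hGc et)
  have hzero := eq_zero_of_deriv_le_add_div (G := fun x t => φ (x, t) * e (x, t))
    (G' := fun x t => Dw (slab T) et (fun q => φ q * e q) (x, t))
    (Fl := fun j t x => φ (x, t) * energyFlux (slab T) L γ S W j (x, t)) (K := K) hK
    (t₁ := t₁) (t₂ := t₂) (M := M) (C := max B₃ 0)
    (hGc.continuousOn.mono fun q hq => ⟨trivial, hIcc _ hq.2⟩)
    (fun t ht x hx => by simp only [hφ0 _ (hout t (hIcc t ht) x hx), zero_mul])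
    ?_ ?_ ?_ ?_ ?_ ?_ ?_ ?_ ?_
  · intro t ht x hx
    have hpos : 0 < coneFun z ρ C (x, t) := by simp only [coneFun]; linarith
    have h1 := hzero t ht x
    have h2 : e (x, t) = 0 := by
      rcases mul_eq_zero.1 h1 with h | h
      · exact absurd h (expNegInvGlue.pos_of_pos hpos).ne'
      · exact h
    have h3 := hlow t ht x hx
    rw [h2] at h3
    have n1 : ∀ i, 0 ≤ Dw (slab T) et (W i) (x, t) * Dw (slab T) et (W i) (x, t) := fun i => mul_self_nonneg _
    have n2 : ∀ i j, 0 ≤ Dw (slab T) (ex j) (W i) (x, t) * Dw (slab T) (ex j) (W i) (x, t) :=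
      fun i j => mul_self_nonneg _
    have n2' : ∀ i, 0 ≤ ∑ j, Dw (slab T) (ex j) (W i) (x, t) * Dw (slab T) (ex j) (W i) (x, t) :=
      fun i => Finset.sum_nonneg fun j _ => n2 i j
    have n3 : ∀ i, 0 ≤ W i (x, t) * W i (x, t) := fun i => mul_self_nonneg _
    have s1 := Finset.sum_nonneg fun i (_ : i ∈ Finset.univ) => n1 i
    have s2 := Finset.sum_nonneg fun i (_ : i ∈ Finset.univ) => n2' i
    have s3 := Finset.sum_nonneg fun i (_ : i ∈ Finset.univ) => n3 i
    have h4 := nonpos_of_mul_nonpos_right h3 hmin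
    intro i
    have z1 := (Finset.sum_eq_zero_iff_of_nonneg fun i _ => n1 i).1
      (le_antisymm (by linarith) s1) i (Finset.mem_univ i)
    have z2 := (Finset.sum_eq_zero_iff_of_nonneg fun i _ => n2' i).1
      (le_antisymm (by linarith) s2) i (Finset.mem_univ i)
    have z3 := (Finset.sum_eq_zero_iff_of_nonneg fun i _ => n3 i).1
      (le_antisymm (by linarith) s3) i (Finset.mem_univ i)
    refine ⟨mul_self_eq_zero.1 z3, mul_self_eq_zero.1 z1, fun j => ?_⟩
    exact mul_self_eq_zero.1 ((Finset.sum_eq_zero_iff_of_nonneg fun j _ => n2 i j).1 z2 j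
      (Finset.mem_univ j))
  · intro t ht x
    by_cases h : coneFun z ρ C (x, t) ≤ 0
    · simp only [hφ0 _ h, zero_mul, le_refl]
    · refine mul_nonneg (hφn _) (le_trans ?_ (hlow t ht x (hin x t (not_le.1 h))))
      refine mul_nonneg hmin.le (add_nonneg (add_nonneg ?_ ?_) ?_)
      · exact Finset.sum_nonneg fun i _ => mul_self_nonneg _
      · exact Finset.sum_nonneg fun i _ => Finset.sum_nonneg fun j _ => mul_self_nonneg _
      · exact Finset.sum_nonneg fun i _ => mul_self_nonneg _
  · intro x
    by_cases h : coneFun z ρ C (x, t₁) ≤ 0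
    · simp only [hφ0 _ h, zero_mul]
    · have := hinit x (hin x t₁ (not_le.1 h))
      have h0 : e (x, t₁) = 0 := by
        simp only [he, energyDens]
        simp [(this _).1, (this _).2.1, (this _).2.2]
      simp only [h0, mul_zero]
  · intro t ht x
    have ht' := Set.Ioo_subset_Icc_self ht
    exact hasDerivAt_slice (F := fun q => φ q * e q)
      (hGc.differentiableOn (by simp) _ ⟨trivial, hIcc t ht'⟩)
      ⟨ht₁.trans_lt ht.1, (hIcc t ht').2⟩
  · intro t ht
    exact (contDiff_slice (contDiffOn_Dw hu hGc et) (hIcc t (Set.Ioo_subset_Icc_self ht))).continuous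
  · intro t ht x hx
    have hmem : ((x, t) : SpT) ∈ slab T := ⟨trivial, hIcc t (Set.Ioo_subset_Icc_self ht)⟩
    have h0 := hout t hmem.2 x hx
    rw [Dw_mul (hu _ hmem) (hφc.differentiableOn (by simp) _ hmem)
      (hec.differentiableOn (by simp) _ hmem), hφ0 _ h0, (Dw_coneWeight z ρ C hmem).1,
      deriv_expNegInvGlue_of_nonpos h0]
    simp
  · intro t ht x
    have ht' := Set.Ioo_subset_Icc_self ht
    by_cases hx : x ∈ K
    · exact (hB₃ x hx t ht').trans (le_max_left _ _)
    · have hmem : ((x, t) : SpT) ∈ slab T := ⟨trivial, hIcc t ht'⟩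
      have h0 := hout t hmem.2 x hx
      rw [Dw_mul (hu _ hmem) (hφc.differentiableOn (by simp) _ hmem)
        (hec.differentiableOn (by simp) _ hmem), hφ0 _ h0, (Dw_coneWeight z ρ C hmem).1,
        deriv_expNegInvGlue_of_nonpos h0]
      simp
  · intro t ht j
    exact contDiff_slice (((hφc.mul (hFc j)).of_le (by norm_cast)))
      (hIcc t (Set.Ioo_subset_Icc_self ht))
  · intro t ht j x hx
    simp only [hφ0 _ (hout t (hIcc t (Set.Ioo_subset_Icc_self ht)) x hx), zero_mul]
  · intro t ht x
    have ht' := Set.Ioo_subset_Icc_self ht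
    have hmem : ((x, t) : SpT) ∈ slab T := ⟨trivial, hIcc t ht'⟩
    have hts : t ∈ Set.Ioo 0 T := ⟨ht₁.trans_lt ht.1, hmem.2.2⟩
    have dφ := hφc.differentiableOn (by simp) _ hmem
    have de := hec.differentiableOn (by simp) _ hmem
    have dF : ∀ j, DifferentiableWithinAt ℝ (energyFlux (slab T) L γ S W j) (slab T) (x, t) := fun j =>
      (hFc j).differentiableOn (by simp) _ hmem
    have hpdF : ∀ j, pd (fun y => φ (y, t) * energyFlux (slab T) L γ S W j (y, t)) j x
        = φ (x, t) * Dw (slab T) (ex j) (energyFlux (slab T) L γ S W j) (x, t)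
          + Dw (slab T) (ex j) φ (x, t) * energyFlux (slab T) L γ S W j (x, t) := fun j => by
      rw [← Dw_mul (hu _ hmem) dφ (dF j)]
      exact pd_slice (F := fun q => φ q * energyFlux (slab T) L γ S W j q) (dφ.fun_mul (dF j)) hmem.2 j
    have hene := Dw_energyDens hu (slab_subset_closure_interior T) hS hW hL hγ hmem
      (hpde x t hts)
    simp only [hpdF]
    rw [Dw_mul (hu _ hmem) dφ de, hene, (Dw_coneWeight z ρ C hmem).1]
    have hDφ : ∀ j, Dw (slab T) (ex j) φ (x, t)
        = -(deriv expNegInvGlue (coneFun z ρ C (x, t)) * (2 * (x j - z j))) :=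
      (Dw_coneWeight z ρ C hmem).2
    simp only [hDφ, Finset.sum_add_distrib, ← Finset.mul_sum]
    by_cases h : coneFun z ρ C (x, t) ≤ 0
    · rw [hφ0 _ h, deriv_expNegInvGlue_of_nonpos h]
      simp
    · have hx := hin x t (not_le.1 h)
      have hr := mul_le_mul_of_nonneg_left (hrem t ht' x hx) (hφn (x, t))
      have ha := hapos t hmem.2
      have hAs : ∀ i j l k, Acoef (slab T) L γ S i j l k (x, t) = Acoef (slab T) L γ S l k i j (x, t) := by
        intro i j l k
        unfold Acoef
        rw [hL i j l k]
        congr 1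
        exact Finset.sum_congr rfl fun m _ => Finset.sum_congr rfl fun n _ => by rw [hγ]
      have hfl := qf_tensor_le (A := fun i j l k => Acoef (slab T) L γ S i j l k (x, t)) hAs
        (fun Y => le_trans (mul_nonneg hc₀.le (Finset.sum_nonneg fun i _ =>
          Finset.sum_nonneg fun j _ => mul_self_nonneg _)) (hcoer t ht' x hx Y))
        (b := C * (ρ - C * t)) (mul_pos hC ha) (P := fun i => Dw (slab T) et (W i) (x, t))
        (d := fun j => x j - z j) (fun l k => Dw (slab T) (ex k) (W l) (x, t))
        (hspeed t ht' x hx fun i => Dw (slab T) et (W i) (x, t))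
      have hsum : ∑ j, (x j - z j) * energyFlux (slab T) L γ S W j (x, t)
          = qf (fun i j l k => Acoef (slab T) L γ S i j l k (x, t))
            (fun i j => Dw (slab T) et (W i) (x, t) * (x j - z j)) fun l k => Dw (slab T) (ex k) (W l) (x, t) := by
        unfold qf energyFlux
        simp only [Finset.mul_sum]
        rw [Finset.sum_comm]
        refine Finset.sum_congr rfl fun j _ => Finset.sum_congr rfl fun i _ =>
          Finset.sum_congr rfl fun l _ => Finset.sum_congr rfl fun k _ => ?_
        ring
      have hen : 1 / 2 * (∑ i, Dw (slab T) et (W i) (x, t) * Dw (slab T) et (W i) (x, t)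
          + qf (fun i j l k => Acoef (slab T) L γ S i j l k (x, t))
            (fun l k => Dw (slab T) (ex k) (W l) (x, t)) fun l k => Dw (slab T) (ex k) (W l) (x, t))
          ≤ e (x, t) := by
        have n3 : 0 ≤ ∑ i, W i (x, t) * W i (x, t) :=
          Finset.sum_nonneg fun i _ => mul_self_nonneg _
        simp only [he, energyDens]
        unfold qf
        linarith
      have hfl2 : ∑ j, (x j - z j) * energyFlux (slab T) L γ S W j (x, t)
          ≤ C * (ρ - C * t) * e (x, t) := by
        rw [hsum]
        exact hfl.trans (mul_le_mul_of_nonneg_left hen (mul_pos hC ha).le)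
      have hΘ := mul_le_mul_of_nonneg_left hfl2
        (deriv_expNegInvGlue_nonneg (coneFun z ρ C (x, t)))
      have hre : ∑ j, -(deriv expNegInvGlue (coneFun z ρ C (x, t)) * (2 * (x j - z j)))
          * energyFlux (slab T) L γ S W j (x, t)
          = -(2 * (deriv expNegInvGlue (coneFun z ρ C (x, t))
            * ∑ j, (x j - z j) * energyFlux (slab T) L γ S W j (x, t))) := by
        simp only [Finset.mul_sum, ← Finset.sum_neg_distrib]
        refine Finset.sum_congr rfl fun j _ => ?_
        ring
      rw [hre]
      linarith

end Local

theorem Dw_congr {s : Set SpT} {v p : SpT} {F G : SpT → ℝ} (h : ∀ q ∈ s, F q = G q)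
    (hp : p ∈ s) : Dw s v F p = Dw s v G p := by
  unfold Dw
  rw [fderivWithin_congr' h hp]

section Unique

variable {T : ℝ} {L : Fin 3 → Fin 3 → Fin 3 → Fin 3 → ℝ}
  {γ : Fin 3 → Fin 3 → Fin 3 → Fin 3 → Fin 3 → Fin 3 → ℝ} {U V : Fin 3 → SpT → ℝ}

/-- Two smooth solutions of a quasilinear system with the same Cauchy data on a ball coincide on a
backward cone, as long as the system stays hyperbolic with speed at most `C` near one of them. -/
theorem vanish_sub_of_cone (hU : ∀ i, ContDiffOn ℝ (⊤ : ℕ∞) (U i) (slab T))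
    (hV : ∀ i, ContDiffOn ℝ (⊤ : ℕ∞) (V i) (slab T))
    (hL : ∀ i j l k, L i j l k = L l k i j)
    (hγ : ∀ m n i j l k, γ m n i j l k = γ m n l k i j)
    (hUeq : ∀ x, ∀ t ∈ Set.Ioo 0 T, ∀ i, Dw (slab T) et (Dw (slab T) et (U i)) (x, t)
      = ∑ j, ∑ l, ∑ k, Acoef (slab T) L γ U i j l k (x, t)
        * Dw (slab T) (ex k) (Dw (slab T) (ex j) (U l)) (x, t))
    (hVeq : ∀ x, ∀ t ∈ Set.Ioo 0 T, ∀ i, Dw (slab T) et (Dw (slab T) et (V i)) (x, t)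
      = ∑ j, ∑ l, ∑ k, Acoef (slab T) L γ V i j l k (x, t)
        * Dw (slab T) (ex k) (Dw (slab T) (ex j) (V l)) (x, t))
    {z : Fin 3 → ℝ} {ρ C c₀ δ : ℝ} (hC : 0 < C) (hCT : C * T ≤ ρ) (hc₀ : 0 < c₀) (hδ : 0 < δ)
    (hhyp : ∀ t ∈ Set.Ico 0 T, ∀ x, sqd z x < (ρ - C * t) ^ 2 → ∀ X : Fin 3 → Fin 3 → ℝ,
      (∀ a b, |X a b - Dw (slab T) (ex b) (V a) (x, t)| ≤ δ) →
      (∀ Z : Fin 3 → Fin 3 → ℝ, c₀ * ∑ i, ∑ j, Z i j * Z i j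
        ≤ qf (fun i j l k => L i j l k + ∑ m, ∑ n, γ m n i j l k * X m n) Z Z) ∧
      ∀ P : Fin 3 → ℝ, qf (fun i j l k => L i j l k + ∑ m, ∑ n, γ m n i j l k * X m n)
        (fun i j => P i * (x j - z j)) (fun i j => P i * (x j - z j))
        ≤ (C * (ρ - C * t)) ^ 2 * ∑ i, P i * P i)
    (hinit : ∀ x, sqd z x < ρ ^ 2 → VanishAt T (fun i p => U i p - V i p) (x, 0)) :
    ∀ t ∈ Set.Ico 0 T, ∀ x, sqd z x < (ρ - C * t) ^ 2 →
      VanishAt T (fun i p => U i p - V i p) (x, t) := by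
  intro tf htf
  have hu := uniqueDiffOn_slab T
  have hT : 0 < T := htf.1.trans_lt htf.2
  set W : Fin 3 → SpT → ℝ := fun i p => U i p - V i p with hWdef
  set S : Fin 3 → SpT → ℝ := fun i p => 2⁻¹ * (U i p + V i p) with hSdef
  have hWc : ∀ i, ContDiffOn ℝ (⊤ : ℕ∞) (W i) (slab T) := fun i => (hU i).sub (hV i)
  have hSc : ∀ i, ContDiffOn ℝ (⊤ : ℕ∞) (S i) (slab T) := fun i =>
    contDiffOn_const.mul ((hU i).add (hV i))
  have hne : ((⊤ : ℕ∞) : WithTop ℕ∞) ≠ 0 := by simp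
  have dW : ∀ {F G : SpT → ℝ}, ContDiffOn ℝ (⊤ : ℕ∞) F (slab T) →
      ContDiffOn ℝ (⊤ : ℕ∞) G (slab T) → ∀ v, ∀ p ∈ slab T,
      Dw (slab T) v (fun q => F q - G q) p = Dw (slab T) v F p - Dw (slab T) v G p :=
    fun hF hG v p hp =>
      Dw_sub (hu p hp) (hF.differentiableOn hne p hp) (hG.differentiableOn hne p hp)
  have dS : ∀ {F G : SpT → ℝ}, ContDiffOn ℝ (⊤ : ℕ∞) F (slab T) →
      ContDiffOn ℝ (⊤ : ℕ∞) G (slab T) → ∀ v, ∀ p ∈ slab T,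
      Dw (slab T) v (fun q => 2⁻¹ * (F q + G q)) p
        = 2⁻¹ * (Dw (slab T) v F p + Dw (slab T) v G p) := fun hF hG v p hp => by
    rw [Dw_const_mul (hu p hp) ((hF.add hG).differentiableOn hne p hp),
      Dw_add (hu p hp) (hF.differentiableOn hne p hp) (hG.differentiableOn hne p hp)]
  have dW2 : ∀ i v w, ∀ p ∈ slab T, Dw (slab T) v (Dw (slab T) w (W i)) p
      = Dw (slab T) v (Dw (slab T) w (U i)) p - Dw (slab T) v (Dw (slab T) w (V i)) p := by
    intro i v w p hp
    rw [← dW (contDiffOn_Dw hu (hU i) w) (contDiffOn_Dw hu (hV i) w) v p hp]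
    exact Dw_congr (fun q hq => dW (hU i) (hV i) w q hq) hp
  have dS2 : ∀ i v w, ∀ p ∈ slab T, Dw (slab T) v (Dw (slab T) w (S i)) p
      = 2⁻¹ * (Dw (slab T) v (Dw (slab T) w (U i)) p
        + Dw (slab T) v (Dw (slab T) w (V i)) p) := by
    intro i v w p hp
    rw [← dS (contDiffOn_Dw hu (hU i) w) (contDiffOn_Dw hu (hV i) w) v p hp]
    exact Dw_congr (fun q hq => dS (hU i) (hV i) w q hq) hp
  have hpde : ∀ x, ∀ t ∈ Set.Ioo 0 T, ∀ i, Dw (slab T) et (Dw (slab T) et (W i)) (x, t)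
      = ∑ j, ∑ l, ∑ k,
        (Acoef (slab T) L γ S i j l k (x, t) * Dw (slab T) (ex k) (Dw (slab T) (ex j) (W l)) (x, t)
        + (∑ m, ∑ n, γ m n i j l k * Dw (slab T) (ex n) (W m) (x, t))
          * Dw (slab T) (ex k) (Dw (slab T) (ex j) (S l)) (x, t)) := by
    intro x t ht i
    have hmem : ((x, t) : SpT) ∈ slab T := ⟨trivial, Set.Ioo_subset_Ico_self ht⟩
    rw [dW2 i et et _ hmem, hUeq x t ht i, hVeq x t ht i]
    simp only [← Finset.sum_sub_distrib]
    refine Finset.sum_congr rfl fun j _ => Finset.sum_congr rfl fun l _ =>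
      Finset.sum_congr rfl fun k _ => ?_
    rw [dW2 l _ _ _ hmem, dS2 l _ _ _ hmem]
    have hA : ∀ F : Fin 3 → SpT → ℝ, Acoef (slab T) L γ F i j l k (x, t) = L i j l k
        + ∑ m, ∑ n, γ m n i j l k * Dw (slab T) (ex n) (F m) (x, t) := fun F => rfl
    have e1 : ∑ m, ∑ n, γ m n i j l k * Dw (slab T) (ex n) (W m) (x, t)
        = ∑ m, ∑ n, γ m n i j l k * Dw (slab T) (ex n) (U m) (x, t)
          - ∑ m, ∑ n, γ m n i j l k * Dw (slab T) (ex n) (V m) (x, t) := by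
      simp only [← Finset.sum_sub_distrib]
      refine Finset.sum_congr rfl fun m _ => Finset.sum_congr rfl fun n _ => ?_
      rw [← mul_sub, ← dW (hU m) (hV m) _ _ hmem]
    have e2 : ∑ m, ∑ n, γ m n i j l k * Dw (slab T) (ex n) (S m) (x, t)
        = 2⁻¹ * (∑ m, ∑ n, γ m n i j l k * Dw (slab T) (ex n) (U m) (x, t)
          + ∑ m, ∑ n, γ m n i j l k * Dw (slab T) (ex n) (V m) (x, t)) := by
      simp only [← Finset.sum_add_distrib, Finset.mul_sum]
      refine Finset.sum_congr rfl fun m _ => Finset.sum_congr rfl fun n _ => ?_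
      rw [← mul_add, mul_left_comm, ← dS (hU m) (hV m) _ _ hmem]
    rw [hA U, hA V, hA S, e1, e2]
    ring
  -- uniform continuity in time of the gradient of the difference
  have hIcc : ∀ t ∈ Set.Icc 0 tf, t ∈ Set.Ico 0 T := fun t ht => ⟨ht.1, ht.2.trans_lt htf.2⟩
  have hKI := (isCompact_sqd_le z (ρ ^ 2)).prod (isCompact_Icc (a := (0 : ℝ)) (b := tf))
  have hcont : ContinuousOn (fun p => fun q : Fin 3 × Fin 3 => Dw (slab T) (ex q.2) (W q.1) p)
      ({x | sqd z x ≤ ρ ^ 2} ×ˢ Set.Icc 0 tf) :=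
    continuousOn_pi.2 fun q => (contDiffOn_Dw hu (hWc q.1) (ex q.2)).continuousOn.mono
      fun p hp => ⟨trivial, hIcc _ hp.2⟩
  obtain ⟨τ, hτ, hτW⟩ := Metric.uniformContinuousOn_iff.1
    (hKI.uniformContinuousOn_of_continuous hcont) δ hδ
  have hcone : ∀ t₁ t x, 0 ≤ t₁ → t₁ ≤ t → t ≤ tf → sqd z x < (ρ - C * t) ^ 2 →
      sqd z x < (ρ - C * t₁) ^ 2 := by
    intro t₁ t x _ h h' hx
    refine hx.trans_le (pow_le_pow_left₀ ?_ ?_ 2)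
    · nlinarith [htf.2]
    · nlinarith
  have key : ∀ n : ℕ, ∀ t ∈ Set.Icc 0 (min (n * (τ / 2)) tf), ∀ x, sqd z x < (ρ - C * t) ^ 2 →
      VanishAt T W (x, t) := by
    intro n
    induction n with
    | zero =>
      intro t ht x hx
      have ht0 : t = 0 := le_antisymm (by simpa using ht.2.trans (min_le_left _ _)) ht.1
      subst ht0
      exact hinit x (by simpa using hx)
    | succ n ih =>
      intro t ht x hx
      have hm0 : 0 ≤ min (n * (τ / 2)) tf := le_min (by positivity) htf.1
      rcases le_total t (min (n * (τ / 2)) tf) with h | h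
      · exact ih t ⟨ht.1, h⟩ x hx
      have hsmall : ∀ r ∈ Set.Icc (min (n * (τ / 2)) tf) (min ((n + 1 : ℕ) * (τ / 2)) tf),
          ∀ y, sqd z y < (ρ - C * r) ^ 2 → ∀ a b,
          |Dw (slab T) (ex b) (S a) (y, r) - Dw (slab T) (ex b) (V a) (y, r)| ≤ δ := by
        intro r hr y hy a b
        have hrf : r ≤ tf := hr.2.trans (min_le_right _ _)
        have hr0 : 0 ≤ r := hm0.trans hr.1
        have hmem : ((y, r) : SpT) ∈ slab T := ⟨trivial, hIcc r ⟨hr0, hrf⟩⟩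
        have hy1 := hcone _ r y hm0 hr.1 hrf hy
        have hy0 : sqd z y ≤ ρ ^ 2 := by
          have := hcone 0 r y le_rfl hr0 hrf hy
          simpa using this.le
        have h0 := (ih _ ⟨hm0, le_rfl⟩ y hy1 a).2.2 b
        have hd : dist ((y, r) : SpT) (y, min (n * (τ / 2)) tf) < τ := by
          rw [dist_prod_same_left, Real.dist_eq, abs_of_nonneg (sub_nonneg.2 hr.1)]
          have h2 := hr.2
          push_cast at h2
          rcases le_total (n * (τ / 2)) tf with h3 | h3
          · rw [min_eq_left h3]
            have := h2.trans (min_le_left _ _)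
            linarith
          · rw [min_eq_right h3]; linarith
        have h1 := hτW (y, r) ⟨hy0, hr0, hrf⟩ (y, min (n * (τ / 2)) tf)
          ⟨hy0, hm0, min_le_right _ _⟩ hd
        have h2 := (dist_pi_lt_iff hδ).1 h1 (a, b)
        rw [Real.dist_eq] at h2
        simp only [h0, sub_zero] at h2
        rw [dS (hU a) (hV a) _ _ hmem]
        rw [dW (hU a) (hV a) _ _ hmem] at h2
        rw [abs_lt] at h2
        rw [abs_le]
        constructor <;> linarith [h2.1, h2.2]
      refine vanish_of_cone_energy hSc hWc hL hγ hpde hC hCT hc₀ hm0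
        (t₂ := min ((n + 1 : ℕ) * (τ / 2)) tf) ((min_le_right _ _).trans_lt htf.2) ?_ ?_
        (fun x hx => ih _ ⟨hm0, le_rfl⟩ x hx) t ⟨h, ht.2⟩ x hx
      · intro r hr y hy
        exact (hhyp r (hIcc r ⟨hm0.trans hr.1, hr.2.trans (min_le_right _ _)⟩) y hy _
          (hsmall r hr y hy)).1
      · intro r hr y hy
        exact (hhyp r (hIcc r ⟨hm0.trans hr.1, hr.2.trans (min_le_right _ _)⟩) y hy _
          (hsmall r hr y hy)).2
  obtain ⟨n, hn⟩ := exists_nat_ge (tf / (τ / 2))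
  intro x hx
  refine key n tf ⟨htf.1, le_min ?_ le_rfl⟩ x hx
  rwa [div_le_iff₀ (by positivity)] at hn

end Unique

theorem kron_self (i : Fin 3) : kron i i = 1 := if_pos rfl

theorem kron_zero_one : kron 0 1 = 0 := if_neg (by decide)

theorem kron_zero_two : kron 0 2 = 0 := if_neg (by decide)

theorem kron_one_zero : kron 1 0 = 0 := if_neg (by decide)

theorem kron_one_two : kron 1 2 = 0 := if_neg (by decide)

theorem kron_two_zero : kron 2 0 = 0 := if_neg (by decide)

theorem kron_two_one : kron 2 1 = 0 := if_neg (by decide)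

/-- The trilinear tensor behind `quadCoeff`. -/
def quadTensor (σ₀ σ₁ σ₂ σ₃ σ₄ : ℝ) (m n i j l k : Fin 3) : ℝ :=
  quadCoeff σ₀ σ₁ σ₂ σ₃ σ₄ (fun a b => kron a m * kron b n) i j l k

theorem quadCoeff_eq_sum (σ₀ σ₁ σ₂ σ₃ σ₄ : ℝ) (X : Fin 3 → Fin 3 → ℝ) (i j l k : Fin 3) :
    quadCoeff σ₀ σ₁ σ₂ σ₃ σ₄ X i j l k
      = ∑ m, ∑ n, quadTensor σ₀ σ₁ σ₂ σ₃ σ₄ m n i j l k * X m n := by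
  have hX : ∀ a b, X a b = ∑ m, ∑ n, kron a m * kron b n * X m n := fun a b => by
    simp [kron, Finset.sum_ite_eq]
  have hs : ∀ m n (i j l k : Fin 3), quadTensor σ₀ σ₁ σ₂ σ₃ σ₄ m n i j l k * X m n
      = quadCoeff σ₀ σ₁ σ₂ σ₃ σ₄ (fun a b => kron a m * kron b n * X m n) i j l k := by
    intro m n i j l k
    unfold quadTensor quadCoeff
    simp only [Fin.sum_univ_three]
    ring
  simp only [hs]
  conv_lhs => rw [show X = fun a b => ∑ m, ∑ n, kron a m * kron b n * X m n from
    funext fun a => funext fun b => hX a b]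
  unfold quadCoeff
  simp only [Fin.sum_univ_three]
  ring

theorem quadTensor_symm (σ₀ σ₁ σ₂ σ₃ σ₄ : ℝ) (m n i j l k : Fin 3) :
    quadTensor σ₀ σ₁ σ₂ σ₃ σ₄ m n i j l k = quadTensor σ₀ σ₁ σ₂ σ₃ σ₄ m n l k i j :=
  quadCoeff_symm _ _ _ _ _ _ _ _ _ _

theorem qf_linCoeff (c₁ c₂ : ℝ) (Y : Fin 3 → Fin 3 → ℝ) :
    qf (linCoeff c₁ c₂) Y Y
      = c₂ ^ 2 * ∑ i, ∑ j, Y i j * Y i j + (c₁ ^ 2 - c₂ ^ 2) * (∑ i, Y i i) ^ 2 := by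
  unfold qf linCoeff
  simp only [Fin.sum_univ_three, kron_self, kron_zero_one, kron_zero_two, kron_one_zero,
    kron_one_two, kron_two_zero, kron_two_one]
  ring

theorem qf_add (A B : Fin 3 → Fin 3 → Fin 3 → Fin 3 → ℝ) (Y Z : Fin 3 → Fin 3 → ℝ) :
    qf (fun i j l k => A i j l k + B i j l k) Y Z = qf A Y Z + qf B Y Z := by
  simp only [qf, add_mul, Finset.sum_add_distrib]

theorem exists_abs_qf_le (γ : Fin 3 → Fin 3 → Fin 3 → Fin 3 → Fin 3 → Fin 3 → ℝ) :
    ∃ Γ, 0 ≤ Γ ∧ ∀ X : Fin 3 → Fin 3 → ℝ, ∀ δ, (∀ a b, |X a b| ≤ δ) → ∀ Y : Fin 3 → Fin 3 → ℝ,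
      |qf (fun i j l k => ∑ m, ∑ n, γ m n i j l k * X m n) Y Y|
        ≤ Γ * δ * ∑ i, ∑ j, Y i j * Y i j := by
  obtain ⟨Γ, hΓ⟩ : ∃ Γ, ∀ m n i j l k, |γ m n i j l k| ≤ Γ := by
    obtain ⟨Γ, hΓ⟩ := (Set.finite_range fun q : Fin 3 × Fin 3 × Fin 3 × Fin 3 × Fin 3 × Fin 3 =>
      |γ q.1 q.2.1 q.2.2.1 q.2.2.2.1 q.2.2.2.2.1 q.2.2.2.2.2|).bddAbove
    exact ⟨Γ, fun m n i j l k => hΓ ⟨(m, n, i, j, l, k), rfl⟩⟩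
  have hΓ0 : 0 ≤ Γ := (abs_nonneg _).trans (hΓ 0 0 0 0 0 0)
  refine ⟨81 * (9 * Γ), by positivity, fun X δ hX Y => ?_⟩
  have hδ : 0 ≤ δ := (abs_nonneg _).trans (hX 0 0)
  set N := ∑ i, ∑ j, Y i j * Y i j with hN
  have hYN : ∀ i j, Y i j * Y i j ≤ N := fun i j =>
    (Finset.single_le_sum (f := fun j => Y i j * Y i j) (fun j _ => mul_self_nonneg _)
      (Finset.mem_univ j)).trans
    (Finset.single_le_sum (f := fun i => ∑ j, Y i j * Y i j)
      (fun i _ => Finset.sum_nonneg fun j _ => mul_self_nonneg _) (Finset.mem_univ i))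
  have hc : ∀ i j l k, |∑ m, ∑ n, γ m n i j l k * X m n| ≤ 3 * (3 * (Γ * δ)) := fun i j l k =>
    abs_sum_three_le fun m => abs_sum_three_le fun n => by
      rw [abs_mul]
      exact mul_le_mul (hΓ _ _ _ _ _ _) (hX _ _) (abs_nonneg _) hΓ0
  have h : |qf (fun i j l k => ∑ m, ∑ n, γ m n i j l k * X m n) Y Y|
      ≤ 3 * (3 * (3 * (3 * (3 * (3 * (Γ * δ)) * N)))) :=
    abs_sum_three_le fun i => abs_sum_three_le fun j => abs_sum_three_le fun l =>
      abs_sum_three_le fun k => by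
        rw [abs_mul]
        exact mul_le_mul (hc _ _ _ _) (abs_mul_le_of_sq_le (hYN i j) (hYN l k)) (abs_nonneg _)
          (by positivity)
  refine h.trans (le_of_eq ?_)
  ring

theorem axial_remainder_le {σ₀ σ₁ σ₂ τ lam y z a P Q : ℝ} (hlam : 0 ≤ lam) (hlam1 : lam ≤ 1)
    (hs : y ^ 2 + z ^ 2 ≤ lam ^ 2) (hsmall : (8 * |σ₂| + 10 * |τ|) * lam ≤ |σ₀|) :
    |2 * σ₁ * (P ^ 2 + Q ^ 2 + (Q * y - P * z) ^ 2)
      + σ₂ * (2 * ((a * y - P) ^ 2 + (a * z - Q) ^ 2) * (y ^ 2 + z ^ 2)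
        + 2 * (a * ((a * y - P) * y + (a * z - Q) * z)))
      + 2 * τ * ((a + (a * y - P) * y + (a * z - Q) * z) * ((a * y - P) * y + (a * z - Q) * z))|
    ≤ 2 * |σ₀| * (a + (a * y - P) * y + (a * z - Q) * z) ^ 2
      + (6 * |σ₂| + 8 * |τ| + 4 * |σ₁| + 2 * |σ₀|) * (P ^ 2 + Q ^ 2) := by
  set s := y ^ 2 + z ^ 2 with hsdef
  set w := P ^ 2 + Q ^ 2 with hw
  set e := P * y + Q * z with he
  have hs0 : 0 ≤ s := by positivity
  have hw0 : 0 ≤ w := by positivity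
  have hll : lam ^ 2 ≤ lam := by nlinarith
  have hsl : s ≤ lam := hs.trans hll
  have hew : e ^ 2 ≤ w * lam ^ 2 := by
    have : e ^ 2 ≤ w * s := by
      have := sq_nonneg (Q * y - P * z)
      simp only [he, hw, hsdef]; nlinarith
    nlinarith
  have hew1 : e ^ 2 ≤ w := by nlinarith
  have hg0 := sq_nonneg (Q * y - P * z)
  have hcross : (Q * y - P * z) ^ 2 ≤ w := by
    have : (Q * y - P * z) ^ 2 = w * s - e ^ 2 := by simp only [he, hw, hsdef]; ring
    nlinarith [sq_nonneg e]
  have hVm : (a * y - P) * y + (a * z - Q) * z = a * s - e := by simp only [he, hsdef]; ring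
  have hVV : (a * y - P) ^ 2 + (a * z - Q) ^ 2 = a ^ 2 * s - 2 * (a * e) + w := by
    simp only [he, hw, hsdef]; ring
  have hD : a + (a * y - P) * y + (a * z - Q) * z = a * (1 + s) - e := by
    simp only [he, hsdef]; ring
  have hVV0 : 0 ≤ a ^ 2 * s - 2 * (a * e) + w := by rw [← hVV]; positivity
  rw [hD, hVm, hVV]
  clear hD hVm hVV
  generalize (Q * y - P * z) ^ 2 = g at hg0 hcross ⊢
  clear_value s w e
  have hae : |a * e| ≤ (lam * a ^ 2 + w) / 2 := by
    rw [abs_le]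
    rcases hlam.eq_or_lt with h | h
    · have : e = 0 := by
        rw [← h] at hew
        nlinarith [sq_nonneg e]
      rw [this, ← h]
      constructor <;> simp <;> linarith
    · have h1 : 0 ≤ lam * (lam * a ^ 2 + w - 2 * (a * e)) := by
        nlinarith [sq_nonneg (lam * a - e)]
      have h2 : 0 ≤ lam * (lam * a ^ 2 + w + 2 * (a * e)) := by
        nlinarith [sq_nonneg (lam * a + e)]
      have h3 := nonneg_of_mul_nonneg_right h1 h
      have h4 := nonneg_of_mul_nonneg_right h2 h
      constructor <;> linarith
  have hae' := abs_le.1 hae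
  have ha0 := sq_nonneg a
  have hVm1 : |a * (a * s - e)| ≤ 2 * lam * a ^ 2 + w := by
    have h1 : 0 ≤ a ^ 2 * s := by positivity
    have h2 : a ^ 2 * s ≤ a ^ 2 * lam := mul_le_mul_of_nonneg_left hsl ha0
    rw [abs_le]
    constructor <;> nlinarith
  have hVV1 : |(a ^ 2 * s - 2 * (a * e) + w) * s| ≤ 2 * lam * a ^ 2 + 2 * w := by
    rw [abs_of_nonneg (mul_nonneg hVV0 hs0)]
    have h2 : a ^ 2 * s ≤ a ^ 2 * lam := mul_le_mul_of_nonneg_left hsl ha0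
    have : (a ^ 2 * s - 2 * (a * e) + w) * s ≤ (a ^ 2 * s - 2 * (a * e) + w) * 1 :=
      mul_le_mul_of_nonneg_left (by linarith) hVV0
    linarith
  have hDV : |(a * (1 + s) - e) * (a * s - e)| ≤ 5 * lam * a ^ 2 + 4 * w := by
    have h1 : (a * (1 + s) - e) * (a * s - e)
        = (1 + s) * (a * (a * s - e)) - (a * e) * s + e ^ 2 := by ring
    rw [h1]
    have h2 := abs_le.1 hVm1
    have h3 : |(1 + s) * (a * (a * s - e))| ≤ 2 * (2 * lam * a ^ 2 + w) := by
      rw [abs_mul, abs_of_nonneg (by linarith : 0 ≤ 1 + s)]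
      exact mul_le_mul (by linarith) hVm1 (abs_nonneg _) (by norm_num)
    have h4 : |(a * e) * s| ≤ (lam * a ^ 2 + w) / 2 := by
      rw [abs_mul, abs_of_nonneg hs0]
      nlinarith [abs_nonneg (a * e)]
    have h3' := abs_le.1 h3
    have h4' := abs_le.1 h4
    have h5 : 0 ≤ lam * a ^ 2 := by positivity
    rw [abs_le]
    constructor <;> linarith only [h3'.1, h3'.2, h4'.1, h4'.2, sq_nonneg e, hew1, h5, hw0]
  have hDD : a ^ 2 / 2 - w ≤ (a * (1 + s) - e) ^ 2 := by
    have h1 := sq_nonneg (a * (1 + s) - 2 * e)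
    have h2 : a ^ 2 ≤ (a * (1 + s)) ^ 2 := by
      rw [mul_pow]
      exact le_mul_of_one_le_right ha0 (by nlinarith)
    nlinarith
  have b1 : |2 * σ₁ * (w + g)| ≤ 4 * |σ₁| * w := by
    rw [abs_mul, abs_mul, abs_two, abs_of_nonneg (add_nonneg hw0 hg0)]
    nlinarith only [mul_le_mul_of_nonneg_left hcross (abs_nonneg σ₁)]
  have b2 : |σ₂ * (2 * (a ^ 2 * s - 2 * (a * e) + w) * s + 2 * (a * (a * s - e)))|
      ≤ |σ₂| * (8 * lam * a ^ 2 + 6 * w) := by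
    rw [abs_mul]
    refine mul_le_mul_of_nonneg_left ?_ (abs_nonneg _)
    have h1 := abs_le.1 hVm1
    have h2 := abs_le.1 hVV1
    rw [abs_le]
    constructor <;> linarith only [h1.1, h1.2, h2.1, h2.2]
  have b3 : |2 * τ * ((a * (1 + s) - e) * (a * s - e))| ≤ |τ| * (10 * lam * a ^ 2 + 8 * w) := by
    rw [abs_mul, abs_mul, abs_two]
    nlinarith only [mul_le_mul_of_nonneg_left hDV (abs_nonneg τ)]
  have hk := mul_le_mul_of_nonneg_right hsmall ha0
  have hk2 := mul_le_mul_of_nonneg_left hDD (mul_nonneg zero_le_two (abs_nonneg σ₀))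
  refine (abs_add_three _ _ _).trans ?_
  nlinarith only [b1, b2, b3, hk, hk2]

/-- Symbol of the quadratic coefficients at an axial strain. -/
theorem qf_quadCoeff_axial (σ₀ σ₁ σ₂ σ₃ σ₄ q : ℝ) (P d : Fin 3 → ℝ) :
    qf (quadCoeff σ₀ σ₁ σ₂ σ₃ σ₄ fun a b => q * (kron a 0 * kron b 0))
      (fun i j => P i * d j) (fun i j => P i * d j)
    = q * (2 * σ₀ * (P 0 * d 0 + P 1 * d 1 + P 2 * d 2) ^ 2
      + 2 * σ₁ * ((P 0 * d 1 - P 1 * d 0) ^ 2 + (P 0 * d 2 - P 2 * d 0) ^ 2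
        + (P 1 * d 2 - P 2 * d 1) ^ 2)
      + σ₂ * (2 * (P 1 ^ 2 + P 2 ^ 2) * (d 1 ^ 2 + d 2 ^ 2)
        + 2 * (P 0 * d 0 * (P 1 * d 1 + P 2 * d 2)))
      + 2 * (σ₃ - σ₄) * ((P 0 * d 0 + P 1 * d 1 + P 2 * d 2) * (P 1 * d 1 + P 2 * d 2))) := by
  unfold qf quadCoeff
  simp only [Fin.sum_univ_three, kron_self, kron_zero_one, kron_zero_two, kron_one_zero,
    kron_one_two, kron_two_zero, kron_two_one]
  ring

theorem axial_symbol_le {c₁ c₂ σ₀ σ₁ σ₂ σ₃ σ₄ lam q : ℝ} (hc : c₂ ^ 2 ≤ c₁ ^ 2) (hlam : 0 ≤ lam)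
    (hlam1 : lam ≤ 1) (hsmall : (8 * |σ₂| + 10 * |σ₃ - σ₄|) * lam ≤ |σ₀|) (hσq : σ₀ * q ≤ 0)
    (hq : |q| * (6 * |σ₂| + 8 * |σ₃ - σ₄| + 4 * |σ₁| + 2 * |σ₀|) ≤ c₁ ^ 2 - c₂ ^ 2)
    (P d : Fin 3 → ℝ) (hd : q = 0 ∨ d 1 ^ 2 + d 2 ^ 2 ≤ lam ^ 2 * d 0 ^ 2) :
    qf (fun i j l k => linCoeff c₁ c₂ i j l k
        + quadCoeff σ₀ σ₁ σ₂ σ₃ σ₄ (fun a b => q * (kron a 0 * kron b 0)) i j l k)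
      (fun i j => P i * d j) (fun i j => P i * d j)
    ≤ c₁ ^ 2 * (∑ i, P i * P i) * ∑ j, d j ^ 2 := by
  rw [qf_add, qf_linCoeff, qf_quadCoeff_axial]
  simp only [Fin.sum_univ_three]
  set g := (P 0 * d 1 - P 1 * d 0) ^ 2 + (P 0 * d 2 - P 2 * d 0) ^ 2
    + (P 1 * d 2 - P 2 * d 1) ^ 2 with hg
  have hg0 : 0 ≤ g := by positivity
  suffices h : q * (2 * σ₀ * (P 0 * d 0 + P 1 * d 1 + P 2 * d 2) ^ 2 + 2 * σ₁ * g
      + σ₂ * (2 * (P 1 ^ 2 + P 2 ^ 2) * (d 1 ^ 2 + d 2 ^ 2)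
        + 2 * (P 0 * d 0 * (P 1 * d 1 + P 2 * d 2)))
      + 2 * (σ₃ - σ₄) * ((P 0 * d 0 + P 1 * d 1 + P 2 * d 2) * (P 1 * d 1 + P 2 * d 2)))
      ≤ (c₁ ^ 2 - c₂ ^ 2) * g by
    refine (add_le_add_right h _).trans (le_of_eq ?_)
    simp only [hg]
    ring
  by_cases hq0 : q = 0
  · rw [hq0, zero_mul]
    exact mul_nonneg (by linarith) hg0
  have hd' := hd.resolve_left hq0
  by_cases hd0 : d 0 = 0
  · have h1 : d 1 = 0 := by rw [hd0] at hd'; nlinarith [sq_nonneg (d 1), sq_nonneg (d 2)]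
    have h2 : d 2 = 0 := by rw [hd0] at hd'; nlinarith [sq_nonneg (d 1), sq_nonneg (d 2)]
    simp [hg, hd0, h1, h2]
  obtain ⟨y, hy⟩ : ∃ y, d 1 = y * d 0 := ⟨d 1 / d 0, (div_mul_cancel₀ _ hd0).symm⟩
  obtain ⟨z, hz⟩ : ∃ z, d 2 = z * d 0 := ⟨d 2 / d 0, (div_mul_cancel₀ _ hd0).symm⟩
  have hd2 : 0 < d 0 ^ 2 := by positivity
  have hyz : y ^ 2 + z ^ 2 ≤ lam ^ 2 := by
    refine le_of_mul_le_mul_right ?_ hd2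
    rw [hy, hz] at hd'
    linarith
  have h := axial_remainder_le (σ₀ := σ₀) (σ₁ := σ₁) (σ₂ := σ₂) (τ := σ₃ - σ₄) (a := P 0)
    (P := P 0 * y - P 1) (Q := P 0 * z - P 2) hlam hlam1 hyz hsmall
  simp only [sub_sub_cancel] at h
  set K := 6 * |σ₂| + 8 * |σ₃ - σ₄| + 4 * |σ₁| + 2 * |σ₀|
  set w := (P 0 * y - P 1) ^ 2 + (P 0 * z - P 2) ^ 2
  have hw0 : 0 ≤ w := by positivity
  have hgw : g = d 0 ^ 2 * (w + ((P 0 * z - P 2) * y - (P 0 * y - P 1) * z) ^ 2) := by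
    simp only [hg, w, hy, hz]; ring
  have hgw1 : d 0 ^ 2 * w ≤ g := by
    rw [hgw]
    exact mul_le_mul_of_nonneg_left (le_add_of_nonneg_right (sq_nonneg _)) hd2.le
  set D := P 0 + P 1 * y + P 2 * z
  set R := 2 * σ₁ * (w + ((P 0 * z - P 2) * y - (P 0 * y - P 1) * z) ^ 2)
      + σ₂ * (2 * (P 1 ^ 2 + P 2 ^ 2) * (y ^ 2 + z ^ 2)
        + 2 * (P 0 * (P 1 * y + P 2 * z)))
      + 2 * (σ₃ - σ₄) * (D * (P 1 * y + P 2 * z)) with hR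
  have hre : q * (2 * σ₀ * (P 0 * d 0 + P 1 * d 1 + P 2 * d 2) ^ 2 + 2 * σ₁ * g
      + σ₂ * (2 * (P 1 ^ 2 + P 2 ^ 2) * (d 1 ^ 2 + d 2 ^ 2)
        + 2 * (P 0 * d 0 * (P 1 * d 1 + P 2 * d 2)))
      + 2 * (σ₃ - σ₄) * ((P 0 * d 0 + P 1 * d 1 + P 2 * d 2) * (P 1 * d 1 + P 2 * d 2)))
      = d 0 ^ 2 * (2 * (σ₀ * q) * D ^ 2 + q * R) := by
    rw [hgw, hR, hy, hz]
    simp only [D]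
    ring
  rw [hre]
  have hqR : q * R ≤ |q| * (2 * |σ₀| * D ^ 2 + K * w) := by
    refine (le_abs_self _).trans ?_
    rw [abs_mul]
    exact mul_le_mul_of_nonneg_left h (abs_nonneg _)
  have hσ : σ₀ * q = -(|q| * |σ₀|) := by
    rw [← abs_mul, mul_comm q, abs_of_nonpos hσq, neg_neg]
  have hin : 2 * (σ₀ * q) * D ^ 2 + q * R ≤ |q| * K * w := by
    rw [hσ]
    nlinarith only [hqR]
  calc d 0 ^ 2 * (2 * (σ₀ * q) * D ^ 2 + q * R) ≤ d 0 ^ 2 * (|q| * K * w) :=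
        mul_le_mul_of_nonneg_left hin hd2.le
    _ = |q| * K * (d 0 ^ 2 * w) := by ring
    _ ≤ (c₁ ^ 2 - c₂ ^ 2) * g :=
        mul_le_mul hq hgw1 (by positivity) (by linarith)

/-- Near a small axial strain `q` with `σ₀ q ≤ 0` the elastic system is hyperbolic, with symbol
bounded by the speed `C > c₁` in almost axial directions. -/
theorem exists_axial_hyperbolic {c₁ c₂ σ₀ : ℝ} (σ₁ σ₂ σ₃ σ₄ : ℝ) (hc : c₂ < c₁) (hc2 : 0 < c₂)
    (hσ0 : σ₀ ≠ 0) :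
    ∃ q₀ > 0, ∃ lam > 0, ∀ C, c₁ < C → ∃ δ > 0, ∀ q, |q| ≤ q₀ → σ₀ * q ≤ 0 →
      ∀ X : Fin 3 → Fin 3 → ℝ, (∀ a b, |X a b - q * (kron a 0 * kron b 0)| ≤ δ) →
      (∀ Z : Fin 3 → Fin 3 → ℝ, c₂ ^ 2 / 2 * ∑ i, ∑ j, Z i j * Z i j
        ≤ qf (fun i j l k => linCoeff c₁ c₂ i j l k
          + ∑ m, ∑ n, quadTensor σ₀ σ₁ σ₂ σ₃ σ₄ m n i j l k * X m n) Z Z) ∧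
      ∀ d : Fin 3 → ℝ, q = 0 ∨ d 1 ^ 2 + d 2 ^ 2 ≤ lam ^ 2 * d 0 ^ 2 → ∀ P : Fin 3 → ℝ,
        qf (fun i j l k => linCoeff c₁ c₂ i j l k
          + ∑ m, ∑ n, quadTensor σ₀ σ₁ σ₂ σ₃ σ₄ m n i j l k * X m n)
          (fun i j => P i * d j) (fun i j => P i * d j)
          ≤ C ^ 2 * (∑ i, P i * P i) * ∑ j, d j ^ 2 := by
  obtain ⟨Γ, hΓ0, hΓ⟩ := exists_abs_qf_le (quadTensor σ₀ σ₁ σ₂ σ₃ σ₄)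
  set K := 6 * |σ₂| + 8 * |σ₃ - σ₄| + 4 * |σ₁| + 2 * |σ₀| with hK
  set K' := 8 * |σ₂| + 10 * |σ₃ - σ₄| with hK'
  have hK0 : 0 ≤ K := by positivity
  have hK'0 : 0 ≤ K' := by positivity
  have hσ : 0 < |σ₀| := abs_pos.2 hσ0
  have hcc : 0 < c₁ ^ 2 - c₂ ^ 2 := by nlinarith
  refine ⟨min ((c₁ ^ 2 - c₂ ^ 2) / (K + 1)) (c₂ ^ 2 / (4 * (Γ + 1))), by positivity,
    min 1 (|σ₀| / (K' + 1)), by positivity, fun C hC => ?_⟩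
  have hCc : 0 < C ^ 2 - c₁ ^ 2 := by nlinarith
  refine ⟨min ((C ^ 2 - c₁ ^ 2) / (Γ + 1)) (c₂ ^ 2 / (4 * (Γ + 1))), by positivity, ?_⟩
  intro q hq hσq X hX
  set δ := min ((C ^ 2 - c₁ ^ 2) / (Γ + 1)) (c₂ ^ 2 / (4 * (Γ + 1))) with hδ
  have hδ0 : 0 < δ := by positivity
  have hq1 : |q| * K ≤ c₁ ^ 2 - c₂ ^ 2 := by
    have h := hq.trans (min_le_left _ _)
    rw [le_div_iff₀ (by positivity)] at h
    nlinarith [abs_nonneg q]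
  have hq2 : Γ * |q| ≤ c₂ ^ 2 / 4 := by
    have h := hq.trans (min_le_right _ _)
    rw [le_div_iff₀ (by positivity)] at h
    nlinarith [abs_nonneg q]
  have hδ1 : Γ * δ ≤ C ^ 2 - c₁ ^ 2 := by
    have h : δ ≤ (C ^ 2 - c₁ ^ 2) / (Γ + 1) := min_le_left _ _
    rw [le_div_iff₀ (by positivity)] at h
    nlinarith
  have hδ2 : Γ * δ ≤ c₂ ^ 2 / 4 := by
    have h : δ ≤ c₂ ^ 2 / (4 * (Γ + 1)) := min_le_right _ _
    rw [le_div_iff₀ (by positivity)] at h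
    nlinarith
  have hl1 : min 1 (|σ₀| / (K' + 1)) ≤ 1 := min_le_left _ _
  have hl0 : 0 < min 1 (|σ₀| / (K' + 1)) := by positivity
  have hl2 : K' * min 1 (|σ₀| / (K' + 1)) ≤ |σ₀| := by
    have h : min 1 (|σ₀| / (K' + 1)) ≤ |σ₀| / (K' + 1) := min_le_right _ _
    rw [le_div_iff₀ (by positivity)] at h
    nlinarith
  have hsplit : ∀ Y : Fin 3 → Fin 3 → ℝ, qf (fun i j l k => linCoeff c₁ c₂ i j l k
        + ∑ m, ∑ n, quadTensor σ₀ σ₁ σ₂ σ₃ σ₄ m n i j l k * X m n) Y Y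
      = qf (linCoeff c₁ c₂) Y Y
        + qf (fun i j l k => ∑ m, ∑ n, quadTensor σ₀ σ₁ σ₂ σ₃ σ₄ m n i j l k
          * (q * (kron m 0 * kron n 0))) Y Y
        + qf (fun i j l k => ∑ m, ∑ n, quadTensor σ₀ σ₁ σ₂ σ₃ σ₄ m n i j l k
          * (X m n - q * (kron m 0 * kron n 0))) Y Y := by
    intro Y
    rw [← qf_add, ← qf_add]
    congr 1
    funext i j l k
    rw [add_assoc]
    congr 1
    simp only [← Finset.sum_add_distrib]
    refine Finset.sum_congr rfl fun m _ => Finset.sum_congr rfl fun n _ => ?_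
    ring
  have hkron : ∀ a b, |q * (kron a 0 * kron b 0)| ≤ |q| := fun a b => by
    unfold kron
    split_ifs <;> simp
  constructor
  · intro Z
    rw [hsplit, qf_linCoeff]
    have h1 := (abs_le.1 (hΓ _ _ hkron Z)).1
    have h2 := (abs_le.1 (hΓ _ _ hX Z)).1
    set N := ∑ i, ∑ j, Z i j * Z i j
    have hN : 0 ≤ N := Finset.sum_nonneg fun i _ => Finset.sum_nonneg fun j _ => mul_self_nonneg _
    have h3 := mul_le_mul_of_nonneg_right hq2 hN
    have h4 := mul_le_mul_of_nonneg_right hδ2 hN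
    have h5 := mul_nonneg hcc.le (sq_nonneg (∑ i, Z i i))
    linarith
  · intro d hd P
    rw [hsplit, ← qf_add]
    simp only [← quadCoeff_eq_sum]
    have h1 := axial_symbol_le (c₁ := c₁) (c₂ := c₂) (σ₀ := σ₀) (σ₁ := σ₁) (σ₂ := σ₂) (σ₃ := σ₃)
      (σ₄ := σ₄) (by linarith) hl0.le hl1 hl2 hσq hq1 P d hd
    have h2 := (abs_le.1 (hΓ _ _ hX fun i j => P i * d j)).2
    simp only [← quadCoeff_eq_sum] at h2
    have h3 : ∑ i, ∑ j, P i * d j * (P i * d j) = (∑ i, P i * P i) * ∑ j, d j ^ 2 := by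
      rw [Finset.sum_mul_sum]
      refine Finset.sum_congr rfl fun i _ => Finset.sum_congr rfl fun j _ => ?_
      ring
    rw [h3] at h2
    have hN : 0 ≤ (∑ i, P i * P i) * ∑ j, d j ^ 2 :=
      mul_nonneg (Finset.sum_nonneg fun i _ => mul_self_nonneg _)
        (Finset.sum_nonneg fun j _ => sq_nonneg _)
    have h4 := mul_le_mul_of_nonneg_right hδ1 hN
    linarith

theorem pd_congr {f g : (Fin 3 → ℝ) → ℝ} {x : Fin 3 → ℝ} (h : f =ᶠ[nhds x] g) (i : Fin 3) :
    pd f i x = pd g i x := by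
  unfold pd
  rw [h.fderiv_eq]

theorem isOpen_sqd_lt (z : Fin 3 → ℝ) (r : ℝ) : IsOpen {x | sqd z x < r} :=
  isOpen_lt (by unfold sqd; fun_prop) continuous_const

theorem sum_linCoeff_mul (c₁ c₂ : ℝ) (i : Fin 3) (H : Fin 3 → Fin 3 → Fin 3 → ℝ) :
    ∑ j, ∑ l, ∑ k, linCoeff c₁ c₂ i j l k * H l j k
      = c₂ ^ 2 * ∑ j, H i j j + (c₁ ^ 2 - c₂ ^ 2) * ∑ l, H l i l := by
  simp only [linCoeff, add_mul, Finset.sum_add_distrib, Finset.mul_sum, kron]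
  congr 1
  · refine Finset.sum_congr rfl fun j _ => ?_
    simp
  · rw [Finset.sum_comm]
    refine Finset.sum_congr rfl fun l _ => ?_
    simp

section Elastic

variable {T : ℝ} {U V : Fin 3 → SpT → ℝ}

theorem elasticEq_iff {c₁ c₂ σ₀ σ₁ σ₂ σ₃ σ₄ : ℝ}
    (hU : ∀ i, ContDiffOn ℝ (⊤ : ℕ∞) (U i) (slab T)) {x : Fin 3 → ℝ} {t : ℝ}
    (ht : t ∈ Set.Ioo 0 T) :
    ElasticEq c₁ c₂ σ₀ σ₁ σ₂ σ₃ σ₄ (fun i y s => U i (y, s)) x t ↔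
      ∀ i, Dw (slab T) et (Dw (slab T) et (U i)) (x, t)
        = ∑ j, ∑ l, ∑ k, Acoef (slab T) (linCoeff c₁ c₂) (quadTensor σ₀ σ₁ σ₂ σ₃ σ₄) U i j l k (x, t)
          * Dw (slab T) (ex k) (Dw (slab T) (ex j) (U l)) (x, t) := by
  have hu := uniqueDiffOn_slab T
  have hne : ((⊤ : ℕ∞) : WithTop ℕ∞) ≠ 0 := by simp
  have ht' := Set.Ioo_subset_Ico_self ht
  have hd : ∀ {F : SpT → ℝ}, ContDiffOn ℝ (⊤ : ℕ∞) F (slab T) → ∀ y, ∀ s ∈ Set.Ico 0 T,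
      DifferentiableWithinAt ℝ F (slab T) (y, s) := fun hF y s hs =>
    hF.differentiableOn hne _ ⟨trivial, hs⟩
  have htt : ∀ i, deriv (fun s => deriv (fun s' => U i (x, s')) s) t
      = Dw (slab T) et (Dw (slab T) et (U i)) (x, t) := fun i => by
    have h : (fun s => deriv (fun s' => U i (x, s')) s)
        =ᶠ[nhds t] fun s => Dw (slab T) et (U i) (x, s) := by
      filter_upwards [Ioo_mem_nhds ht.1 ht.2] with s hs
      exact (hasDerivAt_slice (hd (hU i) x s (Set.Ioo_subset_Ico_self hs)) hs).deriv
    rw [h.deriv_eq]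
    exact (hasDerivAt_slice (hd (contDiffOn_Dw hu (hU i) et) x t ht') ht).deriv
  have hx1 : ∀ i j, (fun y => pd (fun y' => U i (y', t)) j y)
      = fun y => Dw (slab T) (ex j) (U i) (y, t) := fun i j =>
    funext fun y => pd_slice (hd (hU i) y t ht') ht' j
  have hx2 : ∀ i j k, pd (fun y => pd (fun y' => U i (y', t)) j y) k x
      = Dw (slab T) (ex k) (Dw (slab T) (ex j) (U i)) (x, t) := fun i j k => by
    rw [hx1]
    exact pd_slice (hd (contDiffOn_Dw hu (hU i) _) x t ht') ht' k
  have hc2 : ∀ i, ContDiff ℝ 2 fun y => U i (y, t) := fun i =>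
    contDiff_slice ((hU i).of_le (by norm_cast)) ht'
  have hdiv : ∀ i, pd (fun y => divg (fun j y' => U j (y', t)) y) i x
      = ∑ l, pd (fun y => pd (fun y' => U l (y', t)) i y) l x := fun i => by
    unfold divg
    rw [pd_sum i fun l => (differentiable_pd (hc2 l) l) x]
    exact Finset.sum_congr rfl fun l _ => pd_pd_comm (hc2 l) _ _ _
  have hlin := fun i => sum_linCoeff_mul c₁ c₂ i
    fun l j k => Dw (slab T) (ex k) (Dw (slab T) (ex j) (U l)) (x, t)
  unfold ElasticEq
  refine forall_congr' fun i => ?_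
  rw [htt, hdiv, Ncomp_eq _ _ _ _ _ _ hc2]
  have hA : ∀ j l k, Acoef (slab T) (linCoeff c₁ c₂) (quadTensor σ₀ σ₁ σ₂ σ₃ σ₄) U i j l k (x, t)
      = linCoeff c₁ c₂ i j l k
        + quadCoeff σ₀ σ₁ σ₂ σ₃ σ₄ (fun a b => pd (fun y => U a (y, t)) b x) i j l k := by
    intro j l k
    rw [quadCoeff_eq_sum]
    unfold Acoef
    congr 1
    refine Finset.sum_congr rfl fun m _ => Finset.sum_congr rfl fun n _ => ?_
    rw [pd_slice (hd (hU m) x t ht') ht' n]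
  simp only [hx2, hA, add_mul, Finset.sum_add_distrib, hlin]
  constructor <;> intro h <;> linarith

/-- Uniqueness on the characteristic cone for the elastic system near an axial solution `V`. -/
theorem eq_on_cone_of_axial {c₁ c₂ σ₀ : ℝ} (σ₁ σ₂ σ₃ σ₄ : ℝ) (hc : c₂ < c₁) (hc2 : 0 < c₂)
    (hσ0 : σ₀ ≠ 0) :
    ∃ q₀ > 0, ∃ lam > 0, ∀ (T : ℝ) (U V : Fin 3 → SpT → ℝ) (q : SpT → ℝ) (z : Fin 3 → ℝ) (ρ : ℝ),
      (∀ i, ContDiffOn ℝ (⊤ : ℕ∞) (U i) (slab T)) → (∀ i, ContDiffOn ℝ (⊤ : ℕ∞) (V i) (slab T)) →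
      (∀ x, ∀ t ∈ Set.Ioo 0 T, ElasticEq c₁ c₂ σ₀ σ₁ σ₂ σ₃ σ₄ (fun i y s => U i (y, s)) x t) →
      (∀ x, ∀ t ∈ Set.Ioo 0 T, ElasticEq c₁ c₂ σ₀ σ₁ σ₂ σ₃ σ₄ (fun i y s => V i (y, s)) x t) →
      (∀ x, sqd z x < ρ ^ 2 → ∀ i, U i (x, 0) = V i (x, 0) ∧
        Dw (slab T) et (U i) (x, 0) = Dw (slab T) et (V i) (x, 0)) →
      c₁ * T < ρ →
      (∀ t ∈ Set.Ico 0 T, ∀ x, sqd z x < (ρ - c₁ * t) ^ 2 →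
        (∀ a b, Dw (slab T) (ex b) (V a) (x, t) = q (x, t) * (kron a 0 * kron b 0)) ∧
        |q (x, t)| ≤ q₀ ∧ σ₀ * q (x, t) ≤ 0 ∧ (q (x, t) = 0 ∨
          (x 1 - z 1) ^ 2 + (x 2 - z 2) ^ 2 ≤ lam ^ 2 * (x 0 - z 0) ^ 2)) →
      ∀ t ∈ Set.Ico 0 T, ∀ x, sqd z x < (ρ - c₁ * t) ^ 2 → ∀ i, U i (x, t) = V i (x, t) := by
  obtain ⟨q₀, hq₀, lam, hlam, H⟩ := exists_axial_hyperbolic σ₁ σ₂ σ₃ σ₄ hc hc2 hσ0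
  refine ⟨q₀, hq₀, lam, hlam, ?_⟩
  intro T U V q z ρ hU hV hUeq hVeq hdata hρ hax t ht x hx i
  have hc1 : 0 < c₁ := hc2.trans hc
  have hT : 0 < T := ht.1.trans_lt ht.2
  have hne : ((⊤ : ℕ∞) : WithTop ℕ∞) ≠ 0 := by simp
  have hu := uniqueDiffOn_slab T
  obtain ⟨C, hCc, hCT, hxC⟩ : ∃ C, c₁ < C ∧ C * T ≤ ρ ∧ sqd z x < (ρ - C * t) ^ 2 := by
    have h1 : ∀ᶠ C in nhdsWithin c₁ (Set.Ioi c₁), C * T < ρ :=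
      ((continuous_mul_const T).tendsto c₁).mono_left nhdsWithin_le_nhds |>.eventually_lt_const hρ
    have h2 : ∀ᶠ C in nhdsWithin c₁ (Set.Ioi c₁), sqd z x < (ρ - C * t) ^ 2 := by
      have hcont : Continuous fun C : ℝ => (ρ - C * t) ^ 2 := by fun_prop
      exact (hcont.tendsto c₁).mono_left nhdsWithin_le_nhds |>.eventually_const_lt hx
    obtain ⟨C, h⟩ := (h1.and (h2.and self_mem_nhdsWithin)).exists
    exact ⟨C, h.2.2, h.1.le, h.2.1⟩
  obtain ⟨δ, hδ, H⟩ := H C hCc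
  have hsub : ∀ r ∈ Set.Ico 0 T, ∀ y, sqd z y < (ρ - C * r) ^ 2 → sqd z y < (ρ - c₁ * r) ^ 2 := by
    intro r hr y hy
    refine hy.trans_le (pow_le_pow_left₀ ?_ ?_ 2)
    · nlinarith [hr.2]
    · nlinarith [hr.1]
  have hvan := vanish_sub_of_cone hU hV (linCoeff_symm c₁ c₂) (quadTensor_symm σ₀ σ₁ σ₂ σ₃ σ₄)
    (fun y r hr => (elasticEq_iff hU hr).1 (hUeq y r hr))
    (fun y r hr => (elasticEq_iff hV hr).1 (hVeq y r hr))
    (z := z) (ρ := ρ) (C := C) (c₀ := c₂ ^ 2 / 2) (hc1.trans hCc) hCT (by positivity) hδ ?_ ?_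
    t ht x hxC i
  · exact sub_eq_zero.1 hvan.1
  · intro r hr y hy X hX
    obtain ⟨a1, a2, a3, a4⟩ := hax r hr y (hsub r hr y hy)
    have h := H (q (y, r)) a2 a3 X fun a b => by rw [← a1]; exact hX a b
    refine ⟨h.1, fun P => ?_⟩
    refine (h.2 (fun j => y j - z j) a4 P).trans ?_
    have hN : 0 ≤ ∑ i, P i * P i := Finset.sum_nonneg fun i _ => mul_self_nonneg _
    have hy' : ∑ j, (y j - z j) ^ 2 ≤ (ρ - C * r) ^ 2 := hy.le
    calc C ^ 2 * (∑ i, P i * P i) * ∑ j, (y j - z j) ^ 2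
        ≤ C ^ 2 * (∑ i, P i * P i) * (ρ - C * r) ^ 2 :=
          mul_le_mul_of_nonneg_left hy' (by positivity)
      _ = (C * (ρ - C * r)) ^ 2 * ∑ i, P i * P i := by ring
  · intro y hy i
    have hmem : ((y, 0) : SpT) ∈ slab T := ⟨trivial, le_rfl, hT⟩
    have hW : ContDiffOn ℝ (⊤ : ℕ∞) (fun p => U i p - V i p) (slab T) := (hU i).sub (hV i)
    refine ⟨sub_eq_zero.2 (hdata y hy i).1, ?_, fun j => ?_⟩
    · rw [Dw_sub (hu _ hmem) ((hU i).differentiableOn hne _ hmem)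
        ((hV i).differentiableOn hne _ hmem), (hdata y hy i).2, sub_self]
    · rw [← pd_slice (hW.differentiableOn hne _ hmem) hmem.2 j]
      have h0 : (fun y' => U i (y', 0) - V i (y', 0)) =ᶠ[nhds y] fun _ => 0 := by
        filter_upwards [(isOpen_sqd_lt z (ρ ^ 2)).mem_nhds hy] with y' hy'
        exact sub_eq_zero.2 (hdata y' hy' i).1
      rw [pd_congr h0]
      simp [pd]

end Elastic

section Characteristics

variable {c : ℝ → ℝ} {a T : ℝ}

theorem hasDerivAt_characteristic (hc : Differentiable ℝ c) (t ξ : ℝ) :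
    HasDerivAt (fun ξ => ξ + c ξ * t) (1 + deriv c ξ * t) ξ :=
  (hasDerivAt_id ξ).add ((hc ξ).hasDerivAt.mul_const t)

theorem strictMono_characteristic (hc : Differentiable ℝ c) {t : ℝ}
    (hpos : ∀ ξ, 0 < 1 + deriv c ξ * t) : StrictMono fun ξ => ξ + c ξ * t :=
  strictMono_of_deriv_pos fun ξ => by
    rw [(hasDerivAt_characteristic hc t ξ).deriv]
    exact hpos ξ

/-- The inverse of the characteristic flow `(ξ, t) ↦ (ξ + c ξ * t, t)`. -/
theorem exists_characteristic_inverse (hc : ContDiff ℝ (⊤ : ℕ∞) c) {B : ℝ} (hB : ∀ ξ, |c ξ| ≤ B)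
    (hpos : ∀ t ∈ Set.Ioo a T, ∀ ξ, 0 < 1 + deriv c ξ * t) :
    ∃ Ξ : ℝ × ℝ → ℝ, (∀ x, ∀ t ∈ Set.Ioo a T, Ξ (x, t) + c (Ξ (x, t)) * t = x) ∧
      (∀ ξ, ∀ t ∈ Set.Ioo a T, Ξ (ξ + c ξ * t, t) = ξ) ∧
      ∀ p : ℝ × ℝ, p.2 ∈ Set.Ioo a T → ContDiffAt ℝ (⊤ : ℕ∞) Ξ p := by
  have hcd : Differentiable ℝ c := hc.differentiable (by simp)
  have hmono : ∀ t ∈ Set.Ioo a T, StrictMono fun ξ => ξ + c ξ * t := fun t ht =>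
    strictMono_characteristic hcd (hpos t ht)
  have hsurj : ∀ x t, ∃ ξ, ξ + c ξ * t = x := by
    intro x t
    have hcont : Continuous fun ξ => ξ + c ξ * t := by fun_prop
    have hb : ∀ ξ, |c ξ * t| ≤ B * |t| := fun ξ => by
      rw [abs_mul]
      exact mul_le_mul_of_nonneg_right (hB ξ) (abs_nonneg t)
    have h1 := (abs_le.1 (hb (x - B * |t|))).2
    have h2 := (abs_le.1 (hb (x + B * |t|))).1
    have h3 : (x - B * |t|) ≤ x + B * |t| := by
      have := (abs_nonneg _).trans (hb 0)
      linarith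
    obtain ⟨ξ, -, hξ⟩ := intermediate_value_Icc h3 hcont.continuousOn
      (show x ∈ Set.Icc _ _ from ⟨by linarith, by linarith⟩)
    exact ⟨ξ, hξ⟩
  choose Ξ hΞ using hsurj
  have huniq : ∀ ξ x t, t ∈ Set.Ioo a T → ξ + c ξ * t = x → Ξ x t = ξ := fun ξ x t ht h =>
    (hmono t ht).injective ((hΞ x t).trans h.symm)
  refine ⟨fun p => Ξ p.1 p.2, fun x t _ => hΞ x t, fun ξ t ht => huniq ξ _ t ht rfl, ?_⟩
  rintro ⟨x, t⟩ ht
  set ξ := Ξ x t with hξ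
  set F : ℝ × ℝ → ℝ × ℝ := fun p => (p.1 + c p.1 * p.2, p.2) with hF
  have hFc : ContDiff ℝ (⊤ : ℕ∞) F := by
    simp only [hF]
    fun_prop
  set m := 1 + deriv c ξ * t with hm
  have hm0 : m ≠ 0 := (hpos t ht ξ).ne'
  let f' : (ℝ × ℝ) ≃L[ℝ] (ℝ × ℝ) := ContinuousLinearEquiv.equivOfInverse
    ((m • ContinuousLinearMap.fst ℝ ℝ ℝ + c ξ • ContinuousLinearMap.snd ℝ ℝ ℝ).prod
      (ContinuousLinearMap.snd ℝ ℝ ℝ))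
    ((m⁻¹ • (ContinuousLinearMap.fst ℝ ℝ ℝ - c ξ • ContinuousLinearMap.snd ℝ ℝ ℝ)).prod
      (ContinuousLinearMap.snd ℝ ℝ ℝ))
    (fun v => by ext <;> simp [hm0])
    (fun v => by ext <;> simp [hm0])
  have hF' : HasFDerivAt F (f' : (ℝ × ℝ) →L[ℝ] (ℝ × ℝ)) (ξ, t) := by
    have h1 : HasFDerivAt (fun p : ℝ × ℝ => p.1) (ContinuousLinearMap.fst ℝ ℝ ℝ) (ξ, t) :=
      hasFDerivAt_fst
    have h2 : HasFDerivAt (fun p : ℝ × ℝ => p.2) (ContinuousLinearMap.snd ℝ ℝ ℝ) (ξ, t) :=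
      hasFDerivAt_snd
    have h3 := (hcd ξ).hasDerivAt.comp_hasFDerivAt (ξ, t) h1
    refine ((h1.add (h3.mul h2)).prodMk h2).congr_fderiv ?_
    ext
    all_goals simp [f', hm]
    ring
  have hne : ((⊤ : ℕ∞) : WithTop ℕ∞) ≠ 0 := by simp
  have hFx : F (ξ, t) = (x, t) := by simp only [hF, hξ, hΞ]
  have hinv := hFc.contDiffAt.to_localInverse hF' hne
  rw [hFx] at hinv
  have hright : ∀ᶠ y in nhds (x, t), F (hFc.contDiffAt.localInverse hF' hne y) = y := by
    have := (hFc.contDiffAt.hasStrictFDerivAt' hF' hne).eventually_right_inverse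
    rw [hFx] at this
    exact this
  have hI : ∀ᶠ y : ℝ × ℝ in nhds (x, t), y.2 ∈ Set.Ioo a T :=
    continuous_snd.continuousAt.eventually (Ioo_mem_nhds ht.1 ht.2)
  refine (contDiff_fst.contDiffAt.comp (x, t) hinv).congr_of_eventuallyEq ?_
  filter_upwards [hright, hI] with y hy hyI
  have h1 := congrArg Prod.fst hy
  have h2 := congrArg Prod.snd hy
  simp only [hF] at h1 h2
  rw [h2] at h1
  exact huniq _ _ _ hyI h1

theorem hasFDerivAt_characteristic_inverse (hc : Differentiable ℝ c) {Ξ : ℝ × ℝ → ℝ}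
    (hΞ : ∀ x, ∀ t ∈ Set.Ioo a T, Ξ (x, t) + c (Ξ (x, t)) * t = x) {p : ℝ × ℝ}
    (hp : p.2 ∈ Set.Ioo a T) (hd : DifferentiableAt ℝ Ξ p)
    (hpos : 0 < 1 + deriv c (Ξ p) * p.2) :
    HasFDerivAt Ξ ((1 + deriv c (Ξ p) * p.2)⁻¹ •
      (ContinuousLinearMap.fst ℝ ℝ ℝ - c (Ξ p) • ContinuousLinearMap.snd ℝ ℝ ℝ)) p := by
  have h1 := hd.hasFDerivAt
  have h3 := (hc (Ξ p)).hasDerivAt.comp_hasFDerivAt p h1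
  have h4 := h1.add (h3.mul (hasFDerivAt_snd (𝕜 := ℝ) (p := p)))
  have h5 : (fun y : ℝ × ℝ => Ξ y + c (Ξ y) * y.2) =ᶠ[nhds p] fun y => y.1 := by
    filter_upwards [continuous_snd.continuousAt.eventually (Ioo_mem_nhds hp.1 hp.2)] with y hy
    exact hΞ y.1 y.2 hy
  have h6 := (h4.congr_of_eventuallyEq h5.symm).unique (hasFDerivAt_fst (𝕜 := ℝ) (p := p))
  refine h1.congr_fderiv ?_
  have h7 : ∀ v, fderiv ℝ Ξ p v * (1 + deriv c (Ξ p) * p.2) = v.1 - c (Ξ p) * v.2 := fun v => by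
    have := congrArg (fun L : ℝ × ℝ →L[ℝ] ℝ => L v) h6
    simp at this
    linarith
  refine ContinuousLinearMap.ext fun v => ?_
  have h8 := h7 v
  simp only [smul_apply, sub_apply,
    ContinuousLinearMap.coe_fst', ContinuousLinearMap.coe_snd', smul_eq_mul]
  rw [← h8]
  field_simp

end Characteristics

theorem Dw_axial {T : ℝ} {F : ℝ × ℝ → ℝ} {L : ℝ × ℝ →L[ℝ] ℝ} {p : SpT} (hp : p ∈ slab T)
    (hF : HasFDerivAt F L (p.1 0, p.2)) (v : SpT) :
    Dw (slab T) v (fun y => F (y.1 0, y.2)) p = L (v.1 0, v.2) := by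
  have h1 : HasFDerivAt (fun y : SpT => (y.1 0, y.2))
      (((ContinuousLinearMap.proj (R := ℝ) (φ := fun _ : Fin 3 => ℝ) 0).comp
        (ContinuousLinearMap.fst ℝ (Fin 3 → ℝ) ℝ)).prod
        (ContinuousLinearMap.snd ℝ (Fin 3 → ℝ) ℝ)) p :=
    ((hasFDerivAt_apply (𝕜 := ℝ) 0 p.1).comp p hasFDerivAt_fst).prodMk hasFDerivAt_snd
  have h2 := (hF.comp p h1).hasFDerivWithinAt (s := slab T)
  have h3 := h2.fderivWithin (uniqueDiffOn_slab T p hp)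
  unfold Dw
  simp only [Function.comp_def] at h3
  rw [h3]
  simp

/-- The axial simple wave with speed profile `c`, which solves the elastic system for as long as
the characteristics do not cross. -/
theorem exists_axial_wave {c₁ σ₀ : ℝ} (c₂ σ₁ σ₂ σ₃ σ₄ : ℝ) (hσ0 : σ₀ ≠ 0) {c u₀ : ℝ → ℝ} {a T : ℝ}
    (hc : ContDiff ℝ (⊤ : ℕ∞) c) {B : ℝ} (hB : ∀ ξ, |c ξ| ≤ B) (ha : a < 0)
    (hpos : ∀ t ∈ Set.Ioo a T, ∀ ξ, 0 < 1 + deriv c ξ * t)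
    (hu₀ : ContDiff ℝ (⊤ : ℕ∞) u₀)
    (hu₀' : ∀ ξ, HasDerivAt u₀ ((c ξ ^ 2 - c₁ ^ 2) / (2 * σ₀)) ξ) (hT : 0 < T) :
    ∃ (Ξ : ℝ × ℝ → ℝ) (V : Fin 3 → SpT → ℝ),
      (∀ x, ∀ t ∈ Set.Ico 0 T, Ξ (x, t) + c (Ξ (x, t)) * t = x) ∧
      (∀ i, ContDiffOn ℝ (⊤ : ℕ∞) (V i) (slab T)) ∧
      (∀ x, ∀ t ∈ Set.Ioo 0 T, ElasticEq c₁ c₂ σ₀ σ₁ σ₂ σ₃ σ₄ (fun i y s => V i (y, s)) x t) ∧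
      (∀ p ∈ slab T, ∀ i j, Dw (slab T) (ex j) (V i) p
        = (c (Ξ (p.1 0, p.2)) ^ 2 - c₁ ^ 2) / (2 * σ₀) * (kron i 0 * kron j 0)) ∧
      (∀ x i, V i (x, 0) = kron i 0 * u₀ (x 0)) ∧
      (∀ x i, Dw (slab T) et (V i) (x, 0) = kron i 0 * ((c₁ ^ 3 - c (x 0) ^ 3) / (3 * σ₀))) ∧
      ∀ ξ, ∀ t ∈ Set.Ico 0 T, ∀ x : Fin 3 → ℝ, x 0 = ξ + c ξ * t →
        Dw (slab T) (ex 0) (Dw (slab T) (ex 0) (V 0)) (x, t)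
          = c ξ * deriv c ξ / σ₀ / (1 + deriv c ξ * t) := by
  obtain ⟨Ξ, hΞ1, hΞ2, hΞ3⟩ := exists_characteristic_inverse hc hB hpos
  have hne : ((⊤ : ℕ∞) : WithTop ℕ∞) ≠ 0 := by simp
  have hcd : Differentiable ℝ c := hc.differentiable hne
  have hu := uniqueDiffOn_slab T
  have hsub : Set.Ico 0 T ⊆ Set.Ioo a T := fun t ht => ⟨ha.trans_le ht.1, ht.2⟩
  have hΞ0 : ∀ x, Ξ (x, 0) = x := fun x => by simpa using hΞ1 x 0 (hsub ⟨le_rfl, hT⟩)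
  set q : ℝ → ℝ := fun ξ => (c ξ ^ 2 - c₁ ^ 2) / (2 * σ₀) with hq
  set H : ℝ → ℝ := fun ξ => (c ξ ^ 3 - c₁ ^ 3) / (3 * σ₀) with hH
  have hq' : ∀ ξ, HasDerivAt q (c ξ * deriv c ξ / σ₀) ξ := fun ξ => by
    have h := (((hcd ξ).hasDerivAt.pow 2).sub_const (c₁ ^ 2)).div_const (2 * σ₀)
    refine h.congr_deriv ?_
    field_simp
    ring
  have hH' : ∀ ξ, HasDerivAt H (c ξ * (c ξ * deriv c ξ / σ₀)) ξ := fun ξ => by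
    have h := (((hcd ξ).hasDerivAt.pow 3).sub_const (c₁ ^ 3)).div_const (3 * σ₀)
    refine h.congr_deriv ?_
    field_simp
    ring
  set u : ℝ × ℝ → ℝ := fun p => u₀ (Ξ p) + p.2 * (c (Ξ p) * q (Ξ p) - H (Ξ p)) with hu'
  have hΞd : ∀ p : ℝ × ℝ, p.2 ∈ Set.Ico 0 T → HasFDerivAt Ξ ((1 + deriv c (Ξ p) * p.2)⁻¹ •
      (ContinuousLinearMap.fst ℝ ℝ ℝ - c (Ξ p) • ContinuousLinearMap.snd ℝ ℝ ℝ)) p := fun p hp =>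
    hasFDerivAt_characteristic_inverse hcd hΞ1 (hsub hp)
      ((hΞ3 p (hsub hp)).differentiableAt hne) (hpos _ (hsub hp) _)
  have hud : ∀ p : ℝ × ℝ, p.2 ∈ Set.Ico 0 T → HasFDerivAt u
      (q (Ξ p) • ContinuousLinearMap.fst ℝ ℝ ℝ - H (Ξ p) • ContinuousLinearMap.snd ℝ ℝ ℝ) p := by
    intro p hp
    have h1 := (hu₀' (Ξ p)).comp_hasFDerivAt p (hΞd p hp)
    have h2 := (((hcd (Ξ p)).hasDerivAt.mul (hq' (Ξ p))).sub (hH' (Ξ p))).comp_hasFDerivAt p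
      (hΞd p hp)
    have h3 := h1.add ((hasFDerivAt_snd (𝕜 := ℝ) (p := p)).mul h2)
    refine h3.congr_fderiv ?_
    have hm := (hpos _ (hsub hp) (Ξ p)).ne'
    refine ContinuousLinearMap.ext fun v => ?_
    simp [hq]
    field_simp
    ring
  have hLd : ∀ (Q : ℝ → ℝ) (Q' : ℝ), ∀ p : ℝ × ℝ, p.2 ∈ Set.Ico 0 T → HasDerivAt Q Q' (Ξ p) →
      HasFDerivAt (fun p => Q (Ξ p)) (Q' • (1 + deriv c (Ξ p) * p.2)⁻¹ •
      (ContinuousLinearMap.fst ℝ ℝ ℝ - c (Ξ p) • ContinuousLinearMap.snd ℝ ℝ ℝ)) p :=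
    fun Q Q' p hp hQ => hQ.comp_hasFDerivAt p (hΞd p hp)
  have hqc : ContDiff ℝ (⊤ : ℕ∞) q := ((hc.pow 2).sub contDiff_const).div_const _
  have hHc : ContDiff ℝ (⊤ : ℕ∞) H := ((hc.pow 3).sub contDiff_const).div_const _
  have huc : ∀ p : ℝ × ℝ, p.2 ∈ Set.Ico 0 T → ContDiffAt ℝ (⊤ : ℕ∞) u p := by
    intro p hp
    have h := hΞ3 p (hsub hp)
    exact (hu₀.contDiffAt.comp p h).add (contDiffAt_snd.mul
      (((hc.contDiffAt.comp p h).mul (hqc.contDiffAt.comp p h)).sub (hHc.contDiffAt.comp p h)))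
  set V : Fin 3 → SpT → ℝ := fun i p => kron i 0 * u (p.1 0, p.2) with hV
  have haxc : ContDiff ℝ (⊤ : ℕ∞) fun p : SpT => ((p.1 0, p.2) : ℝ × ℝ) := by fun_prop
  have hVc : ∀ i, ContDiffOn ℝ (⊤ : ℕ∞) (V i) (slab T) := fun i p hp =>
    (contDiffAt_const.mul ((huc (p.1 0, p.2) hp.2).comp p haxc.contDiffAt)).contDiffWithinAt
  have hVD : ∀ p ∈ slab T, ∀ i v, Dw (slab T) v (V i) p
      = kron i 0 * (q (Ξ (p.1 0, p.2)) * v.1 0 - H (Ξ (p.1 0, p.2)) * v.2) := by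
    intro p hp i v
    have h := Dw_axial hp ((hud (p.1 0, p.2) hp.2).const_mul (kron i 0)) v
    simpa using h
  have hVex : ∀ p ∈ slab T, ∀ i j, Dw (slab T) (ex j) (V i) p
      = q (Ξ (p.1 0, p.2)) * (kron i 0 * kron j 0) := by
    intro p hp i j
    rw [hVD p hp]
    simp [ex, kron, Pi.single_apply, eq_comm]
  have hVet : ∀ p ∈ slab T, ∀ i, Dw (slab T) et (V i) p
      = kron i 0 * -H (Ξ (p.1 0, p.2)) := by
    intro p hp i
    rw [hVD p hp]
    simp [et]
  have hVxx : ∀ p ∈ slab T, ∀ i j k, Dw (slab T) (ex k) (Dw (slab T) (ex j) (V i)) p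
      = kron i 0 * kron j 0 * kron k 0 * (c (Ξ (p.1 0, p.2)) * deriv c (Ξ (p.1 0, p.2)) / σ₀
        * (1 + deriv c (Ξ (p.1 0, p.2)) * p.2)⁻¹) := by
    intro p hp i j k
    rw [Dw_congr (fun y hy => hVex y hy i j) hp]
    have h := Dw_axial hp ((hLd q _ (p.1 0, p.2) hp.2 (hq' _)).mul_const (kron i 0 * kron j 0))
      (ex k)
    have hex : (ex k).1 0 = kron k 0 := by simp [ex, kron, Pi.single_apply, eq_comm]
    rw [h, hex]
    simp [ex]
    ring
  have hVtt : ∀ p ∈ slab T, ∀ i, Dw (slab T) et (Dw (slab T) et (V i)) p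
      = kron i 0 * (c (Ξ (p.1 0, p.2)) ^ 2 * (c (Ξ (p.1 0, p.2)) * deriv c (Ξ (p.1 0, p.2)) / σ₀
        * (1 + deriv c (Ξ (p.1 0, p.2)) * p.2)⁻¹)) := by
    intro p hp i
    rw [Dw_congr (fun y hy => hVet y hy i) hp]
    have h := Dw_axial hp ((hLd H _ (p.1 0, p.2) hp.2 (hH' _)).neg.const_mul (kron i 0)) et
    refine h.trans ?_
    simp [et, -mul_eq_mul_left_iff]
    ring
  refine ⟨Ξ, V, fun x t ht => hΞ1 x t (hsub ht), hVc, ?_, hVex, ?_, ?_, ?_⟩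
  · intro x t ht
    have hp : ((x, t) : SpT) ∈ slab T := ⟨trivial, Set.Ioo_subset_Ico_self ht⟩
    refine (elasticEq_iff hVc ht).2 fun i => ?_
    have hA : ∀ j l k, Acoef (slab T) (linCoeff c₁ c₂) (quadTensor σ₀ σ₁ σ₂ σ₃ σ₄) V i j l k (x, t)
        = linCoeff c₁ c₂ i j l k + quadCoeff σ₀ σ₁ σ₂ σ₃ σ₄
          (fun a b => q (Ξ (x 0, t)) * (kron a 0 * kron b 0)) i j l k := by
      intro j l k
      rw [quadCoeff_eq_sum]
      unfold Acoef
      congr 1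
      refine Finset.sum_congr rfl fun m _ => Finset.sum_congr rfl fun n _ => ?_
      rw [hVex _ hp]
    rw [hVtt _ hp]
    simp only [hVxx _ hp, hA, Fin.sum_univ_three, kron_self, kron_one_zero, kron_two_zero, mul_zero,
      zero_mul, add_zero, mul_one, one_mul]
    fin_cases i <;>
      simp only [Fin.zero_eta, Fin.mk_one, Fin.reduceFinMk, linCoeff, quadCoeff, Fin.sum_univ_three,
        kron_self, kron_one_zero, kron_two_zero, hq]
    · field_simp
      ring
    · ring
    · ring
  · intro x i
    simp [hV, hu', hΞ0]
  · intro x i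
    rw [hVet _ ⟨trivial, le_rfl, hT⟩]
    simp only [hΞ0, hH]
    ring
  · intro ξ t ht x hx
    rw [hVxx _ ⟨trivial, ht⟩]
    simp only [hx, hΞ2 ξ t (hsub ht), kron_self]
    ring

/-- The characteristic speed of the simple wave with amplitude profile `g`. -/
def waveSpeed (c₁ : ℝ) (g : ℝ → ℝ) (ξ : ℝ) : ℝ := √(c₁ ^ 2 - 2 * g ξ)

section WaveSpeed

variable {c₁ ε ℓ : ℝ} {g : ℝ → ℝ}

theorem waveSpeed_sq (hgb : ∀ y, |g y| ≤ c₁ ^ 2 / 4) (ξ : ℝ) :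
    waveSpeed c₁ g ξ ^ 2 = c₁ ^ 2 - 2 * g ξ :=
  Real.sq_sqrt (by nlinarith [(abs_le.1 (hgb ξ)).2])

theorem waveSpeed_pos (hc : 0 < c₁) (hgb : ∀ y, |g y| ≤ c₁ ^ 2 / 4) (ξ : ℝ) :
    0 < waveSpeed c₁ g ξ :=
  Real.sqrt_pos.2 (by nlinarith [(abs_le.1 (hgb ξ)).2])

theorem contDiff_waveSpeed (hc : 0 < c₁) (hg : ContDiff ℝ (⊤ : ℕ∞) g)
    (hgb : ∀ y, |g y| ≤ c₁ ^ 2 / 4) : ContDiff ℝ (⊤ : ℕ∞) (waveSpeed c₁ g) :=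
  (contDiff_const.sub (contDiff_const.mul hg)).sqrt fun ξ => by
    nlinarith [(abs_le.1 (hgb ξ)).2]

theorem waveSpeed_le_two_mul (hc : 0 < c₁) (hgb : ∀ y, |g y| ≤ c₁ ^ 2 / 4) (ξ : ℝ) :
    |waveSpeed c₁ g ξ| ≤ 2 * c₁ := by
  rw [abs_of_pos (waveSpeed_pos hc hgb ξ)]
  refine Real.sqrt_le_iff.2 ⟨by positivity, ?_⟩
  nlinarith [(abs_le.1 (hgb ξ)).1]

theorem waveSpeed_le (hc : 0 < c₁) {ξ : ℝ} (hξ : 0 ≤ g ξ) : waveSpeed c₁ g ξ ≤ c₁ :=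
  Real.sqrt_le_iff.2 ⟨hc.le, by linarith⟩

theorem deriv_waveSpeed (hc : 0 < c₁) (hg : Differentiable ℝ g)
    (hgb : ∀ y, |g y| ≤ c₁ ^ 2 / 4) (ξ : ℝ) :
    deriv (waveSpeed c₁ g) ξ = -(deriv g ξ / waveSpeed c₁ g ξ) := by
  have h := (((hg ξ).hasDerivAt.const_mul 2).const_sub (c₁ ^ 2)).sqrt
    (by nlinarith [(abs_le.1 (hgb ξ)).2])
  refine h.deriv.trans ?_
  have := (waveSpeed_pos hc hgb ξ).ne'
  unfold waveSpeed at this ⊢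
  field_simp

/-- For an odd profile the characteristics first cross on the positive side. -/
theorem exists_first_crossing (hc : 0 < c₁) (hε : 0 < ε) (hg : ContDiff ℝ (⊤ : ℕ∞) g)
    (hodd : ∀ y, g (-y) = -g y) (hnn : ∀ y, 0 ≤ y → 0 ≤ g y) (hsupp : ∀ y, ℓ < y → g y = 0)
    (hgb : ∀ y, |g y| ≤ c₁ ^ 2 / 4) (hg0 : deriv g 0 = 2 * c₁ / ε) :
    ∃ a < 0, ∃ T, 0 < T ∧ T ≤ ε / 2 ∧
      (∀ t ∈ Set.Ioo a T, ∀ ξ, 0 < 1 + deriv (waveSpeed c₁ g) ξ * t) ∧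
      ∃ y, 0 ≤ y ∧ y ≤ ℓ ∧ 1 + deriv (waveSpeed c₁ g) y * T = 0 := by
  have hgd : Differentiable ℝ g := hg.differentiable (by simp)
  set c := waveSpeed c₁ g with hcdef
  have hcc : ContDiff ℝ (⊤ : ℕ∞) c := contDiff_waveSpeed hc hg hgb
  have hcp := waveSpeed_pos hc hgb
  have hder := deriv_waveSpeed hc hgd hgb
  have heven : ∀ y, deriv g (-y) = deriv g y := fun y => by
    have h := deriv_comp_neg g y
    have h2 : (fun x => g (-x)) = fun x => -g x := funext hodd
    rw [h2, deriv.fun_neg] at h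
    linarith
  have hd0 : ∀ y, ℓ < y → deriv g y = 0 := fun y hy => by
    have h : g =ᶠ[nhds y] fun _ => 0 := by
      filter_upwards [Ioi_mem_nhds hy] with x hx using hsupp x hx
    rw [h.deriv_eq, deriv_const]
  set z : ℝ → ℝ := fun y => -deriv c y with hz
  have hzg : ∀ y, z y = deriv g y / c y := fun y => by
    simp only [hz]
    rw [hder]
    ring
  have hzc : Continuous z := (hcc.continuous_deriv (by norm_cast)).neg
  have hzs : ∀ y, ℓ < |y| → z y = 0 := fun y hy => by
    rw [hzg]
    rcases abs_cases y with h | h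
    · rw [hd0 y (h.1 ▸ hy), zero_div]
    · rw [← heven, hd0 (-y) (h.1 ▸ hy), zero_div]
  have hzcs : HasCompactSupport z := by
    refine HasCompactSupport.intro (isCompact_Icc (a := -ℓ) (b := ℓ)) fun y hy => hzs y ?_
    by_contra! h
    exact hy (abs_le.1 h)
  obtain ⟨y₀, hy₀⟩ := hzc.exists_forall_ge_of_hasCompactSupport hzcs
  obtain ⟨y₁, hy₁⟩ := hzc.exists_forall_le_of_hasCompactSupport hzcs
  have hg00 : g 0 = 0 := by
    have := hodd 0
    rw [neg_zero] at this
    linarith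
  have hz0 : z 0 = 2 / ε := by
    rw [hzg, hg0, hcdef, waveSpeed, hg00, mul_zero, sub_zero, Real.sqrt_sq hc.le]
    field_simp
  obtain ⟨y, hy, hymax⟩ : ∃ y, 0 ≤ y ∧ ∀ x, z x ≤ z y := by
    rcases le_or_gt 0 y₀ with h | h
    · exact ⟨y₀, h, hy₀⟩
    · refine ⟨-y₀, by linarith, fun x => (hy₀ x).trans ?_⟩
      have hpos : 0 < z y₀ := (by rw [hz0]; positivity : 0 < z 0).trans_le (hy₀ 0)
      rw [hzg] at hpos
      have hgpos : 0 < deriv g y₀ := by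
        have := mul_pos hpos (hcp y₀)
        rwa [div_mul_cancel₀ _ (hcp y₀).ne'] at this
      rw [hzg, hzg, heven]
      refine div_le_div_of_nonneg_left hgpos.le (hcp _) (Real.sqrt_le_sqrt ?_)
      have h1 := hnn (-y₀) (by linarith)
      have h2 := hodd y₀
      linarith
  have hK : 2 / ε ≤ z y := hz0 ▸ hymax 0
  have hKpos : 0 < z y := (by positivity : 0 < 2 / ε).trans_le hK
  have hm : z y₁ ≤ z y := hy₁ y
  set M := max (z y) (-z y₁) + 1 with hM
  have hM1 : z y < M := by
    have := le_max_left (z y) (-z y₁)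
    linarith
  have hM2 : -z y₁ < M := by
    have := le_max_right (z y) (-z y₁)
    linarith
  have hMpos : 0 < M := hKpos.trans hM1
  refine ⟨-(1 / M), by simpa using hMpos, 1 / z y, by positivity, ?_, ?_, y, hy, ?_, ?_⟩
  · rw [div_le_div_iff₀ hKpos two_pos]
    rw [div_le_iff₀ hε] at hK
    linarith
  · rintro t ⟨ht1, ht2⟩ ξ
    have hξ : deriv c ξ = -z ξ := by simp [hz]
    rw [hξ]
    rcases le_or_gt 0 t with h | h
    · have h1 : z ξ * t ≤ z y * t := mul_le_mul_of_nonneg_right (hymax ξ) h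
      rw [lt_div_iff₀ hKpos] at ht2
      linarith
    · have h1 : -z ξ * -t ≤ M * -t :=
        mul_le_mul_of_nonneg_right (by linarith [hy₁ ξ]) (by linarith)
      have h2 : -t < 1 / M := by linarith
      rw [lt_div_iff₀ hMpos] at h2
      linarith
  · by_contra! h
    have := hzs y (by rwa [abs_of_nonneg hy])
    linarith
  · have hξ : deriv c y = -z y := by simp [hz]
    rw [hξ]
    field_simp
    ring

end WaveSpeed

theorem pd_pd_slice {T : ℝ} {F : SpT → ℝ} (hF : ContDiffOn ℝ (⊤ : ℕ∞) F (slab T))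
    {x : Fin 3 → ℝ} {t : ℝ} (ht : t ∈ Set.Ico 0 T) (j k : Fin 3) :
    pd (fun y => pd (fun y' => F (y', t)) j y) k x
      = Dw (slab T) (ex k) (Dw (slab T) (ex j) F) (x, t) := by
  have hne : ((⊤ : ℕ∞) : WithTop ℕ∞) ≠ 0 := by simp
  have h : (fun y => pd (fun y' => F (y', t)) j y) = fun y => Dw (slab T) (ex j) F (y, t) :=
    funext fun y => pd_slice (hF.differentiableOn hne (y, t) ⟨trivial, ht⟩) ht j
  rw [h]
  exact pd_slice ((contDiffOn_Dw (uniqueDiffOn_slab T) hF _).differentiableOn hne (x, t)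
    ⟨trivial, ht⟩) ht k

theorem Dw_et_initial {T : ℝ} (hT : 0 < T) {F : SpT → ℝ} (hF : ContDiffOn ℝ (⊤ : ℕ∞) F (slab T))
    (x : Fin 3 → ℝ) :
    Dw (slab T) et F (x, 0) = derivWithin (fun s => F (x, s)) (Set.Ici 0) 0 := by
  have h0 : ((x, 0) : SpT) ∈ slab T := ⟨trivial, le_rfl, hT⟩
  have h := hasDerivWithinAt_slice (hF.differentiableOn (by simp) _ h0)
  exact ((h.mono_of_mem_nhdsWithin (Ico_mem_nhdsGE hT)).derivWithin
    (uniqueDiffOn_Ici 0 0 Set.self_mem_Ici)).symm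

theorem slope_le_of_near_boundary {lam A μ d : ℝ} (hA : 0 < A) (hμ : μ ≤ A / 2)
    (hμl : μ ≤ lam ^ 2 * A / 8) (hd : (μ - A) ^ 2 + d < A ^ 2) : d ≤ lam ^ 2 * (μ - A) ^ 2 := by
  have h1 : lam ^ 2 * (A / 2) ^ 2 ≤ lam ^ 2 * (μ - A) ^ 2 :=
    mul_le_mul_of_nonneg_left (by nlinarith) (sq_nonneg lam)
  have h2 : 2 * A * μ ≤ 2 * A * (lam ^ 2 * A / 8) :=
    mul_le_mul_of_nonneg_left hμl (by linarith)
  nlinarith [sq_nonneg μ]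

set_option maxHeartbeats 1000000 in
/-- Data that coincide with a simple wave on a ball of radius `c₁ * ε` do not admit a smooth
solution on `[0, ε)`. -/
theorem not_exists_solution_of_profile {c₁ c₂ σ₀ : ℝ} (σ₁ σ₂ σ₃ σ₄ : ℝ) (hc : c₂ < c₁)
    (hc2 : 0 < c₂) (hσ0 : σ₀ ≠ 0) :
    ∃ g₀ > 0, g₀ ≤ c₁ ^ 2 / 4 ∧ ∀ ε > 0, ∃ ℓ > 0, ∀ g u₀ : ℝ → ℝ, ContDiff ℝ (⊤ : ℕ∞) g →
      (∀ y, g (-y) = -g y) → (∀ y, 0 ≤ y → 0 ≤ g y) → (∀ y, ℓ < y → g y = 0) →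
      (∀ y, |g y| ≤ g₀) → deriv g 0 = 2 * c₁ / ε → (∀ y, HasDerivAt u₀ (-g y / σ₀) y) →
      ∀ U₀ U₁ : (Fin 3 → ℝ) → Fin 3 → ℝ,
      (∀ x, sqd (Pi.single 0 (c₁ * ε)) x < (c₁ * ε) ^ 2 → ∀ i, U₀ x i = kron i 0 * u₀ (x 0)) →
      (∀ x, sqd (Pi.single 0 (c₁ * ε)) x < (c₁ * ε) ^ 2 → ∀ i,
        U₁ x i = kron i 0 * ((c₁ ^ 3 - waveSpeed c₁ g (x 0) ^ 3) / (3 * σ₀))) →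
      ∀ T, ε ≤ T → ¬ ∃ U : Fin 3 → (Fin 3 → ℝ) → ℝ → ℝ,
        ContDiffOn ℝ (⊤ : ℕ∞) (fun p : (Fin 3 → ℝ) × ℝ => fun i : Fin 3 => U i p.1 p.2)
          (Set.univ ×ˢ Set.Ico 0 T) ∧
        (∀ x : Fin 3 → ℝ, ∀ t ∈ Set.Ioo (0 : ℝ) T, ElasticEq c₁ c₂ σ₀ σ₁ σ₂ σ₃ σ₄ U x t) ∧
        (∀ (x : Fin 3 → ℝ) (i : Fin 3), U i x 0 = U₀ x i) ∧
        (∀ (x : Fin 3 → ℝ) (i : Fin 3),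
          derivWithin (fun s => U i x s) (Set.Ici 0) 0 = U₁ x i) := by
  have hc1 : 0 < c₁ := hc2.trans hc
  obtain ⟨q₀, hq₀, lam, hlam, Huniq⟩ := eq_on_cone_of_axial σ₁ σ₂ σ₃ σ₄ hc hc2 hσ0
  have hσabs : 0 < |σ₀| := abs_pos.2 hσ0
  refine ⟨min (c₁ ^ 2 / 4) (|σ₀| * q₀), by positivity, min_le_left _ _, fun ε hε =>
    ⟨min (c₁ * ε / 4) (lam ^ 2 * (c₁ * ε) / 16), by positivity, ?_⟩⟩
  set ℓ := min (c₁ * ε / 4) (lam ^ 2 * (c₁ * ε) / 16) with hℓ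
  have hℓ1 : ℓ ≤ c₁ * ε / 4 := min_le_left _ _
  have hℓ2 : ℓ ≤ lam ^ 2 * (c₁ * ε) / 16 := min_le_right _ _
  intro g u₀ hg hodd hnn hsupp hgb' hg0 hu₀' U₀ U₁ hU₀ hU₁ T hT
  rintro ⟨U, hUc, hUeq, hUi, hUt⟩
  have hgb : ∀ y, |g y| ≤ c₁ ^ 2 / 4 := fun y => (hgb' y).trans (min_le_left _ _)
  have hgq : ∀ y, |g y| ≤ |σ₀| * q₀ := fun y => (hgb' y).trans (min_le_right _ _)
  have hne : ((⊤ : ℕ∞) : WithTop ℕ∞) ≠ 0 := by simp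
  obtain ⟨a, ha, Ts, hTs, hTsε, hpos, ys, hys0, hysℓ, hys⟩ :=
    exists_first_crossing hc1 hε hg hodd hnn hsupp hgb hg0
  set c := waveSpeed c₁ g with hcdef
  have hcc : ContDiff ℝ (⊤ : ℕ∞) c := contDiff_waveSpeed hc1 hg hgb
  have hcd : Differentiable ℝ c := hcc.differentiable hne
  have hcsq := waveSpeed_sq hgb
  have hcp := waveSpeed_pos hc1 hgb
  have hc0 : c 0 = c₁ := by
    have := hodd 0
    rw [neg_zero] at this
    have h0 : g 0 = 0 := by linarith
    rw [hcdef, waveSpeed, h0, mul_zero, sub_zero, Real.sqrt_sq hc1.le]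
  have hqg : ∀ y, (c y ^ 2 - c₁ ^ 2) / (2 * σ₀) = -g y / σ₀ := fun y => by
    rw [hcdef, hcsq]
    field_simp
    ring
  have hu₀ : ContDiff ℝ (⊤ : ℕ∞) u₀ := by
    refine contDiff_infty_iff_deriv.2 ⟨fun y => (hu₀' y).differentiableAt, ?_⟩
    have : deriv u₀ = fun y => -g y / σ₀ := funext fun y => (hu₀' y).deriv
    rw [this]
    exact hg.neg.div_const _
  obtain ⟨Ξ, V, hΞ, hVc, hVeq, hVex, hV0, hVt, hVxx⟩ := exists_axial_wave c₂ σ₁ σ₂ σ₃ σ₄ hσ0 hcc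
    (waveSpeed_le_two_mul hc1 hgb) ha hpos hu₀ (fun y => (hqg y).symm ▸ hu₀' y) hTs
  have hmono : ∀ t ∈ Set.Ico 0 Ts, StrictMono fun ξ => ξ + c ξ * t := fun t ht =>
    strictMono_characteristic hcd (hpos t ⟨ha.trans_le ht.1, ht.2⟩)
  set W : Fin 3 → SpT → ℝ := fun i p => U i p.1 p.2 with hW
  have hWT : ∀ i, ContDiffOn ℝ (⊤ : ℕ∞) (W i) (slab T) := contDiffOn_pi.1 hUc
  have hTsT : Ts < T := by linarith
  have hslab : slab Ts ⊆ slab T := Set.prod_mono_right (Set.Ico_subset_Ico_right hTsT.le)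
  have hWTs : ∀ i, ContDiffOn ℝ (⊤ : ℕ∞) (W i) (slab Ts) := fun i => (hWT i).mono hslab
  set z : Fin 3 → ℝ := Pi.single 0 (c₁ * ε) with hz
  have hz0 : z 0 = c₁ * ε := by simp [hz]
  have hz1 : z 1 = 0 := by simp [hz]
  have hz2 : z 2 = 0 := by simp [hz]
  have hc1Ts : c₁ * Ts ≤ c₁ * ε / 2 := by nlinarith
  have hsqd : ∀ x, sqd z x = (x 0 - c₁ * ε) ^ 2 + x 1 ^ 2 + x 2 ^ 2 := fun x => by
    simp [sqd, Fin.sum_univ_three, hz0, hz1, hz2]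
  have heq : ∀ t ∈ Set.Ico 0 Ts, ∀ x, sqd z x < (c₁ * ε - c₁ * t) ^ 2 →
      ∀ i, W i (x, t) = V i (x, t) := by
    refine Huniq Ts W V (fun p => (c (Ξ (p.1 0, p.2)) ^ 2 - c₁ ^ 2) / (2 * σ₀)) z (c₁ * ε)
      hWTs hVc (fun x t ht => hUeq x t ⟨ht.1, ht.2.trans hTsT⟩) hVeq ?_ (by nlinarith) ?_
    · intro x hx i
      refine ⟨?_, ?_⟩
      · rw [hV0]
        exact (hUi x i).trans (hU₀ x hx i)
      · rw [hVt, Dw_et_initial hTs (hWTs i)]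
        exact (hUt x i).trans (hU₁ x hx i)
    · intro t ht x hx
      have hx' := hx
      rw [hsqd] at hx'
      have htT : c₁ * t ≤ c₁ * ε / 2 := (mul_le_mul_of_nonneg_left ht.2.le hc1.le).trans hc1Ts
      have hA : 0 < c₁ * ε - c₁ * t := by nlinarith
      have habs := abs_lt_of_sq_lt_sq (by nlinarith [sq_nonneg (x 1), sq_nonneg (x 2)] :
        (x 0 - c₁ * ε) ^ 2 < (c₁ * ε - c₁ * t) ^ 2) hA.le
      have hx0 := hΞ (x 0) t ht
      have hξ : 0 < Ξ (x 0, t) := by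
        refine (hmono t ht).lt_iff_lt.1 ?_
        simp only [hx0, hc0]
        linarith [(abs_lt.1 habs).1]
      refine ⟨hVex (x, t) ⟨trivial, ht⟩, ?_, ?_, ?_⟩
      · simp only [hqg]
        rw [abs_div, abs_neg, div_le_iff₀ hσabs, mul_comm]
        exact hgq _
      · simp only [hqg]
        rw [mul_div_cancel₀ _ hσ0]
        linarith [hnn _ hξ.le]
      · refine or_iff_not_imp_left.2 fun h => ?_
        simp only [hqg] at h
        have hξℓ : Ξ (x 0, t) ≤ ℓ := by
          by_contra! h'
          exact h (by rw [hsupp _ h', neg_zero, zero_div])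
        have hcle := waveSpeed_le hc1 (hnn _ hξ.le)
        have hμ1 : x 0 - c₁ * t ≤ ℓ := by
          have := mul_le_mul_of_nonneg_right hcle ht.1
          linarith
        have hμ0 := (abs_lt.1 habs).1
        rw [hz0, hz1, hz2, sub_zero, sub_zero]
        set A := c₁ * ε - c₁ * t with hAdef
        set μ := x 0 - c₁ * t with hμdef
        have hxA : x 0 - c₁ * ε = μ - A := by ring
        rw [hxA] at hx' ⊢
        have hAε : c₁ * ε ≤ 2 * A := by linarith
        have hμA : μ ≤ A / 2 := by linarith
        have hμl : μ ≤ lam ^ 2 * A / 8 := by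
          have := mul_le_mul_of_nonneg_left hAε (sq_nonneg lam)
          linarith
        exact slope_le_of_near_boundary (A := A) (by linarith) hμA hμl (by linarith)
  have hxx : ∀ ξ ∈ Set.Ioo 0 (c₁ * ε), ∀ t ∈ Set.Ioo 0 Ts,
      Dw (slab T) (ex 0) (Dw (slab T) (ex 0) (W 0)) (Pi.single 0 (ξ + c ξ * t), t)
        * (1 + deriv c ξ * t) = c ξ * deriv c ξ / σ₀ := by
    intro ξ hξ t ht
    have ht' := Set.Ioo_subset_Ico_self ht
    have htT : c₁ * t ≤ c₁ * ε / 2 := (mul_le_mul_of_nonneg_left ht.2.le hc1.le).trans hc1Ts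
    set x : Fin 3 → ℝ := Pi.single 0 (ξ + c ξ * t) with hx
    have hx0 : x 0 = ξ + c ξ * t := by simp [hx]
    have hmem : sqd z x < (c₁ * ε - c₁ * t) ^ 2 := by
      rw [hsqd]
      have h1 := hmono t ht' hξ.1
      have h2 := mul_le_mul_of_nonneg_right (waveSpeed_le hc1 (hnn ξ hξ.1.le)) ht.1.le
      simp only [hc0, zero_add] at h1
      have hx1 : x 1 = 0 := by simp [hx]
      have hx2 : x 2 = 0 := by simp [hx]
      rw [hx0, hx1, hx2]
      have h3 : |ξ + c ξ * t - c₁ * ε| < c₁ * ε - c₁ * t :=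
        abs_lt.2 ⟨by linarith, by linarith [hξ.2]⟩
      nlinarith [sq_lt_sq' (by linarith [(abs_lt.1 h3).1]) (abs_lt.1 h3).2]
    have hm : 1 + deriv c ξ * t ≠ 0 := (hpos t ⟨ha.trans ht.1, ht.2⟩ ξ).ne'
    have hev : ∀ y, sqd z y < (c₁ * ε - c₁ * t) ^ 2 →
        (fun y' => W 0 (y', t)) =ᶠ[nhds y] fun y' => V 0 (y', t) := fun y hy => by
      filter_upwards [(isOpen_sqd_lt z _).mem_nhds hy] with y' hy' using heq t ht' y' hy' 0
    have hev2 : (fun y => pd (fun y' => W 0 (y', t)) 0 y)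
        =ᶠ[nhds x] fun y => pd (fun y' => V 0 (y', t)) 0 y := by
      filter_upwards [(isOpen_sqd_lt z _).mem_nhds hmem] with y hy using pd_congr (hev y hy) 0
    rw [← pd_pd_slice (hWT 0) ⟨ht.1.le, ht.2.trans hTsT⟩, pd_congr hev2,
      pd_pd_slice (hVc 0) ht', hVxx ξ t ht' x hx0, div_mul_cancel₀ _ hm]
  have hpath : ∀ᶠ s in nhdsWithin (0 : ℝ) (Set.Ioi 0),
      ys + s ∈ Set.Ioo 0 (c₁ * ε) ∧ Ts - s ∈ Set.Ioo 0 Ts := by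
    have h1 : 0 < c₁ * ε - ys := by
      have : 0 < c₁ * ε := by positivity
      linarith
    filter_upwards [Ioo_mem_nhdsGT h1, Ioo_mem_nhdsGT hTs] with s hs1 hs2
    exact ⟨⟨by linarith [hs1.1], by linarith [hs1.2]⟩, by linarith [hs2.2], by linarith [hs2.1]⟩
  set G := Dw (slab T) (ex 0) (Dw (slab T) (ex 0) (W 0)) with hG
  have hGc : ContinuousOn G (slab T) :=
    (contDiffOn_Dw (uniqueDiffOn_slab T)
      (contDiffOn_Dw (uniqueDiffOn_slab T) (hWT 0) _) _).continuousOn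
  have hcdc : Continuous (deriv c) := hcc.continuous_deriv (by norm_cast)
  have hcc0 : Continuous c := hcc.continuous
  let P : ℝ → SpT := fun s => (Pi.single 0 (ys + s + c (ys + s) * (Ts - s)), Ts - s)
  have hPc : Continuous P := by
    refine Continuous.prodMk ?_ (by fun_prop)
    exact (continuous_single 0).comp (by fun_prop)
  have hPs : ∀ᶠ s in nhdsWithin (0 : ℝ) (Set.Ioi 0), P s ∈ slab T := by
    filter_upwards [hpath] with s hs
    exact ⟨trivial, hs.2.1.le, hs.2.2.trans hTsT⟩
  have hP0 : P 0 ∈ slab T := ⟨trivial, by simpa [P] using hTs.le, by simpa [P] using hTsT⟩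
  have hlim1 : Filter.Tendsto (fun s => G (P s) * (1 + deriv c (ys + s) * (Ts - s)))
      (nhdsWithin 0 (Set.Ioi 0)) (nhds (G (P 0) * (1 + deriv c (ys + 0) * (Ts - 0)))) := by
    refine Filter.Tendsto.mul ?_ ?_
    · exact (hGc (P 0) hP0).tendsto.comp
        (tendsto_nhdsWithin_iff.2 ⟨(hPc.tendsto 0).mono_left nhdsWithin_le_nhds, hPs⟩)
    · exact ((by fun_prop : Continuous fun s => 1 + deriv c (ys + s) * (Ts - s)).tendsto
        0).mono_left nhdsWithin_le_nhds
  have hlim2 : Filter.Tendsto (fun s => c (ys + s) * deriv c (ys + s) / σ₀)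
      (nhdsWithin 0 (Set.Ioi 0)) (nhds (c (ys + 0) * deriv c (ys + 0) / σ₀)) :=
    ((by fun_prop : Continuous fun s => c (ys + s) * deriv c (ys + s) / σ₀).tendsto
      0).mono_left nhdsWithin_le_nhds
  have hEq := tendsto_nhds_unique (hlim1.congr' (by
    filter_upwards [hpath] with s hs using hxx _ hs.1 _ hs.2)) hlim2
  rw [add_zero, sub_zero, hys, mul_zero] at hEq
  have hcy : deriv c ys ≠ 0 := fun h => by simp [h] at hys
  exact div_ne_zero (mul_ne_zero (hcp ys).ne' hcy) hσ0 hEq.symm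

section PartialDerivatives

variable {f : (Fin 3 → ℝ) → ℝ}

theorem contDiff_pd (hf : ContDiff ℝ (⊤ : ℕ∞) f) (i : Fin 3) : ContDiff ℝ (⊤ : ℕ∞) (pd f i) :=
  (hf.fderiv_right (m := (⊤ : ℕ∞)) (by norm_cast)).clm_apply contDiff_const

theorem tsupport_pd_subset (f : (Fin 3 → ℝ) → ℝ) (i : Fin 3) : tsupport (pd f i) ⊆ tsupport f :=
  tsupport_fderiv_apply_subset ℝ _

theorem norm_iteratedFDeriv_pd_le (hf : ContDiff ℝ (⊤ : ℕ∞) f) (n : ℕ) (i : Fin 3)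
    (x : Fin 3 → ℝ) : ‖iteratedFDeriv ℝ n (pd f i) x‖ ≤ ‖iteratedFDeriv ℝ (n + 1) f x‖ := by
  let L := ContinuousLinearMap.apply ℝ ℝ (Pi.single i 1 : Fin 3 → ℝ)
  have hL : ‖L‖ ≤ 1 := by
    refine ContinuousLinearMap.opNorm_le_bound _ zero_le_one fun M => ?_
    have h : ‖(Pi.single i 1 : Fin 3 → ℝ)‖ = 1 := by rw [Pi.norm_single, norm_one]
    have := M.le_opNorm (Pi.single i 1)
    rw [h] at this
    simpa [L] using this
  have hfd : ContDiff ℝ (⊤ : ℕ∞) (fderiv ℝ f) := hf.fderiv_right (by norm_cast)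
  have h := L.norm_iteratedFDeriv_comp_left (f := fderiv ℝ f) (x := x) (n := n) hfd.contDiffAt
    (by exact_mod_cast le_top)
  rw [← norm_iteratedFDeriv_fderiv]
  exact h.trans (mul_le_of_le_one_left (norm_nonneg _) hL)

theorem norm_iteratedFDeriv_succ_le (hf : ContDiff ℝ (⊤ : ℕ∞) f) (n : ℕ) (x : Fin 3 → ℝ) :
    ‖iteratedFDeriv ℝ (n + 1) f x‖ ≤ ∑ i, ‖iteratedFDeriv ℝ n (pd f i) x‖ := by
  let L : Fin 3 → ℝ →L[ℝ] (Fin 3 → ℝ) →L[ℝ] ℝ := fun i =>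
    ContinuousLinearMap.smulRight (1 : ℝ →L[ℝ] ℝ)
      (ContinuousLinearMap.proj (R := ℝ) (φ := fun _ : Fin 3 => ℝ) i)
  have hL : ∀ i, ‖L i‖ ≤ 1 := fun i => by
    refine ContinuousLinearMap.opNorm_le_bound _ zero_le_one fun a => ?_
    refine ContinuousLinearMap.opNorm_le_bound _ (by positivity) fun v => ?_
    simp only [L, ContinuousLinearMap.smulRight_apply, one_apply_eq_self, one_mul,
      smul_apply, ContinuousLinearMap.proj_apply, norm_smul]
    exact mul_le_mul_of_nonneg_left (norm_le_pi_norm v i) (norm_nonneg a)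
  have hfd : fderiv ℝ f = fun y => ∑ i, (L i ∘ pd f i) y := by
    funext y
    refine ContinuousLinearMap.ext fun v => ?_
    conv_lhs => rw [pi_eq_sum_univ' v, map_sum]
    simp [L, pd, mul_comm]
  have hLc : ∀ i, ContDiff ℝ n (L i ∘ pd f i) := fun i =>
    (L i).contDiff.comp ((contDiff_pd hf i).of_le (by exact_mod_cast le_top))
  rw [← norm_iteratedFDeriv_fderiv, hfd,
    iteratedFDeriv_fun_sum_apply fun i _ => (hLc i).contDiffAt]
  refine (norm_sum_le _ _).trans (Finset.sum_le_sum fun i _ => ?_)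
  have h := (L i).norm_iteratedFDeriv_comp_left (f := pd f i) (x := x) (n := n)
    (contDiff_pd hf i).contDiffAt (by exact_mod_cast le_top)
  exact h.trans (mul_le_of_le_one_left (norm_nonneg _) (hL i))

theorem norm_iteratedFDeriv_two_le (hf : ContDiff ℝ (⊤ : ℕ∞) f) (x : Fin 3 → ℝ) :
    ‖iteratedFDeriv ℝ 2 f x‖ ≤ ∑ i, ∑ j, |pd (pd f i) j x| := by
  refine (norm_iteratedFDeriv_succ_le hf 1 x).trans (Finset.sum_le_sum fun i _ => ?_)
  refine (norm_iteratedFDeriv_succ_le (contDiff_pd hf i) 0 x).trans_eq ?_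
  simp

theorem norm_iteratedFDeriv_three_le (hf : ContDiff ℝ (⊤ : ℕ∞) f) (x : Fin 3 → ℝ) :
    ‖iteratedFDeriv ℝ 3 f x‖ ≤ ∑ i, ∑ j, ∑ k, |pd (pd (pd f i) j) k x| :=
  (norm_iteratedFDeriv_succ_le hf 2 x).trans
    (Finset.sum_le_sum fun i _ => norm_iteratedFDeriv_two_le (contDiff_pd hf i) x)

/-- Second-order chain rule estimate. -/
theorem norm_iteratedFDeriv_two_comp_le {h : ℝ → ℝ} {q : (Fin 3 → ℝ) → ℝ} {C : ℝ}
    (hh : ContDiff ℝ (⊤ : ℕ∞) h) (hq : ContDiff ℝ (⊤ : ℕ∞) q)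
    (hC : ∀ i ≤ 2, ∀ y, ‖iteratedFDeriv ℝ i h y‖ ≤ C) (x : Fin 3 → ℝ) :
    ‖iteratedFDeriv ℝ 2 (h ∘ q) x‖
      ≤ 2 * C * (‖iteratedFDeriv ℝ 1 q x‖ ^ 2 + ‖iteratedFDeriv ℝ 2 q x‖) := by
  set a := ‖iteratedFDeriv ℝ 1 q x‖
  set b := ‖iteratedFDeriv ℝ 2 q x‖
  have ha : 0 ≤ a := norm_nonneg _
  have hb : 0 ≤ b := norm_nonneg _
  have hD : √(a ^ 2 + b) ^ 2 = a ^ 2 + b := Real.sq_sqrt (by positivity)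
  have hle : ((2 : ℕ) : WithTop ℕ∞) ≤ (⊤ : ℕ∞) := by norm_cast
  have := norm_iteratedFDeriv_comp_le (n := 2) (C := C) (D := √(a ^ 2 + b))
    hh hq hle x (fun i hi => hC i hi _) fun i hi1 hi2 => by
      interval_cases i
      · rw [pow_one]
        exact Real.le_sqrt_of_sq_le (by linarith)
      · rw [hD]
        exact le_add_of_nonneg_left (sq_nonneg a)
  rw [hD] at this
  simpa using this

theorem norm_iteratedFDeriv_single_le {f : (Fin 3 → ℝ) → ℝ} (hf : ContDiff ℝ (⊤ : ℕ∞) f) (n : ℕ)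
    (x : Fin 3 → ℝ) :
    ‖iteratedFDeriv ℝ n (fun y => (Pi.single 0 (f y) : Fin 3 → ℝ)) x‖
      ≤ ‖iteratedFDeriv ℝ n f x‖ := by
  let L := ContinuousLinearMap.single ℝ (fun _ : Fin 3 => ℝ) 0
  have hL : ‖L‖ ≤ 1 := ContinuousLinearMap.opNorm_le_bound _ zero_le_one fun a => by
    simp [L, Pi.norm_single]
  have h := L.norm_iteratedFDeriv_comp_left (f := f) (x := x) (n := n) hf.contDiffAt
    (by exact_mod_cast le_top)
  exact h.trans (mul_le_of_le_one_left (norm_nonneg _) hL)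

end PartialDerivatives

theorem pd_const_mul {f : (Fin 3 → ℝ) → ℝ} {x : Fin 3 → ℝ} (c : ℝ) (i : Fin 3)
    (hf : DifferentiableAt ℝ f x) : pd (fun y => c * f y) i x = c * pd f i x := by
  unfold pd
  rw [fderiv_const_mul hf]
  rfl

theorem pd_comp_apply {W : ℝ → ℝ} {w : ℝ} {x : Fin 3 → ℝ} (hW : HasDerivAt W w (x 0)) :
    pd (fun y => W (y 0)) 0 x = w := by
  have h := hW.comp_hasFDerivAt x
    (ContinuousLinearMap.proj (R := ℝ) (φ := fun _ : Fin 3 => ℝ) 0).hasFDerivAt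
  unfold pd
  rw [HasFDerivAt.fderiv (f := fun y : Fin 3 → ℝ => W (y 0)) h]
  simp

theorem pd_eq_zero_of_forall {f : (Fin 3 → ℝ) → ℝ} {x : Fin 3 → ℝ} {i : Fin 3}
    (hf : DifferentiableAt ℝ f x) (h : ∀ t : ℝ, f (x + t • Pi.single i 1) = f x) :
    pd f i x = 0 := by
  unfold pd
  rw [← hf.lineDeriv_eq_fderiv, lineDeriv]
  simp only [h, deriv_const]

/-- Weights of the anisotropic dilations `(x₀, x₁, x₂) ↦ (r² x₀, r x₁, r x₂)`. -/
def wt (r : ℝ) (i : Fin 3) : ℝ := if i = 0 then r ^ 2 else r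

/-- The anisotropic dilation with factor `r⁻¹`. -/
def aniso (r : ℝ) (x : Fin 3 → ℝ) : Fin 3 → ℝ := fun i => (wt r i)⁻¹ * x i

theorem contDiff_aniso (r : ℝ) : ContDiff ℝ (⊤ : ℕ∞) (aniso r) := by
  unfold aniso
  fun_prop

theorem pd_comp_aniso {G : (Fin 3 → ℝ) → ℝ} (hG : Differentiable ℝ G) (r : ℝ) (i : Fin 3)
    (x : Fin 3 → ℝ) : pd (fun y => G (aniso r y)) i x = (wt r i)⁻¹ * pd G i (aniso r x) := by
  let A : (Fin 3 → ℝ) →L[ℝ] (Fin 3 → ℝ) := ContinuousLinearMap.pi fun i =>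
    (wt r i)⁻¹ • ContinuousLinearMap.proj (R := ℝ) (φ := fun _ : Fin 3 => ℝ) i
  have hA : A (Pi.single i 1) = (wt r i)⁻¹ • Pi.single i 1 := by
    ext j
    rcases eq_or_ne j i with rfl | h <;> simp_all [A]
  have h := (hG (aniso r x)).hasFDerivAt.comp x (A.hasFDerivAt (x := x))
  unfold pd
  rw [HasFDerivAt.fderiv (f := fun y => G (aniso r y)) h, ContinuousLinearMap.comp_apply, hA,
    map_smul, smul_eq_mul]

/-- A smooth even cutoff, together with a compactly supported primitive of its first moment. -/
theorem exists_cutoff_primitive : ∃ W χ : ℝ → ℝ, ContDiff ℝ (⊤ : ℕ∞) W ∧ ContDiff ℝ (⊤ : ℕ∞) χ ∧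
    (∀ y, χ (-y) = χ y) ∧ (∀ y, 0 ≤ χ y) ∧ (∀ y, χ y ≤ 1) ∧ (∀ y, |y| ≤ 1 → χ y = 1) ∧
    (∀ y, 2 ≤ |y| → χ y = 0) ∧ (∀ y, HasDerivAt W (y * χ y) y) ∧ ∀ y, 2 ≤ |y| → W y = 0 := by
  have hθ : Continuous fun u : ℝ => Real.smoothTransition ((4 - u) / 3) :=
    Real.smoothTransition.continuous.comp (by fun_prop)
  have hχ : ContDiff ℝ (⊤ : ℕ∞) fun y : ℝ => Real.smoothTransition ((4 - y ^ 2) / 3) :=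
    Real.smoothTransition.contDiff.comp (by fun_prop)
  have hzero : ∀ u : ℝ, 4 ≤ u → Real.smoothTransition ((4 - u) / 3) = 0 := fun u hu =>
    Real.smoothTransition.zero_of_nonpos (by linarith)
  have hsq : ∀ y : ℝ, 2 ≤ |y| → 4 ≤ y ^ 2 := fun y hy => by
    rw [← sq_abs]; nlinarith
  have hW : ∀ y : ℝ, HasDerivAt
      (fun y : ℝ => (1 / 2) * ∫ u in (4 : ℝ)..y ^ 2, Real.smoothTransition ((4 - u) / 3))
      (y * Real.smoothTransition ((4 - y ^ 2) / 3)) y := fun y => by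
    have h1 := hθ.integral_hasStrictDerivAt 4 (y ^ 2)
    have h2 := (h1.hasDerivAt.comp (h := fun y : ℝ => y ^ 2) y (hasDerivAt_pow 2 y)).const_mul (1 / 2)
    refine h2.congr_deriv ?_
    push_cast
    ring
  refine ⟨_, fun y => Real.smoothTransition ((4 - y ^ 2) / 3), ?_, hχ, fun y => by simp,
    fun y => Real.smoothTransition.nonneg _, fun y => Real.smoothTransition.le_one _,
    fun y hy => Real.smoothTransition.one_of_one_le ?_, fun y hy => hzero _ (hsq y hy), hW,
    fun y hy => ?_⟩
  · refine contDiff_infty_iff_deriv.2 ⟨fun y => (hW y).differentiableAt, ?_⟩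
    rw [funext fun y => (hW y).deriv]
    exact contDiff_id.mul hχ
  · have : y ^ 2 ≤ 1 := by rw [← sq_abs]; nlinarith [abs_nonneg y]
    linarith
  · have h4 := hsq y hy
    rw [intervalIntegral.integral_congr (g := fun _ => (0 : ℝ)) fun u hu => ?_]
    · simp
    · rw [Set.uIcc_of_le h4] at hu
      exact hzero u hu.1

/-- The box `[-2, 2] × [-L, L]²`. -/
def blobBox (L : ℝ) : Set (Fin 3 → ℝ) := {y | |y 0| ≤ 2 ∧ |y 1| ≤ L ∧ |y 2| ≤ L}

theorem isCompact_blobBox (L : ℝ) : IsCompact (blobBox L) := by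
  have h : blobBox L = Set.Icc (fun i => if i = 0 then -2 else -L)
      (fun i => if i = 0 then 2 else L) := by
    ext y
    simp [blobBox, Pi.le_def, Fin.forall_fin_succ, abs_le]
    tauto
  rw [h]
  exact isCompact_Icc

theorem exists_blob {W χ : ℝ → ℝ} (hW : ContDiff ℝ (⊤ : ℕ∞) W)
    (hχ1 : ∀ y, |y| ≤ 1 → χ y = 1) (hWχ : ∀ y, HasDerivAt W (y * χ y) y)
    (hW0 : ∀ y, 2 ≤ |y| → W y = 0) {β : ℝ} (hβ : 0 < β) :
    ∃ G : (Fin 3 → ℝ) → ℝ, ContDiff ℝ (⊤ : ℕ∞) G ∧ tsupport G ⊆ blobBox (1 + 2 * β) ∧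
      (∀ y, y 1 ^ 2 + y 2 ^ 2 ≤ β → G y = W (y 0)) ∧ (∀ y, 2 ≤ |y 0| → G y = 0) ∧
      ∀ y, |y 0| < 1 → pd (pd (pd G 0) 0) 0 y = 0 := by
  set ψ : (Fin 3 → ℝ) → ℝ := fun y => Real.smoothTransition (2 - (y 1 ^ 2 + y 2 ^ 2) / β)
  have hψ : ContDiff ℝ (⊤ : ℕ∞) ψ := Real.smoothTransition.contDiff.comp (by fun_prop)
  have hψd : Differentiable ℝ ψ := hψ.differentiable (by simp)
  have hWc : ContDiff ℝ (⊤ : ℕ∞) fun y : Fin 3 → ℝ => W (y 0) := hW.comp (contDiff_apply ℝ ℝ 0)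
  have hψ0 : ∀ y, pd ψ 0 y = 0 := fun y => pd_eq_zero_of_forall (hψd y) fun t => by simp [ψ]
  have hclosed : IsClosed (blobBox (1 + 2 * β)) := (isCompact_blobBox _).isClosed
  refine ⟨fun y => W (y 0) * ψ y, hWc.mul hψ, ?_, fun y hy => ?_, fun y hy => ?_, fun y hy => ?_⟩
  · refine closure_minimal (fun y hy => ?_) hclosed
    have hy' := Function.mem_support.1 hy
    have h0 : |y 0| ≤ 2 := by
      by_contra! h
      exact hy' (by rw [hW0 _ h.le, zero_mul])
    have h12 : y 1 ^ 2 + y 2 ^ 2 ≤ 2 * β := by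
      by_contra! h
      refine hy' (mul_eq_zero_of_right _ (Real.smoothTransition.zero_of_nonpos ?_))
      rw [sub_nonpos, le_div_iff₀ hβ]
      exact h.le
    have hle : ∀ a : ℝ, a ^ 2 ≤ 2 * β → |a| ≤ 1 + 2 * β := fun a ha => by
      refine abs_le_of_sq_le_sq ?_ (by positivity)
      nlinarith
    exact ⟨h0, hle _ (by nlinarith [sq_nonneg (y 2)]), hle _ (by nlinarith [sq_nonneg (y 1)])⟩
  · have : ψ y = 1 := by
      refine Real.smoothTransition.one_of_one_le ?_
      have := (div_le_one hβ).2 hy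
      linarith
    simp only [this, mul_one]
  · simp only [hW0 _ hy, zero_mul]
  · have hopen : ∀ z : Fin 3 → ℝ, |z 0| < 1 → ∀ᶠ z' in nhds z, |z' 0| < 1 := fun z hz =>
      (isOpen_lt (f := fun z : Fin 3 → ℝ => |z 0|) (by fun_prop) continuous_const).mem_nhds hz
    have h1 : ∀ z : Fin 3 → ℝ, |z 0| < 1 →
        pd (fun y => W (y 0) * ψ y) 0 z = z 0 * ψ z := fun z hz => by
      rw [pd_mul 0 (hWc.differentiable (by simp) z) (hψd z), hψ0, pd_comp_apply (hWχ _),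
        hχ1 _ hz.le]
      ring
    have h2 : ∀ z : Fin 3 → ℝ, |z 0| < 1 →
        pd (pd (fun y => W (y 0) * ψ y) 0) 0 z = ψ z := fun z hz => by
      rw [pd_congr ((hopen z hz).mono h1), pd_mul 0 (by fun_prop) (hψd z), hψ0,
        pd_comp_apply (W := fun s => s) (hasDerivAt_id _)]
      ring
    rw [pd_congr ((hopen y hy).mono h2), hψ0]

/-- The scales of the superposition. -/
def rad (n : ℕ) (m : Fin n) : ℝ := (1 / 2) ^ (n + (m : ℕ))

theorem rad_pos (n : ℕ) (m : Fin n) : 0 < rad n m := by unfold rad; positivity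

theorem rad_sq_le (n : ℕ) (m : Fin n) : rad n m ^ 2 ≤ (1 / 4) ^ n := by
  have h : rad n m ≤ (1 / 2) ^ n :=
    pow_le_pow_of_le_one (by norm_num) (by norm_num) (Nat.le_add_right _ _)
  calc rad n m ^ 2 ≤ ((1 / 2) ^ n) ^ 2 := by gcongr; exact (rad_pos n m).le
    _ = (1 / 4) ^ n := by rw [← pow_mul, mul_comm, pow_mul]; norm_num

theorem rad_le_one (n : ℕ) (m : Fin n) : rad n m ≤ 1 :=
  pow_le_one₀ (by norm_num) (by norm_num)

theorem natCast_mul_rad_sq_le_one (n : ℕ) (m : Fin n) : (n : ℝ) * rad n m ^ 2 ≤ 1 := by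
  have h : (n : ℝ) ≤ 4 ^ n := by exact_mod_cast (Nat.lt_pow_self (by norm_num)).le
  calc (n : ℝ) * rad n m ^ 2 ≤ 4 ^ n * (1 / 4) ^ n := by
        gcongr
        exact rad_sq_le n m
    _ = 1 := by rw [← mul_pow]; norm_num

theorem four_mul_rad_sq_le {n : ℕ} {m m' : Fin n} (h : m < m') :
    4 * rad n m' ^ 2 ≤ rad n m ^ 2 := by
  have h1 : rad n m' ≤ (1 / 2) ^ (n + (m : ℕ) + 1) :=
    pow_le_pow_of_le_one (by norm_num) (by norm_num) (by have : (m : ℕ) < m' := h; omega)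
  have h2 : 2 * rad n m' ≤ rad n m := by
    rw [pow_succ] at h1
    unfold rad at h1 ⊢
    linarith
  have := rad_pos n m'
  nlinarith

/-- Superposition of anisotropically rescaled copies of `H`. -/
def superpose {n : ℕ} (a : Fin n → ℝ) (H : (Fin 3 → ℝ) → ℝ) (x : Fin 3 → ℝ) : ℝ :=
  ∑ m, a m * H (aniso (rad n m) x)

section Superpose

variable {n : ℕ} {H : (Fin 3 → ℝ) → ℝ}

theorem contDiff_superpose (a : Fin n → ℝ) (hH : ContDiff ℝ (⊤ : ℕ∞) H) :
    ContDiff ℝ (⊤ : ℕ∞) (superpose a H) :=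
  ContDiff.sum fun _ _ => contDiff_const.mul (hH.comp (contDiff_aniso _))

theorem pd_superpose (a : Fin n → ℝ) (hH : ContDiff ℝ (⊤ : ℕ∞) H) (i : Fin 3) :
    pd (superpose a H) i = superpose (fun m => a m * (wt (rad n m) i)⁻¹) (pd H i) := by
  have hd : ∀ m, Differentiable ℝ fun y => H (aniso (rad n m) y) := fun m =>
    (hH.comp (contDiff_aniso _)).differentiable (by simp)
  funext x
  unfold superpose
  rw [pd_sum i fun m => (hd m x).const_mul (a m)]
  refine Finset.sum_congr rfl fun m _ => ?_
  rw [pd_const_mul _ _ (hd m x), pd_comp_aniso (hH.differentiable (by simp))]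
  ring

/-- The indicator of the rescaled box at scale `rad n m`. -/
def boxInd (L : ℝ) (m : Fin n) (x : Fin 3 → ℝ) : ℝ :=
  (blobBox L).indicator 1 (aniso (rad n m) x)

/-- The density dominating the squared top-order derivatives of the superposition. -/
def boxDensity (n : ℕ) (L : ℝ) (x : Fin 3 → ℝ) : ℝ :=
  ∑ m : Fin n, ((rad n m) ^ 4)⁻¹ * boxInd L m x

theorem boxInd_nonneg (L : ℝ) (m : Fin n) (x : Fin 3 → ℝ) : 0 ≤ boxInd L m x :=
  Set.indicator_nonneg (fun _ _ => zero_le_one) _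

theorem boxInd_sq (L : ℝ) (m : Fin n) (x : Fin 3 → ℝ) : boxInd L m x ^ 2 = boxInd L m x := by
  unfold boxInd
  by_cases h : aniso (rad n m) x ∈ blobBox L <;> simp [h]

theorem boxInd_le_one (L : ℝ) (m : Fin n) (x : Fin 3 → ℝ) : boxInd L m x ≤ 1 := by
  nlinarith [boxInd_sq L m x, sq_nonneg (boxInd L m x - 1)]

theorem abs_le_mul_boxInd {L M : ℝ} (hsupp : tsupport H ⊆ blobBox L) (hM : ∀ y, |H y| ≤ M)
    (m : Fin n) (x : Fin 3 → ℝ) : |H (aniso (rad n m) x)| ≤ M * boxInd L m x := by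
  unfold boxInd
  by_cases h : aniso (rad n m) x ∈ blobBox L
  · simpa [h] using hM _
  · rw [image_eq_zero_of_notMem_tsupport fun h' => h (hsupp h')]
    simp [h]

theorem abs_superpose_le {L M : ℝ} {a b : Fin n → ℝ} (hsupp : tsupport H ⊆ blobBox L)
    (hM : ∀ y, |H y| ≤ M) (hab : ∀ m, |a m| ≤ b m) (x : Fin 3 → ℝ) :
    |superpose a H x| ≤ M * ∑ m, b m * boxInd L m x := by
  rw [Finset.mul_sum]
  refine (Finset.abs_sum_le_sum_abs _ _).trans (Finset.sum_le_sum fun m _ => ?_)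
  rw [abs_mul]
  calc |a m| * |H (aniso (rad n m) x)| ≤ b m * (M * boxInd L m x) :=
        mul_le_mul (hab m) (abs_le_mul_boxInd hsupp hM m x) (abs_nonneg _)
          ((abs_nonneg _).trans (hab m))
    _ = M * (b m * boxInd L m x) := by ring

theorem sq_sum_inv_rad_le (L : ℝ) (x : Fin 3 → ℝ) :
    (∑ m : Fin n, (rad n m)⁻¹ * boxInd L m x) ^ 2 ≤ boxDensity n L x := by
  refine (sq_sum_le_card_mul_sum_sq).trans ?_
  rw [Finset.card_univ, Fintype.card_fin, Finset.mul_sum]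
  refine Finset.sum_le_sum fun m _ => ?_
  rw [mul_pow, boxInd_sq, ← mul_assoc]
  refine mul_le_mul_of_nonneg_right ?_ (boxInd_nonneg L m x)
  have hr := rad_pos n m
  have h := natCast_mul_rad_sq_le_one n m
  rw [inv_pow, ← div_eq_mul_inv, div_le_iff₀ (by positivity)]
  have : ((rad n m) ^ 4)⁻¹ * rad n m ^ 2 = (rad n m ^ 2)⁻¹ := by field_simp
  rw [this, le_inv_comm₀ (Nat.cast_pos.2 m.pos) (by positivity), ← one_div,
    le_div_iff₀ (Nat.cast_pos.2 m.pos), mul_comm]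
  exact h

theorem sum_boxInd_pow_four_le (L : ℝ) (x : Fin 3 → ℝ) :
    (∑ m : Fin n, boxInd L m x) ^ 4 ≤ n ^ 2 * boxDensity n L x := by
  have h0 : 0 ≤ ∑ m : Fin n, boxInd L m x := Finset.sum_nonneg fun m _ => boxInd_nonneg L m x
  have h1 : ∑ m : Fin n, boxInd L m x ≤ n := by
    refine (Finset.sum_le_sum fun m _ => boxInd_le_one L m x).trans ?_
    simp
  have h2 : ∑ m : Fin n, boxInd L m x ≤ ∑ m : Fin n, (rad n m)⁻¹ * boxInd L m x :=
    Finset.sum_le_sum fun m _ => le_mul_of_one_le_left (boxInd_nonneg L m x)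
      ((one_le_inv₀ (rad_pos n m)).2 (rad_le_one n m))
  calc (∑ m : Fin n, boxInd L m x) ^ 4
      = (∑ m : Fin n, boxInd L m x) ^ 2 * (∑ m : Fin n, boxInd L m x) ^ 2 := by ring
    _ ≤ n ^ 2 * (∑ m : Fin n, (rad n m)⁻¹ * boxInd L m x) ^ 2 := by gcongr
    _ ≤ n ^ 2 * boxDensity n L x := by gcongr; exact sq_sum_inv_rad_le L x

theorem sq_superpose_le_of_separated {L M : ℝ} (hsupp : tsupport H ⊆ blobBox L)
    (hM : ∀ y, |H y| ≤ M) (hz : ∀ y, |y 0| < 1 → H y = 0) {a : Fin n → ℝ} {κ : ℝ}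
    (ha : ∀ m, a m ^ 2 = κ ^ 2 * ((rad n m) ^ 4)⁻¹) (x : Fin 3 → ℝ) :
    superpose a H x ^ 2 ≤ (κ * M) ^ 2 * boxDensity n L x := by
  have hr : ∀ m, H (aniso (rad n m) x) ≠ 0 → rad n m ^ 2 ≤ |x 0| ∧ |x 0| ≤ 2 * rad n m ^ 2 :=
    fun m hm => by
      have hp : 0 < rad n m ^ 2 := pow_pos (rad_pos n m) 2
      have h0 : |aniso (rad n m) x 0| = |x 0| / rad n m ^ 2 := by
        simp [aniso, wt, abs_mul, abs_inv, div_eq_inv_mul]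
      have h1 : 1 ≤ |aniso (rad n m) x 0| := by
        by_contra! h
        exact hm (hz _ h)
      have h2 : |aniso (rad n m) x 0| ≤ 2 :=
        (hsupp (subset_tsupport _ (Function.mem_support.2 hm))).1
      rw [h0] at h1 h2
      exact ⟨by rwa [le_div_iff₀ hp, one_mul] at h1, by rwa [div_le_iff₀ hp] at h2⟩
  have hsep : ∀ m m', m < m' → H (aniso (rad n m) x) * H (aniso (rad n m') x) = 0 :=
    fun m m' hlt => by
      by_contra h
      have h1 := (hr m (left_ne_zero_of_mul h)).1
      have h2 := (hr m' (right_ne_zero_of_mul h)).2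
      have h3 := four_mul_rad_sq_le hlt
      have h4 := pow_pos (rad_pos n m') 2
      linarith
  have hsq : superpose a H x ^ 2 = ∑ m, (a m * H (aniso (rad n m) x)) ^ 2 := by
    unfold superpose
    rw [sq, Finset.sum_mul_sum]
    refine Finset.sum_congr rfl fun m _ => ?_
    rw [Finset.sum_eq_single m (fun m' _ hne => ?_) (by simp), sq]
    rcases lt_or_gt_of_ne hne with h | h
    · linear_combination a m * a m' * hsep _ _ h
    · linear_combination a m * a m' * hsep _ _ h
  rw [hsq, boxDensity, Finset.mul_sum]
  refine Finset.sum_le_sum fun m _ => ?_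
  have h1 := abs_le_mul_boxInd hsupp hM m x
  have h2 : H (aniso (rad n m) x) ^ 2 ≤ M ^ 2 * boxInd L m x := by
    rw [← boxInd_sq, ← mul_pow, ← sq_abs]
    gcongr
  have hp : 0 ≤ κ ^ 2 * ((rad n m) ^ 4)⁻¹ := by have := rad_pos n m; positivity
  calc (a m * H (aniso (rad n m) x)) ^ 2
      = κ ^ 2 * ((rad n m) ^ 4)⁻¹ * H (aniso (rad n m) x) ^ 2 := by rw [mul_pow, ha]
    _ ≤ κ ^ 2 * ((rad n m) ^ 4)⁻¹ * (M ^ 2 * boxInd L m x) := by gcongr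
    _ = (κ * M) ^ 2 * (((rad n m) ^ 4)⁻¹ * boxInd L m x) := by ring

end Superpose

theorem wt_eq_pow (r : ℝ) (i : Fin 3) : wt r i = r ^ (if i = 0 then 2 else 1) := by
  unfold wt
  split_ifs <;> simp

theorem wt_pos {r : ℝ} (hr : 0 < r) (i : Fin 3) : 0 < wt r i := by
  rw [wt_eq_pow]
  positivity

theorem pow_four_mul_inv_wt_le_one {r : ℝ} (hr : 0 < r) (hr1 : r ≤ 1) (i j : Fin 3) :
    r ^ 4 * (wt r i)⁻¹ * (wt r j)⁻¹ ≤ 1 := by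
  rw [mul_assoc, ← mul_inv, ← div_eq_mul_inv, wt_eq_pow, wt_eq_pow, ← pow_add,
    div_le_one (by positivity)]
  exact pow_le_pow_of_le_one hr.le hr1 (by split_ifs <;> norm_num)

theorem pow_four_mul_inv_wt_le_inv {r : ℝ} (hr : 0 < r) (hr1 : r ≤ 1) {i j k : Fin 3}
    (h : ¬(i = 0 ∧ j = 0 ∧ k = 0)) :
    r ^ 4 * (wt r i)⁻¹ * (wt r j)⁻¹ * (wt r k)⁻¹ ≤ r⁻¹ := by
  rw [mul_assoc, mul_assoc, ← mul_inv, ← mul_inv, ← div_eq_mul_inv, wt_eq_pow, wt_eq_pow,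
    wt_eq_pow, ← pow_add, ← pow_add, div_le_iff₀ (by positivity), inv_mul_eq_div,
    le_div_iff₀ hr, ← pow_succ]
  exact pow_le_pow_of_le_one hr.le hr1 (by split_ifs <;> omega)

/-- A blob together with uniform bounds for its partial derivatives up to order three. -/
structure IsBlob (G : (Fin 3 → ℝ) → ℝ) (L M : ℝ) : Prop where
  contDiff : ContDiff ℝ (⊤ : ℕ∞) G
  tsupport_subset : tsupport G ⊆ blobBox L
  pd_zero_eq : ∀ y, |y 0| < 1 → pd (pd (pd G 0) 0) 0 y = 0
  abs_pd_le : ∀ i y, |pd G i y| ≤ M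
  abs_pd_pd_le : ∀ i j y, |pd (pd G i) j y| ≤ M
  abs_pd_pd_pd_le : ∀ i j k y, |pd (pd (pd G i) j) k y| ≤ M

theorem exists_isBlob {G : (Fin 3 → ℝ) → ℝ} {L : ℝ} (hG : ContDiff ℝ (⊤ : ℕ∞) G)
    (hs : tsupport G ⊆ blobBox L) (h0 : ∀ y, |y 0| < 1 → pd (pd (pd G 0) 0) 0 y = 0) :
    ∃ M, IsBlob G L M := by
  have key : ∀ H : (Fin 3 → ℝ) → ℝ, ContDiff ℝ (⊤ : ℕ∞) H → tsupport H ⊆ blobBox L →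
      ∃ M, ∀ y, |H y| ≤ M := fun H hH hHs => by
    have hc : HasCompactSupport H := (isCompact_blobBox L).of_isClosed_subset
      (isClosed_tsupport _) hHs
    exact hc.exists_bound_of_continuous hH.continuous
  have c1 : ∀ i, ContDiff ℝ (⊤ : ℕ∞) (pd G i) := fun i => contDiff_pd hG i
  have c2 : ∀ i j, ContDiff ℝ (⊤ : ℕ∞) (pd (pd G i) j) := fun i j => contDiff_pd (c1 i) j
  have s1 : ∀ i, tsupport (pd G i) ⊆ blobBox L := fun i => (tsupport_pd_subset _ i).trans hs
  have s2 : ∀ i j, tsupport (pd (pd G i) j) ⊆ blobBox L := fun i j =>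
    (tsupport_pd_subset _ j).trans (s1 i)
  choose A hA using fun i => key _ (c1 i) (s1 i)
  choose B hB using fun p : Fin 3 × Fin 3 => key _ (c2 p.1 p.2) (s2 p.1 p.2)
  choose C hC using fun p : Fin 3 × Fin 3 × Fin 3 => key _ (contDiff_pd (c2 p.1 p.2.1) p.2.2)
    ((tsupport_pd_subset _ _).trans (s2 p.1 p.2.1))
  have hA0 : ∀ i, 0 ≤ A i := fun i => (abs_nonneg _).trans (hA i 0)
  have hB0 : ∀ p, 0 ≤ B p := fun p => (abs_nonneg _).trans (hB p 0)
  have hC0 : ∀ p, 0 ≤ C p := fun p => (abs_nonneg _).trans (hC p 0)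
  have sA := Finset.sum_nonneg fun i (_ : i ∈ Finset.univ) => hA0 i
  have sB := Finset.sum_nonneg fun i (_ : i ∈ Finset.univ) => hB0 i
  have sC := Finset.sum_nonneg fun i (_ : i ∈ Finset.univ) => hC0 i
  refine ⟨∑ i, A i + ∑ p, B p + ∑ p, C p, hG, hs, h0, fun i y => ?_, fun i j y => ?_,
    fun i j k y => ?_⟩
  · have := Finset.single_le_sum (fun i _ => hA0 i) (Finset.mem_univ i)
    linarith [hA i y]
  · have := Finset.single_le_sum (fun i _ => hB0 i) (Finset.mem_univ (i, j))
    linarith [hB (i, j) y]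
  · have := Finset.single_le_sum (fun i _ => hC0 i) (Finset.mem_univ (i, j, k))
    linarith [hC (i, j, k) y]

namespace IsBlob

variable {G : (Fin 3 → ℝ) → ℝ} {L M : ℝ}

/-- The superposition `κ ∑ₘ rₘ⁴ G(x₀ / rₘ², x₁ / rₘ, x₂ / rₘ)`. -/
def profile (n : ℕ) (κ : ℝ) (G : (Fin 3 → ℝ) → ℝ) : (Fin 3 → ℝ) → ℝ :=
  superpose (fun m : Fin n => κ * rad n m ^ 4) G

theorem bound_nonneg (hG : IsBlob G L M) : 0 ≤ M := (abs_nonneg _).trans (hG.abs_pd_le 0 0)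

theorem contDiff_profile (hG : IsBlob G L M) (n : ℕ) (κ : ℝ) :
    ContDiff ℝ (⊤ : ℕ∞) (profile n κ G) :=
  contDiff_superpose _ hG.contDiff

theorem abs_pd_profile_le (hG : IsBlob G L M) (n : ℕ) (κ : ℝ) (x : Fin 3 → ℝ) :
    |pd (profile n κ G) 0 x| ≤ |κ| * n * M * (1 / 4) ^ n := by
  have hM := hG.bound_nonneg
  rw [profile, pd_superpose _ hG.contDiff]
  have hb : ∀ m : Fin n, |κ * rad n m ^ 4 * (wt (rad n m) 0)⁻¹| ≤ |κ| * (1 / 4) ^ n := fun m => by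
    have hr := rad_pos n m
    have h : κ * rad n m ^ 4 * (wt (rad n m) 0)⁻¹ = κ * rad n m ^ 2 := by
      simp only [wt, if_pos]
      field_simp
    rw [h, abs_mul, abs_of_nonneg (sq_nonneg (rad n m))]
    gcongr
    exact rad_sq_le n m
  refine (abs_superpose_le ((tsupport_pd_subset _ _).trans hG.tsupport_subset)
    (hG.abs_pd_le 0) hb x).trans ?_
  calc M * ∑ m : Fin n, |κ| * (1 / 4) ^ n * boxInd L m x
      ≤ M * ∑ _m : Fin n, |κ| * (1 / 4) ^ n * 1 := by
        gcongr with m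
        exact boxInd_le_one L m x
    _ = |κ| * n * M * (1 / 4) ^ n := by
        simp
        ring

theorem norm_iteratedFDeriv_two_profile_le (hG : IsBlob G L M) (n : ℕ) (κ : ℝ) (x : Fin 3 → ℝ) :
    ‖iteratedFDeriv ℝ 2 (profile n κ G) x‖ ^ 4
      ≤ (9 * |κ| * M) ^ 4 * (n ^ 2 * boxDensity n L x) := by
  have hM := hG.bound_nonneg
  have hij : ∀ i j, |pd (pd (profile n κ G) i) j x| ≤ |κ| * M * ∑ m : Fin n, boxInd L m x :=
    fun i j => by
      rw [profile, pd_superpose _ hG.contDiff, pd_superpose _ (contDiff_pd hG.contDiff i)]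
      have hb : ∀ m : Fin n,
          |κ * rad n m ^ 4 * (wt (rad n m) i)⁻¹ * (wt (rad n m) j)⁻¹| ≤ |κ| := fun m => by
        have hr := rad_pos n m
        have hi := wt_pos hr i
        have hj := wt_pos hr j
        rw [mul_assoc κ, mul_assoc κ, abs_mul,
          abs_of_nonneg (a := rad n m ^ 4 * _ * _) (by positivity)]
        exact mul_le_of_le_one_right (abs_nonneg _)
          (pow_four_mul_inv_wt_le_one hr (rad_le_one n m) i j)
      refine (abs_superpose_le ((tsupport_pd_subset _ _).trans
        ((tsupport_pd_subset _ _).trans hG.tsupport_subset))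
        (hG.abs_pd_pd_le i j) hb x).trans_eq ?_
      rw [← Finset.mul_sum]
      ring
  have hS : 0 ≤ ∑ m : Fin n, boxInd L m x := Finset.sum_nonneg fun m _ => boxInd_nonneg L m x
  have h : ‖iteratedFDeriv ℝ 2 (profile n κ G) x‖ ≤ 9 * |κ| * M * ∑ m : Fin n, boxInd L m x := by
    refine (norm_iteratedFDeriv_two_le (hG.contDiff_profile n κ) x).trans
      ((Finset.sum_le_sum fun i _ => Finset.sum_le_sum fun j _ => hij i j).trans_eq ?_)
    simp
    ring
  calc ‖iteratedFDeriv ℝ 2 (profile n κ G) x‖ ^ 4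
      ≤ (9 * |κ| * M * ∑ m : Fin n, boxInd L m x) ^ 4 := by gcongr
    _ = (9 * |κ| * M) ^ 4 * (∑ m : Fin n, boxInd L m x) ^ 4 := by rw [mul_pow]
    _ ≤ _ := by gcongr; exact sum_boxInd_pow_four_le L x

theorem norm_iteratedFDeriv_three_profile_le (hG : IsBlob G L M) (n : ℕ) (κ : ℝ)
    (x : Fin 3 → ℝ) :
    ‖iteratedFDeriv ℝ 3 (profile n κ G) x‖ ^ 2 ≤ (27 * |κ| * M) ^ 2 * boxDensity n L x := by
  have hM := hG.bound_nonneg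
  have hΦ : 0 ≤ boxDensity n L x := Finset.sum_nonneg fun m _ =>
    mul_nonneg (by have := rad_pos n m; positivity) (boxInd_nonneg L m x)
  have hijk : ∀ i j k, |pd (pd (pd (profile n κ G) i) j) k x|
      ≤ |κ| * M * √(boxDensity n L x) := fun i j k => by
    refine abs_le_of_sq_le_sq ?_ (by positivity)
    rw [mul_pow, Real.sq_sqrt hΦ, profile, pd_superpose _ hG.contDiff,
      pd_superpose _ (contDiff_pd hG.contDiff i),
      pd_superpose _ (contDiff_pd (contDiff_pd hG.contDiff i) j)]
    have hs : tsupport (pd (pd (pd G i) j) k) ⊆ blobBox L := (tsupport_pd_subset _ _).trans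
      ((tsupport_pd_subset _ _).trans ((tsupport_pd_subset _ _).trans hG.tsupport_subset))
    by_cases h : i = 0 ∧ j = 0 ∧ k = 0
    · obtain ⟨rfl, rfl, rfl⟩ := h
      refine sq_superpose_le_of_separated hs (hG.abs_pd_pd_pd_le 0 0 0) hG.pd_zero_eq
        (fun m => ?_) x
      have hr := rad_pos n m
      rw [sq_abs]
      simp only [wt, if_pos]
      field_simp
    · have hb : ∀ m : Fin n, |κ * rad n m ^ 4 * (wt (rad n m) i)⁻¹ * (wt (rad n m) j)⁻¹
          * (wt (rad n m) k)⁻¹| ≤ |κ| * (rad n m)⁻¹ := fun m => by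
        have hr := rad_pos n m
        have hi := wt_pos hr i
        have hj := wt_pos hr j
        have hk := wt_pos hr k
        rw [mul_assoc κ, mul_assoc κ, mul_assoc κ, abs_mul,
          abs_of_nonneg (a := rad n m ^ 4 * _ * _ * _) (by positivity)]
        gcongr
        exact pow_four_mul_inv_wt_le_inv hr (rad_le_one n m) h
      have h1 := abs_superpose_le hs (hG.abs_pd_pd_pd_le i j k) hb x
      simp only [mul_assoc |κ|] at h1
      rw [← Finset.mul_sum] at h1
      rw [← sq_abs]
      refine (pow_le_pow_left₀ (abs_nonneg _) h1 2).trans ?_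
      have h2 := mul_le_mul_of_nonneg_left (sq_sum_inv_rad_le (n := n) L x)
        (sq_nonneg (|κ| * M))
      exact le_of_eq_of_le (by ring) h2
  have h : ‖iteratedFDeriv ℝ 3 (profile n κ G) x‖ ≤ 27 * |κ| * M * √(boxDensity n L x) := by
    refine (norm_iteratedFDeriv_three_le (hG.contDiff_profile n κ) x).trans
      ((Finset.sum_le_sum fun i _ => Finset.sum_le_sum fun j _ => Finset.sum_le_sum fun k _ =>
        hijk i j k).trans_eq ?_)
    simp
    ring
  calc ‖iteratedFDeriv ℝ 3 (profile n κ G) x‖ ^ 2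
      ≤ (27 * |κ| * M * √(boxDensity n L x)) ^ 2 := by gcongr
    _ = _ := by rw [mul_pow, Real.sq_sqrt hΦ]

end IsBlob

theorem preimage_aniso_blobBox {r : ℝ} (hr : 0 < r) (L : ℝ) :
    aniso r ⁻¹' blobBox L = Set.Icc (fun i => if i = 0 then -(2 * r ^ 2) else -(L * r))
      (fun i => if i = 0 then 2 * r ^ 2 else L * r) := by
  have h2 : 0 < r ^ 2 := by positivity
  have e0 : ∀ a : ℝ, |(r ^ 2)⁻¹ * a| ≤ 2 ↔ -(2 * r ^ 2) ≤ a ∧ a ≤ 2 * r ^ 2 := fun a => by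
    rw [inv_mul_eq_div, abs_div, abs_of_pos h2, div_le_iff₀ h2, abs_le]
  have e1 : ∀ a : ℝ, |r⁻¹ * a| ≤ L ↔ -(L * r) ≤ a ∧ a ≤ L * r := fun a => by
    rw [inv_mul_eq_div, abs_div, abs_of_pos hr, div_le_iff₀ hr, abs_le]
  ext y
  simp only [Set.mem_preimage, blobBox, Set.mem_ofPred_eq, aniso, wt, Set.mem_Icc, Pi.le_def,
    Fin.forall_fin_succ]
  simp [-abs_mul, e0, e1]
  tauto

theorem boxInd_eq {n : ℕ} (L : ℝ) (m : Fin n) :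
    boxInd L m = (aniso (rad n m) ⁻¹' blobBox L).indicator 1 := rfl

theorem integrable_boxInd {n : ℕ} (L : ℝ) (m : Fin n) : Integrable (boxInd L m) := by
  rw [boxInd_eq, preimage_aniso_blobBox (rad_pos n m)]
  exact (integrable_indicator_iff measurableSet_Icc).2
    (integrableOn_const (isCompact_Icc.measure_lt_top).ne)

theorem integral_boxInd {n : ℕ} {L : ℝ} (hL : 0 ≤ L) (m : Fin n) :
    ∫ x, boxInd L m x = 16 * L ^ 2 * rad n m ^ 4 := by
  have hr := rad_pos n m
  rw [boxInd_eq, preimage_aniso_blobBox hr, integral_indicator_one measurableSet_Icc,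
    measureReal_def, Real.volume_Icc_pi_toReal, Fin.prod_univ_three]
  · simp
    ring
  · intro i
    dsimp only
    split_ifs <;> nlinarith [mul_nonneg hL hr.le, sq_nonneg (rad n m)]

theorem integrable_boxDensity (n : ℕ) (L : ℝ) : Integrable (boxDensity n L) :=
  integrable_finsetSum _ fun m _ => (integrable_boxInd L m).const_mul _

theorem integral_boxDensity (n : ℕ) {L : ℝ} (hL : 0 ≤ L) :
    ∫ x, boxDensity n L x = 16 * L ^ 2 * n := by
  unfold boxDensity
  rw [integral_finsetSum _ fun m _ => (integrable_boxInd L m).const_mul _]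
  have h : ∀ m : Fin n, ∫ x, ((rad n m) ^ 4)⁻¹ * boxInd L m x = 16 * L ^ 2 := fun m => by
    have hr := rad_pos n m
    rw [integral_const_mul, integral_boxInd hL]
    field_simp
  simp only [h]
  simp
  ring

theorem sobolevSemi_le {n k : ℕ} {L A : ℝ} (hL : 0 ≤ L) {f : (Fin 3 → ℝ) → Fin 3 → ℝ}
    (h : ∀ x, ‖iteratedFDeriv ℝ k f x‖ ^ 2 ≤ A * boxDensity n L x) :
    sobolevSemi k f ≤ √(A * (16 * L ^ 2 * n)) := by
  rw [sobolevSemi, ← Real.sqrt_eq_rpow]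
  refine Real.sqrt_le_sqrt ?_
  rw [← integral_boxDensity n hL, ← integral_const_mul]
  exact integral_mono_of_nonneg (Filter.Eventually.of_forall fun x => sq_nonneg _)
    ((integrable_boxDensity n L).const_mul _) (Filter.Eventually.of_forall h)

/-- A globally smooth, compactly supported modification of
`q ↦ (c₁³ - (c₁² + 2σ₀q)^{3/2}) / (3σ₀)`. -/
theorem exists_truncated_speed {c₁ σ₀ : ℝ} (hc : 0 < c₁) (hσ0 : σ₀ ≠ 0) :
    ∃ h : ℝ → ℝ, ∃ δ > 0, ∃ C ≥ 0, ContDiff ℝ (⊤ : ℕ∞) h ∧ h 0 = 0 ∧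
      (∀ i ≤ 2, ∀ y, ‖iteratedFDeriv ℝ i h y‖ ≤ C) ∧
      ∀ q, |q| ≤ δ → h q = (c₁ ^ 3 - √(c₁ ^ 2 + 2 * σ₀ * q) ^ 3) / (3 * σ₀) := by
  obtain ⟨-, χ, -, hχ, -, hχ0, hχ1, hone, hzero, -, -⟩ := exists_cutoff_primitive
  have hσ : 0 < |σ₀| := abs_pos.2 hσ0
  set δ := c₁ ^ 2 / (8 * |σ₀|) with hδ
  have hδ0 : 0 < δ := by positivity
  have hb : ∀ q, |q * χ (q / δ)| ≤ 2 * δ := fun q => by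
    rw [abs_mul, abs_of_nonneg (hχ0 _)]
    rcases le_total 2 |q / δ| with h | h
    · rw [hzero _ h, mul_zero]
      positivity
    · rw [abs_div, abs_of_pos hδ0, div_le_iff₀ hδ0] at h
      exact (mul_le_of_le_one_right (abs_nonneg _) (hχ1 _)).trans h
  have hpos : ∀ q, c₁ ^ 2 + 2 * σ₀ * (q * χ (q / δ)) ≠ 0 := fun q => by
    have h1 : |2 * σ₀ * (q * χ (q / δ))| ≤ c₁ ^ 2 / 2 := by
      rw [abs_mul, abs_mul, abs_two]
      calc 2 * |σ₀| * |q * χ (q / δ)| ≤ 2 * |σ₀| * (2 * δ) := by gcongr; exact hb q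
        _ = c₁ ^ 2 / 2 := by rw [hδ]; field_simp; norm_num
    have h2 := (abs_le.1 h1).1
    have : 0 < c₁ ^ 2 := by positivity
    linarith
  have hχc : ContDiff ℝ (⊤ : ℕ∞) fun q => q * χ (q / δ) :=
    contDiff_id.mul (hχ.comp (contDiff_id.div_const δ))
  set h : ℝ → ℝ := fun q => (c₁ ^ 3 - √(c₁ ^ 2 + 2 * σ₀ * (q * χ (q / δ))) ^ 3) / (3 * σ₀)
  have hh : ContDiff ℝ (⊤ : ℕ∞) h :=
    (contDiff_const.sub (((contDiff_const.add (contDiff_const.mul hχc)).sqrt hpos).pow 3)).div_const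
      _
  have hsupp : HasCompactSupport h := by
    refine HasCompactSupport.intro (K := Set.Icc (-(2 * δ)) (2 * δ)) isCompact_Icc fun q hq => ?_
    have : 2 ≤ |q / δ| := by
      rw [abs_div, abs_of_pos hδ0, le_div_iff₀ hδ0]
      by_contra! hlt
      exact hq (abs_le.1 hlt.le)
    simp [h, hzero _ this, Real.sqrt_sq hc.le]
  have hC : ∀ i : ℕ, ∃ C, ∀ y, ‖iteratedFDeriv ℝ i h y‖ ≤ C := fun i =>
    (hsupp.iteratedFDeriv i).exists_bound_of_continuous
      (hh.continuous_iteratedFDeriv (by exact_mod_cast le_top))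
  choose C hC using hC
  have hC0 : ∀ i, 0 ≤ C i := fun i => (norm_nonneg _).trans (hC i 0)
  refine ⟨h, δ, hδ0, C 0 + C 1 + C 2, by linarith [hC0 0, hC0 1, hC0 2], hh, ?_,
    fun i hi y => ?_, fun q hq => ?_⟩
  · simp [h, Real.sqrt_sq hc.le]
  · refine (hC i y).trans ?_
    interval_cases i <;> linarith [hC0 0, hC0 1, hC0 2]
  · have : |q / δ| ≤ 1 := by
      rw [abs_div, abs_of_pos hδ0]
      exact (div_le_one hδ0).2 hq
    simp [h, hone _ this]

/-- The one-dimensional slope profile. -/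
def axialSlope (χ : ℝ → ℝ) (ν : ℝ) (n : ℕ) (y : ℝ) : ℝ :=
  ν / n * ∑ m : Fin n, y * χ ((rad n m ^ 2)⁻¹ * y)

section Slope

variable {χ : ℝ → ℝ} {ν : ℝ} {n : ℕ}

theorem contDiff_axialSlope (hχ : ContDiff ℝ (⊤ : ℕ∞) χ) : ContDiff ℝ (⊤ : ℕ∞) (axialSlope χ ν n) :=
  contDiff_const.mul <| ContDiff.sum fun _ _ =>
    contDiff_id.mul (hχ.comp (contDiff_const.mul contDiff_id))

theorem axialSlope_neg (heven : ∀ y, χ (-y) = χ y) (y : ℝ) : axialSlope χ ν n (-y) = -axialSlope χ ν n y := by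
  simp [axialSlope, heven]

theorem axialSlope_nonneg (hν : 0 ≤ ν) (hχ0 : ∀ y, 0 ≤ χ y) {y : ℝ} (hy : 0 ≤ y) :
    0 ≤ axialSlope χ ν n y :=
  mul_nonneg (by positivity) (Finset.sum_nonneg fun m _ => mul_nonneg hy (hχ0 _))

theorem cutoff_eq_zero (hzero : ∀ y, 2 ≤ |y| → χ y = 0) {y : ℝ} (hy : 2 * (1 / 4) ^ n ≤ |y|)
    (m : Fin n) : χ ((rad n m ^ 2)⁻¹ * y) = 0 := by
  have hr := pow_pos (rad_pos n m) 2
  refine hzero _ ?_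
  rw [inv_mul_eq_div, abs_div, abs_of_pos hr, le_div_iff₀ hr]
  linarith [rad_sq_le n m]

theorem axialSlope_eq_zero (hzero : ∀ y, 2 ≤ |y| → χ y = 0) {y : ℝ} (hy : 2 * (1 / 4) ^ n ≤ |y|) :
    axialSlope χ ν n y = 0 := by
  simp [axialSlope, cutoff_eq_zero hzero hy]

theorem abs_axialSlope_le (hν : 0 ≤ ν) (hχ0 : ∀ y, 0 ≤ χ y) (hχ1 : ∀ y, χ y ≤ 1)
    (hzero : ∀ y, 2 ≤ |y| → χ y = 0) (y : ℝ) : |axialSlope χ ν n y| ≤ ν * (2 * (1 / 4) ^ n) := by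
  rcases le_total (2 * (1 / 4) ^ n) |y| with h | h
  · rw [axialSlope_eq_zero hzero h, abs_zero]
    positivity
  · rcases Nat.eq_zero_or_pos n with rfl | hn
    · simp [axialSlope, hν]
    · have hn' : (0 : ℝ) < n := Nat.cast_pos.2 hn
      rw [axialSlope, abs_mul, abs_of_nonneg (by positivity)]
      calc ν / n * |∑ m : Fin n, y * χ ((rad n m ^ 2)⁻¹ * y)|
          ≤ ν / n * ∑ _m : Fin n, 2 * (1 / 4 : ℝ) ^ n := by
            gcongr
            refine (Finset.abs_sum_le_sum_abs _ _).trans (Finset.sum_le_sum fun m _ => ?_)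
            rw [abs_mul, abs_of_nonneg (hχ0 _)]
            exact (mul_le_of_le_one_right (abs_nonneg _) (hχ1 _)).trans h
        _ = ν * (2 * (1 / 4) ^ n) := by
            simp
            field_simp

theorem deriv_axialSlope_zero (hχ : ContDiff ℝ (⊤ : ℕ∞) χ) (hone : χ 0 = 1) (hn : 0 < n) :
    deriv (axialSlope χ ν n) 0 = ν := by
  have hχd : Differentiable ℝ χ := hχ.differentiable (by simp)
  have h : ∀ m ∈ (Finset.univ : Finset (Fin n)),
      HasDerivAt (fun y : ℝ => y * χ ((rad n m ^ 2)⁻¹ * y)) 1 0 := fun m _ => by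
    have h1 : DifferentiableAt ℝ (fun y : ℝ => χ ((rad n m ^ 2)⁻¹ * y)) 0 := by fun_prop
    refine ((hasDerivAt_id (0 : ℝ)).mul h1.hasDerivAt).congr_deriv ?_
    simp [hone]
  refine ((HasDerivAt.fun_sum h).const_mul (ν / n)).deriv.trans ?_
  have hn' : (n : ℝ) ≠ 0 := (Nat.cast_pos.2 hn).ne'
  simp
  field_simp

theorem hasDerivAt_potential {W : ℝ → ℝ} (hW : ∀ y, HasDerivAt W (y * χ y) y) (σ₀ y : ℝ) :
    HasDerivAt (fun y => ∑ m : Fin n, -(ν / (σ₀ * n)) * rad n m ^ 4 * W ((rad n m ^ 2)⁻¹ * y))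
      (-axialSlope χ ν n y / σ₀) y := by
  have h : ∀ m ∈ (Finset.univ : Finset (Fin n)), HasDerivAt
      (fun y => -(ν / (σ₀ * n)) * rad n m ^ 4 * W ((rad n m ^ 2)⁻¹ * y))
      (-(ν / (σ₀ * n)) * (y * χ ((rad n m ^ 2)⁻¹ * y))) y := fun m _ => by
    have hr := (rad_pos n m).ne'
    have h1 := ((hW ((rad n m ^ 2)⁻¹ * y)).comp y
      ((hasDerivAt_id y).const_mul (rad n m ^ 2)⁻¹)).const_mul (-(ν / (σ₀ * n)) * rad n m ^ 4)
    refine h1.congr_deriv ?_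
    field_simp
  refine (HasDerivAt.fun_sum h).congr_deriv ?_
  rw [← Finset.mul_sum, axialSlope]
  ring

end Slope

namespace IsBlob

variable {G : (Fin 3 → ℝ) → ℝ} {L M : ℝ}

theorem hasCompactSupport_profile (hG : IsBlob G L M) (n : ℕ) (κ : ℝ) :
    HasCompactSupport (profile n κ G) := by
  refine HasCompactSupport.intro (K := ⋃ m : Fin n, aniso (rad n m) ⁻¹' blobBox L)
    (isCompact_iUnion fun m => ?_) fun x hx => ?_
  · rw [preimage_aniso_blobBox (rad_pos n m)]
    exact isCompact_Icc
  · simp only [Set.mem_iUnion, not_exists] at hx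
    unfold profile superpose
    refine Finset.sum_eq_zero fun m _ => ?_
    rw [image_eq_zero_of_notMem_tsupport fun h => hx m (hG.tsupport_subset h), mul_zero]

/-- Inside a ball tangent to `{x₀ = 0}` at the origin the profile depends on `x₀` only. -/
theorem profile_eq_of_sqd_lt {W : ℝ → ℝ} (hW : ∀ y, 2 ≤ |y| → W y = 0) {ρ : ℝ} (hρ : 0 < ρ)
    (hGW : ∀ y, y 1 ^ 2 + y 2 ^ 2 ≤ 4 * ρ → G y = W (y 0)) (hG0 : ∀ y, 2 ≤ |y 0| → G y = 0)
    (n : ℕ) (κ : ℝ) {x : Fin 3 → ℝ} (hx : sqd (Pi.single 0 ρ) x < ρ ^ 2) :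
    profile n κ G x = ∑ m : Fin n, κ * rad n m ^ 4 * W ((rad n m ^ 2)⁻¹ * x 0) := by
  unfold profile superpose
  refine Finset.sum_congr rfl fun m _ => ?_
  congr 1
  have hr := pow_pos (rad_pos n m) 2
  simp only [sqd, Fin.sum_univ_three, Pi.single_eq_same] at hx
  simp only [ne_eq, one_ne_zero, not_false_eq_true, Pi.single_eq_of_ne, sub_zero,
    Fin.reduceEq] at hx
  have e0 : aniso (rad n m) x 0 = (rad n m ^ 2)⁻¹ * x 0 := by simp [aniso, wt]
  have e1 : aniso (rad n m) x 1 = (rad n m)⁻¹ * x 1 := by simp [aniso, wt]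
  have e2 : aniso (rad n m) x 2 = (rad n m)⁻¹ * x 2 := by simp [aniso, wt]
  rcases le_total (2 * rad n m ^ 2) (x 0) with h | h
  · have h2 : 2 ≤ |(rad n m ^ 2)⁻¹ * x 0| := by
      refine le_trans ?_ (le_abs_self _)
      rwa [inv_mul_eq_div, le_div_iff₀ hr]
    rw [hW _ h2, hG0 _ (by rwa [e0])]
  · rw [hGW, e0]
    rw [e1, e2, mul_pow, mul_pow, ← mul_add, inv_pow, inv_mul_eq_div, div_le_iff₀ hr]
    nlinarith [mul_le_mul_of_nonneg_left h hρ.le, sq_nonneg (x 0)]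

end IsBlob

theorem contDiff_single_comp {f : (Fin 3 → ℝ) → ℝ} (hf : ContDiff ℝ (⊤ : ℕ∞) f) :
    ContDiff ℝ (⊤ : ℕ∞) fun x => (Pi.single 0 (f x) : Fin 3 → ℝ) :=
  (ContinuousLinearMap.single ℝ (fun _ : Fin 3 => ℝ) 0).contDiff.comp hf

theorem hasCompactSupport_single_comp {f : (Fin 3 → ℝ) → ℝ} (hf : HasCompactSupport f) :
    HasCompactSupport fun x => (Pi.single 0 (f x) : Fin 3 → ℝ) :=
  hf.comp_left (g := fun a => (Pi.single 0 a : Fin 3 → ℝ)) (Pi.single_zero 0)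

theorem single_apply_eq_kron (a : ℝ) (i : Fin 3) :
    (Pi.single 0 a : Fin 3 → ℝ) i = kron i 0 * a := by
  rcases eq_or_ne i 0 with rfl | h
  · simp [kron]
  · simp [kron, h]

theorem norm_iteratedFDeriv_speed_le {h : ℝ → ℝ} {F : (Fin 3 → ℝ) → ℝ} {C A B Φ : ℝ}
    (hh : ContDiff ℝ (⊤ : ℕ∞) h) (hF : ContDiff ℝ (⊤ : ℕ∞) F)
    (hC : ∀ i ≤ 2, ∀ y, ‖iteratedFDeriv ℝ i h y‖ ≤ C) {x : Fin 3 → ℝ}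
    (hA : ‖iteratedFDeriv ℝ 2 F x‖ ^ 4 ≤ A * Φ) (hB : ‖iteratedFDeriv ℝ 3 F x‖ ^ 2 ≤ B * Φ) :
    ‖iteratedFDeriv ℝ 2 (fun y => (Pi.single 0 (h (pd F 0 y)) : Fin 3 → ℝ)) x‖ ^ 2
      ≤ 8 * C ^ 2 * (A + B) * Φ := by
  have hC0 : 0 ≤ C := (norm_nonneg _).trans (hC 0 (by norm_num) 0)
  have h1 := norm_iteratedFDeriv_single_le (hh.comp (contDiff_pd hF 0)) 2 x
  have h2 := norm_iteratedFDeriv_two_comp_le hh (contDiff_pd hF 0) hC x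
  have h3 := norm_iteratedFDeriv_pd_le hF 1 0 x
  have h4 := norm_iteratedFDeriv_pd_le hF 2 0 x
  set a := ‖iteratedFDeriv ℝ 2 F x‖
  set b := ‖iteratedFDeriv ℝ 3 F x‖
  have h5 : ‖iteratedFDeriv ℝ 2 (fun y => (Pi.single 0 (h (pd F 0 y)) : Fin 3 → ℝ)) x‖
      ≤ 2 * C * (a ^ 2 + b) := by
    refine (h1.trans h2).trans ?_
    gcongr
  calc ‖iteratedFDeriv ℝ 2 (fun y => (Pi.single 0 (h (pd F 0 y)) : Fin 3 → ℝ)) x‖ ^ 2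
      ≤ (2 * C * (a ^ 2 + b)) ^ 2 := by gcongr
    _ = 4 * C ^ 2 * (a ^ 2 + b) ^ 2 := by ring
    _ ≤ 4 * C ^ 2 * (2 * (a ^ 4 + b ^ 2)) := by
        gcongr
        nlinarith [sq_nonneg (a ^ 2 - b)]
    _ ≤ 4 * C ^ 2 * (2 * (A * Φ + B * Φ)) := by gcongr
    _ = _ := by ring

/-- Arbitrarily small data without a smooth solution up to a given positive time. -/
theorem exists_small_data {c₁ c₂ σ₀ : ℝ} (σ₁ σ₂ σ₃ σ₄ : ℝ) (hc : c₂ < c₁) (hc2 : 0 < c₂)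
    (hσ0 : σ₀ ≠ 0) {ε τ : ℝ} (hε : 0 < ε) (hτ : 0 < τ) :
    ∃ U₀ U₁ : (Fin 3 → ℝ) → Fin 3 → ℝ,
      (ContDiff ℝ (⊤ : ℕ∞) U₀ ∧ HasCompactSupport U₀ ∧
        ContDiff ℝ (⊤ : ℕ∞) U₁ ∧ HasCompactSupport U₁) ∧
      sobolevSemi 3 U₀ + sobolevSemi 2 U₁ ≤ τ ∧
      ∀ T, ε ≤ T → ¬ ∃ U : Fin 3 → (Fin 3 → ℝ) → ℝ → ℝ,
        ContDiffOn ℝ (⊤ : ℕ∞) (fun p : (Fin 3 → ℝ) × ℝ => fun i : Fin 3 => U i p.1 p.2)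
          (Set.univ ×ˢ Set.Ico 0 T) ∧
        (∀ x : Fin 3 → ℝ, ∀ t ∈ Set.Ioo (0 : ℝ) T, ElasticEq c₁ c₂ σ₀ σ₁ σ₂ σ₃ σ₄ U x t) ∧
        (∀ (x : Fin 3 → ℝ) (i : Fin 3), U i x 0 = U₀ x i) ∧
        (∀ (x : Fin 3 → ℝ) (i : Fin 3),
          derivWithin (fun s => U i x s) (Set.Ici 0) 0 = U₁ x i) := by
  have hc1 : 0 < c₁ := hc2.trans hc
  obtain ⟨g₀, hg₀, hg₀c, H⟩ := not_exists_solution_of_profile σ₁ σ₂ σ₃ σ₄ hc hc2 hσ0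
  obtain ⟨ℓ, hℓ, H⟩ := H ε hε
  obtain ⟨W, χ, hW, hχ, heven, hχ0, hχ1, hone, hzero, hWχ, hWz⟩ := exists_cutoff_primitive
  obtain ⟨h, δ, hδ, C, -, hh, hh0, hC, hhδ⟩ := exists_truncated_speed hc1 hσ0
  set ρ := c₁ * ε with hρ
  have hρ0 : 0 < ρ := by positivity
  obtain ⟨G, hGc, hGs, hGW, hG0, hG3⟩ := exists_blob hW hone hWχ hWz (β := 4 * ρ) (by positivity)
  obtain ⟨M, hG⟩ := exists_isBlob hGc hGs hG3
  set L := 1 + 2 * (4 * ρ)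
  have hL : 0 ≤ L := by positivity
  have hM := hG.bound_nonneg
  set ν := 2 * c₁ / ε with hν
  have hν0 : 0 < ν := by positivity
  set κ₀ := ν / |σ₀|
  set B₃ : ℝ := (27 * κ₀ * M) ^ 2 * (16 * L ^ 2) with hB₃
  set B₂ : ℝ := 8 * C ^ 2 * ((9 * κ₀ * M) ^ 4 + (27 * κ₀ * M) ^ 2) * (16 * L ^ 2) with hB₂
  have hpow : Filter.Tendsto (fun n : ℕ => (1 / 4 : ℝ) ^ n) Filter.atTop (nhds 0) :=
    tendsto_pow_atTop_nhds_zero_of_lt_one (by norm_num) (by norm_num)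
  have hsmall : ∀ a b : ℝ, 0 < b → ∀ᶠ n : ℕ in Filter.atTop, a * (1 / 4 : ℝ) ^ n ≤ b :=
    fun a b hb => by
      have h := hpow.const_mul a
      rw [mul_zero] at h
      exact h.eventually_le_const hb
  have hsqrt : ∀ B : ℝ, Filter.Tendsto (fun n : ℕ => √(B / n)) Filter.atTop (nhds 0) := fun B => by
    have h := (Real.continuous_sqrt.tendsto 0).comp (tendsto_const_div_atTop_nhds_zero_nat B)
    rwa [Real.sqrt_zero] at h
  have hsum := (hsqrt B₃).add (hsqrt B₂)
  rw [add_zero] at hsum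
  obtain ⟨n, hn, hn1, hn2, hn3, hn4⟩ := ((Filter.eventually_gt_atTop 0).and
    ((hsmall 2 ℓ hℓ).and ((hsmall (ν * 2) g₀ hg₀).and ((hsmall (κ₀ * M) δ hδ).and
      (hsum.eventually_le_const hτ))))).exists
  have hn' : (0 : ℝ) < n := Nat.cast_pos.2 hn
  set κ := -(ν / (σ₀ * n)) with hκ
  have hκabs : |κ| = κ₀ / n := by
    rw [hκ, abs_neg, abs_div, abs_mul, abs_of_pos hν0, abs_of_pos hn', div_mul_eq_div_div]
  set F := IsBlob.profile n κ G with hF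
  have hFc : ContDiff ℝ (⊤ : ℕ∞) F := hG.contDiff_profile n κ
  have hFs : HasCompactSupport F := hG.hasCompactSupport_profile n κ
  have hpdF : ∀ x, |pd F 0 x| ≤ δ := fun x => by
    refine (hG.abs_pd_profile_le n κ x).trans (le_of_eq_of_le ?_ hn3)
    rw [hκabs]
    field_simp
  have hqs : HasCompactSupport (pd F 0) :=
    hFs.of_isClosed_subset (isClosed_tsupport _) (tsupport_pd_subset F 0)
  have hF3 : ∀ x, ‖iteratedFDeriv ℝ 3 F x‖ ^ 2 ≤ (27 * |κ| * M) ^ 2 * boxDensity n L x :=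
    hG.norm_iteratedFDeriv_three_profile_le n κ
  have hF2 : ∀ x, ‖iteratedFDeriv ℝ 2 F x‖ ^ 4
      ≤ ((9 * |κ| * M) ^ 4 * n ^ 2) * boxDensity n L x := fun x =>
    (hG.norm_iteratedFDeriv_two_profile_le n κ x).trans_eq (mul_assoc _ _ _).symm
  refine ⟨fun x => Pi.single 0 (F x), fun x => Pi.single 0 (h (pd F 0 x)),
    ⟨contDiff_single_comp hFc, hasCompactSupport_single_comp hFs,
      contDiff_single_comp (hh.comp (contDiff_pd hFc 0)),
      hasCompactSupport_single_comp (hqs.comp_left hh0)⟩, ?_, ?_⟩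
  · refine le_trans (add_le_add ?_ ?_) hn4
    · refine (sobolevSemi_le hL fun x => ?_).trans_eq
        (congrArg Real.sqrt (?_ : (27 * |κ| * M) ^ 2 * (16 * L ^ 2 * n) = B₃ / n))
      · exact (pow_le_pow_left₀ (norm_nonneg _) (norm_iteratedFDeriv_single_le hFc 3 x) 2).trans
          (hF3 x)
      · rw [hκabs, hB₃]
        field_simp
    · refine (sobolevSemi_le hL fun x =>
        norm_iteratedFDeriv_speed_le hh hFc hC (hF2 x) (hF3 x)).trans_eq (congrArg Real.sqrt ?_)
      rw [hκabs, hB₂]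
      field_simp
  · have hpot := hasDerivAt_potential (ν := ν) (n := n) hWχ σ₀
    have hball : ∀ x, sqd (Pi.single 0 ρ) x < ρ ^ 2 →
        F x = ∑ m : Fin n, κ * rad n m ^ 4 * W ((rad n m ^ 2)⁻¹ * x 0) := fun x hx =>
      IsBlob.profile_eq_of_sqd_lt hWz hρ0 hGW hG0 n κ hx
    have hpd : ∀ x, sqd (Pi.single 0 ρ) x < ρ ^ 2 →
        pd F 0 x = -axialSlope χ ν n (x 0) / σ₀ := fun x hx => by
      rw [pd_congr (Filter.eventually_of_mem ((isOpen_sqd_lt _ _).mem_nhds hx) hball)]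
      exact pd_comp_apply (hpot (x 0))
    refine H (axialSlope χ ν n) _ (contDiff_axialSlope hχ) (axialSlope_neg heven)
      (fun y hy => axialSlope_nonneg hν0.le hχ0 hy)
      (fun y hy => axialSlope_eq_zero hzero ((hn1.trans hy.le).trans (le_abs_self y)))
      (fun y => (abs_axialSlope_le hν0.le hχ0 hχ1 hzero y).trans (by rwa [← mul_assoc]))
      (deriv_axialSlope_zero hχ (hone 0 (by simp)) hn) hpot _ _ (fun x hx i => ?_)
      fun x hx i => ?_
    · rw [single_apply_eq_kron, hball x hx]
    · rw [single_apply_eq_kron, hhδ _ (hpdF x), hpd x hx, waveSpeed]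
      congr 6
      field_simp

/-- **Ill-posedness of 3D elastic waves in `H³`** (Theorem 1.1, lifespan part). -/
theorem illposedness_3D_elastic (c₁ c₂ σ₀ σ₁ σ₂ σ₃ σ₄ : ℝ)
    (hc : c₂ < c₁) (hc2 : 0 < c₂) (hσ0 : σ₀ ≠ 0) (hσ1 : σ₁ ≠ 0) :
    ∃ U₀ U₁ : ℝ → (Fin 3 → ℝ) → Fin 3 → ℝ,
      -- a family of smooth compactly supported data, indexed by `η ∈ (0,1)`
      (∀ η ∈ Set.Ioo (0 : ℝ) 1,
        ContDiff ℝ (⊤ : ℕ∞) (U₀ η) ∧ HasCompactSupport (U₀ η) ∧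
        ContDiff ℝ (⊤ : ℕ∞) (U₁ η) ∧ HasCompactSupport (U₁ η)) ∧
      -- (i) `‖U₀^(η)‖_{Ḣ³} + ‖U₁^(η)‖_{Ḣ²} → 0` as `η → 0⁺`
      Filter.Tendsto (fun η => sobolevSemi 3 (U₀ η) + sobolevSemi 2 (U₁ η))
        (nhdsWithin 0 (Set.Ioo 0 1)) (nhds 0) ∧
      -- (ii) the maximal time of existence of smooth solutions shrinks to zero
      (∀ ε : ℝ, 0 < ε → ∃ η₀ ∈ Set.Ioo (0 : ℝ) 1, ∀ η ∈ Set.Ioo (0 : ℝ) η₀,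
        ∀ T : ℝ, ε ≤ T →
          ¬ ∃ U : Fin 3 → (Fin 3 → ℝ) → ℝ → ℝ,
            -- `U ∈ C^∞(ℝ³ × [0,T); ℝ³)`
            ContDiffOn ℝ (⊤ : ℕ∞)
              (fun p : (Fin 3 → ℝ) × ℝ => fun i : Fin 3 => U i p.1 p.2)
              (Set.univ ×ˢ Set.Ico 0 T) ∧
            -- `U` solves the 3D elastic wave system on `ℝ³ × (0,T)`
            (∀ x : Fin 3 → ℝ, ∀ t ∈ Set.Ioo (0 : ℝ) T,
              ElasticEq c₁ c₂ σ₀ σ₁ σ₂ σ₃ σ₄ U x t) ∧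
            -- initial conditions `U(·,0) = U₀^(η)`, `∂_tU(·,0) = U₁^(η)`
            (∀ (x : Fin 3 → ℝ) (i : Fin 3), U i x 0 = U₀ η x i) ∧
            (∀ (x : Fin 3 → ℝ) (i : Fin 3),
              derivWithin (fun s => U i x s) (Set.Ici 0) 0 = U₁ η x i)) := by
  have hdata := fun η : Set.Ioo (0 : ℝ) 1 =>
    exists_small_data σ₁ σ₂ σ₃ σ₄ hc hc2 hσ0 η.2.1 η.2.1
  choose U₀ U₁ hreg hle hno using hdata
  classical
  refine ⟨fun η => if h : η ∈ Set.Ioo (0 : ℝ) 1 then U₀ ⟨η, h⟩ else 0,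
    fun η => if h : η ∈ Set.Ioo (0 : ℝ) 1 then U₁ ⟨η, h⟩ else 0, fun η hη => ?_, ?_,
    fun ε hε => ⟨min ε (1 / 2), ⟨by positivity, (min_le_right _ _).trans_lt (by norm_num)⟩,
      fun η hη T hT => ?_⟩⟩
  · simpa only [dif_pos hη] using hreg ⟨η, hη⟩
  · have hid : Filter.Tendsto (fun η : ℝ => η) (nhdsWithin 0 (Set.Ioo 0 1)) (nhds 0) :=
      Filter.tendsto_id.mono_left nhdsWithin_le_nhds
    refine squeeze_zero' (Filter.Eventually.of_forall fun η => ?_) ?_ hid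
    · exact add_nonneg (Real.rpow_nonneg (integral_nonneg fun _ => sq_nonneg _) _)
        (Real.rpow_nonneg (integral_nonneg fun _ => sq_nonneg _) _)
    · filter_upwards [self_mem_nhdsWithin] with η hη
      simpa only [dif_pos hη] using hle ⟨η, hη⟩
  · have hη1 : η ∈ Set.Ioo (0 : ℝ) 1 :=
      ⟨hη.1, hη.2.trans ((min_le_right _ _).trans_lt (by norm_num))⟩
    simp only [dif_pos hη1]
    exact hno ⟨η, hη1⟩ T ((hη.2.le.trans (min_le_left _ _)).trans hT)
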